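/- For K ∈ 𝒦̄_s^d define Δ₂*(K) := inf{ ‖D∘α_{K,e} − avg(D∘α_{K,e})‖_{L²(S_e,σ⁰_{d−1})} : e ∈ S^d with K ⊆ {x : ⟨x,e⟩ ≥ 0} }. Let C ⊂ S^d be a spherical cap with σ_d(K) = σ_d(C) > 0 and radius α_C < π/2, and let α₀ ∈ (0,π/2) be such that α₀ ≤ α_C. Then U₁(K) ≥ (1 + β·Δ₂*(K)²)·U₁(C), where β := 2·min{ binom(d+1,2)·sin^{d+1}(α₀)·tan^{−2d}(α_C) / (d + d·binom(d+1,2)·(π/2)²·tan^{−d}(α_C)) , (2/π)²·D(π/2 − α_C) }. Moreover Δ₂*(K) ≤ Δ₂(K) for K ∈ 𝒦_s^d. -/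

import Mathlib

open Real MeasureTheory Filter
open scoped RealInnerProductSpace ENNReal NNReal Topology

noncomputable section

/-- The ambient Euclidean space `ℝ^{d+1}`. -/
abbrev Esp (d : ℕ) : Type := EuclideanSpace ℝ (Fin (d + 1))

/-- The unit sphere `S^d ⊂ ℝ^{d+1}`. -/
def uSphere (d : ℕ) : Set (Esp d) := Metric.sphere 0 1

/-- The spherical Lebesgue measure `σ_d` (d-dimensional Hausdorff measure restricted
to the unit sphere). -/
def sigmaMeas (d : ℕ) : Measure (Esp d) := (μH[(d : ℝ)]).restrict (uSphere d)

/-- `ω_{d+1} = σ_d(S^d)`, the total surface area of the unit sphere in `ℝ^{d+1}`. -/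
def omegaTot (d : ℕ) : ℝ := (sigmaMeas d (uSphere d)).toReal

/-- `ω_d`, the `(d-1)`-dimensional measure of the unit sphere `S^{d-1} ⊂ ℝ^d`. -/
def omegaSm (d : ℕ) : ℝ :=
  (μH[((d : ℝ) - 1)] (Metric.sphere (0 : EuclideanSpace ℝ (Fin d)) 1)).toReal

/-- `κ_d`, the volume of the unit ball in `ℝ^d`. -/
def kappaVol (d : ℕ) : ℝ :=
  (volume (Metric.ball (0 : EuclideanSpace ℝ (Fin d)) 1)).toReal

/-- The geodesic (angular) distance `d_s(x,y) = arccos ⟨x,y⟩` on the unit sphere. -/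
def geo {d : ℕ} (x y : Esp d) : ℝ := Real.arccos ⟪x, y⟫

/-- The spherical ball (cap) `B(e,α)` of radius `α` centred at `e`. -/
def cap {d : ℕ} (e : Esp d) (α : ℝ) : Set (Esp d) := {x ∈ uSphere d | geo x e ≤ α}

/-- `K ∈ 𝒦̄_s^d`: a spherically convex body, i.e. the intersection of the unit sphere
with a closed convex cone `C ≠ {0}` which is not a linear subspace. -/
def IsSphConvBody (d : ℕ) (K : Set (Esp d)) : Prop :=
  ∃ C : Set (Esp d), IsClosed C ∧ Convex ℝ C ∧
    (∀ x ∈ C, ∀ t : ℝ, 0 ≤ t → t • x ∈ C) ∧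
    C ≠ {0} ∧ (∀ L : Submodule ℝ (Esp d), C ≠ (L : Set (Esp d))) ∧
    K = C ∩ uSphere d

/-- `K ∈ 𝒦_s^d`: a proper spherically convex body, i.e. the intersection of the unit
sphere with a line-free closed convex cone `C ≠ {0}`. -/
def IsProperSphConvBody (d : ℕ) (K : Set (Esp d)) : Prop :=
  ∃ C : Set (Esp d), IsClosed C ∧ Convex ℝ C ∧
    (∀ x ∈ C, ∀ t : ℝ, 0 ≤ t → t • x ∈ C) ∧
    C ≠ {0} ∧ (∀ x ∈ C, x ≠ 0 → -x ∉ C) ∧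
    K = C ∩ uSphere d

/-- The spherical mean width functional
`U₁(K) = (1/(2 ω_{d+1})) σ_d({x ∈ S^d : x^⊥ ∩ K ≠ ∅})`. -/
def U1 (d : ℕ) (K : Set (Esp d)) : ℝ :=
  (1 / (2 * omegaTot d)) * (sigmaMeas d {x | ∃ y ∈ K, ⟪x, y⟫ = 0}).toReal

/-- `D(x) = ∫₀^x sin^{d-1} t dt`. -/
def Dfun (d : ℕ) (x : ℝ) : ℝ := ∫ t in (0:ℝ)..x, Real.sin t ^ (d - 1)

/-- `S_e = S^d ∩ e^⊥`, the great subsphere orthogonal to `e`. -/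
def equator {d : ℕ} (e : Esp d) : Set (Esp d) := uSphere d ∩ {x | ⟪x, e⟫ = 0}

/-- The rotation invariant probability measure `σ⁰_{d-1}` on the great subsphere `S_e`. -/
def sigma0 (d : ℕ) (e : Esp d) : Measure (Esp d) :=
  (μH[((d : ℝ) - 1)] (equator e))⁻¹ • (μH[((d : ℝ) - 1)]).restrict (equator e)

/-- The spherical radial function `α_{K,e}(u)`: the geodesic distance from `e` to the
boundary of `K` along the great circle through `e` in direction `u ∈ S_e`. -/
def sphRadial {d : ℕ} (K : Set (Esp d)) (e u : Esp d) : ℝ :=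
  sSup {t : ℝ | 0 ≤ t ∧ t ≤ π / 2 ∧ (Real.cos t) • e + (Real.sin t) • u ∈ K}

/-- The set `-int(K*)`: points `e` of the sphere such that `K` is contained in the
open hemisphere centred at `e`. -/
def negIntPolar (d : ℕ) (K : Set (Esp d)) : Set (Esp d) :=
  {e ∈ uSphere d | ∀ x ∈ K, 0 < ⟪e, x⟫}

/-- Points `e` of the sphere such that `K ⊆ {x : ⟨x,e⟩ ≥ 0}` (closed hemisphere). -/
def hemiCenters (d : ℕ) (K : Set (Esp d)) : Set (Esp d) :=
  {e ∈ uSphere d | ∀ x ∈ K, 0 ≤ ⟪x, e⟫}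

/-- The `σ⁰_{d-1}`-average of `D ∘ α_{K,e}` over `S_e`. -/
def avgD (d : ℕ) (K : Set (Esp d)) (e : Esp d) : ℝ :=
  ∫ u, Dfun d (sphRadial K e u) ∂(sigma0 d e)

/-- The `L²(S_e, σ⁰_{d-1})`-deviation of `D ∘ α_{K,e}` from its average. -/
def L2dev (d : ℕ) (K : Set (Esp d)) (e : Esp d) : ℝ :=
  Real.sqrt (∫ u, (Dfun d (sphRadial K e u) - avgD d K e) ^ 2 ∂(sigma0 d e))

/-- `Δ₂(K)`: infimum of the `L²` deviations over `e ∈ -int(K*)`. -/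
def Delta2 (d : ℕ) (K : Set (Esp d)) : ℝ :=
  sInf (L2dev d K '' negIntPolar d K)

/-- `Δ₂*(K)`: infimum of the `L²` deviations over all `e` with
`K ⊆ {x : ⟨x,e⟩ ≥ 0}`. -/
def Delta2Star (d : ℕ) (K : Set (Esp d)) : ℝ :=
  sInf (L2dev d K '' hemiCenters d K)

/-- The centred spherical inradius `r_e(K) = max{r ≥ 0 : B(e,r) ⊆ K}`. -/
def rcent (d : ℕ) (K : Set (Esp d)) (e : Esp d) : ℝ :=
  sSup {r : ℝ | 0 ≤ r ∧ cap e r ⊆ K}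

/-- The centred spherical circumradius `R_e(K) = min{r ≥ 0 : K ⊆ B(e,r)}`. -/
def Rcent (d : ℕ) (K : Set (Esp d)) (e : Esp d) : ℝ :=
  sInf {r : ℝ | 0 ≤ r ∧ K ⊆ cap e r}

/-- The spherical inradius `Σ_r(K) = max{r_e(K) : e ∈ K}`. -/
def SigmaR (d : ℕ) (K : Set (Esp d)) : ℝ :=
  sSup (rcent d K '' K)

/-- The deviation functional `ϑ_r(K) = min{R_e(K) - r_e(K) : e ∈ K, r_e(K) = Σ_r(K)}`. -/
def thetaR (d : ℕ) (K : Set (Esp d)) : ℝ :=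
  sInf ((fun e => Rcent d K e - rcent d K e) '' {e ∈ K | rcent d K e = SigmaR d K})

/-- `Ũ_e(K) = σ_d({x ∈ S^d : (x-e)^⊥ ∩ K ≠ ∅})`. -/
def Utilde (d : ℕ) (e : Esp d) (K : Set (Esp d)) : ℝ :=
  (sigmaMeas d {x | ∃ y ∈ K, ⟪x - e, y⟫ = 0}).toReal

/-- The spherical Hausdorff distance `δ_s`, based on the geodesic metric. -/
def sphHausdorff (d : ℕ) (K L : Set (Esp d)) : ℝ :=
  max (⨆ x ∈ K, ⨅ y ∈ L, geo x y) (⨆ y ∈ L, ⨅ x ∈ K, geo x y)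

/-- Continuity of a functional on `𝒦̄_s^d` with respect to the spherical Hausdorff
metric `δ_s`. -/
def SphContinuous (d : ℕ) (F : Set (Esp d) → ℝ) : Prop :=
  ∀ K, IsSphConvBody d K → ∀ ε > (0:ℝ), ∃ δ > (0:ℝ), ∀ L, IsSphConvBody d L →
    sphHausdorff d K L < δ → |F K - F L| < ε

/-- A hitting functional: continuous, nonnegative, vanishing exactly on one-pointed
sets. -/
def IsHittingFunctional (d : ℕ) (Φ : Set (Esp d) → ℝ) : Prop :=
  SphContinuous d Φ ∧ (∀ K, IsSphConvBody d K → 0 ≤ Φ K) ∧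
    (∀ K, IsSphConvBody d K → (Φ K = 0 ↔ ∃ p, K = {p}))

/-- A size functional: continuous, nonnegative, not identically zero, vanishing on
one-pointed sets. -/
def IsSizeFunctional (d : ℕ) (S : Set (Esp d) → ℝ) : Prop :=
  SphContinuous d S ∧ (∀ K, IsSphConvBody d K → 0 ≤ S K) ∧
    (∃ K, IsSphConvBody d K ∧ S K ≠ 0) ∧
    (∀ p ∈ uSphere d, S ({p} : Set (Esp d)) = 0)

/-- The isoperimetric constant `τ(Φ,Σ,a) = inf{Φ(K) : K ∈ 𝒦̄_s^d, Σ(K) ≥ a}`. -/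
def tauConst (d : ℕ) (Φ S : Set (Esp d) → ℝ) (a : ℝ) : ℝ :=
  sInf (Φ '' {K | IsSphConvBody d K ∧ a ≤ S K})

/-- The spherical convex hull of a set `V ⊆ S^d`: the intersection of the sphere with
the closed convex cone generated by `V`. -/
def sphConvHull (d : ℕ) (V : Set (Esp d)) : Set (Esp d) :=
  {x ∈ uSphere d | ∃ y ∈ convexHull ℝ V, ∃ t : ℝ, 0 < t ∧ x = t • y}

/-- A spherical polytope: the intersection of the sphere with a finitely generated
(polyhedral) cone, which is also a spherically convex body. -/
def IsSphPolytope (d : ℕ) (P : Set (Esp d)) : Prop :=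
  IsSphConvBody d P ∧ ∃ V : Finset (Esp d),
    (V : Set (Esp d)) ⊆ uSphere d ∧ P = sphConvHull d (V : Set (Esp d))

/-- The vertices (extreme points) of a spherical polytope. -/
def sphExtremePoints (d : ℕ) (P : Set (Esp d)) : Set (Esp d) :=
  {x ∈ P | x ∉ sphConvHull d (P \ {x})}

/-- The boundary of `K` relative to the sphere. -/
def sphFrontier (d : ℕ) (K : Set (Esp d)) : Set (Esp d) :=
  {x ∈ K | ∀ ε > (0:ℝ), ∃ y ∈ uSphere d, y ∉ K ∧ dist y x < ε}

/-- The functions `h_m(t) = (-1)^{m+1} e^{-t} + 2 ∑_{i=0}^{⌊m/2⌋} t^{m-2i}/(m-2i)!`. -/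
def hFun (m : ℕ) (t : ℝ) : ℝ :=
  (-1 : ℝ) ^ (m + 1) * Real.exp (-t) +
    2 * ∑ i ∈ Finset.range (m / 2 + 1), t ^ (m - 2 * i) / (Nat.factorial (m - 2 * i) : ℝ)

/-- One-dimensional Brunn–Minkowski inequality for midpoints of compact sets. -/
theorem volume_add_le_two_mul_of_compact {A B S : Set ℝ} (hA : IsCompact A) (hB : IsCompact B)
    (hA0 : A.Nonempty) (hB0 : B.Nonempty) (hS : ∀ a ∈ A, ∀ b ∈ B, (a + b) / 2 ∈ S) :
    volume A + volume B ≤ 2 * volume S := by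
  set a := sSup A
  set b := sInf B
  have ha : a ∈ A := hA.sSup_mem hA0
  have hb : b ∈ B := hB.sInf_mem hB0
  set φ : ℝ → ℝ := fun x => 2 * x - b
  set ψ : ℝ → ℝ := fun x => 2 * x - a
  have hvol : ∀ (c : ℝ) (T : Set ℝ), 2 * volume ((fun x : ℝ => 2 * x - c) ⁻¹' T) = volume T := by
    intro c T
    have h1 : (fun x : ℝ => 2 * x - c) ⁻¹' T = (fun x => 2 * x) ⁻¹' ((fun x => x + (-c)) ⁻¹' T) := by
      ext x; simp [sub_eq_add_neg]
    rw [h1, Real.volume_preimage_mul_left (by norm_num), measure_preimage_add_right, ← mul_assoc,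
      show (2 : ℝ≥0∞) = ENNReal.ofReal 2 by simp, ← ENNReal.ofReal_mul (by norm_num)]
    norm_num [abs_of_pos]
  have hsub : φ ⁻¹' A ∪ ψ ⁻¹' B ⊆ S := by
    rintro x (hx | hx)
    · have := hS _ hx b hb
      simpa [φ] using this
    · have := hS a ha _ hx
      simpa [ψ] using this
  have hdisj : AEDisjoint volume (φ ⁻¹' A) (ψ ⁻¹' B) := by
    refine measure_mono_null (t := {(a + b) / 2}) ?_ (by simp)
    rintro x ⟨h1, h2⟩
    have h3 : 2 * x - b ≤ a := le_csSup hA.bddAbove h1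
    have h4 : b ≤ 2 * x - a := csInf_le hB.bddBelow h2
    simp only [Set.mem_singleton_iff]
    linarith
  have hmeas : MeasurableSet (ψ ⁻¹' B) := by
    refine hB.measurableSet.preimage ?_
    fun_prop
  calc volume A + volume B = 2 * volume (φ ⁻¹' A) + 2 * volume (ψ ⁻¹' B) := by rw [hvol, hvol]
    _ = 2 * volume (φ ⁻¹' A ∪ ψ ⁻¹' B) := by
        rw [measure_union₀ hmeas.nullMeasurableSet hdisj, mul_add]
    _ ≤ 2 * volume S := by gcongr

/-- One-dimensional Brunn–Minkowski inequality for midpoints of measurable sets. -/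
theorem volume_add_le_two_mul {A B S : Set ℝ} (hA : MeasurableSet A) (hB : MeasurableSet B)
    (hA0 : A.Nonempty) (hB0 : B.Nonempty) (hS : ∀ a ∈ A, ∀ b ∈ B, (a + b) / 2 ∈ S) :
    volume A + volume B ≤ 2 * volume S := by
  obtain ⟨a0, ha0⟩ := hA0
  obtain ⟨b0, hb0⟩ := hB0
  have hcpt : ∀ {T : Set ℝ}, MeasurableSet T →
      volume T = ⨆ (K : Set ℝ) (_ : K ⊆ T ∧ IsCompact K), volume K := fun hT => by
    rw [hT.measure_eq_iSup_isCompact]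
    simp only [iSup_and]
  rw [hcpt hA, hcpt hB]
  refine ENNReal.biSup_add_biSup_le' ⟨∅, by simp⟩ ⟨∅, by simp⟩ ?_
  rintro K ⟨hKA, hK⟩ L ⟨hLB, hL⟩
  calc volume K + volume L ≤ volume (insert a0 K) + volume (insert b0 L) := by
        gcongr <;> exact Set.subset_insert _ _
    _ ≤ 2 * volume S := by
        refine volume_add_le_two_mul_of_compact (hK.insert a0) (hL.insert b0) ⟨a0, by simp⟩
          ⟨b0, by simp⟩ ?_
        intro a ha b hb
        exact hS a (Set.insert_subset ha0 hKA ha) b (Set.insert_subset hb0 hLB hb)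

/-- Prékopa–Leindler inequality on the line for functions with supremum one. -/
theorem lintegral_add_le_of_sq_le {F G H : ℝ → ℝ} (hF : Measurable F) (hG : Measurable G)
    (hH : Measurable H) (hF0 : ∀ a, 0 ≤ F a) (hG0 : ∀ a, 0 ≤ G a) (hH0 : ∀ a, 0 ≤ H a)
    (hF1 : ∀ a, F a ≤ 1) (hG1 : ∀ a, G a ≤ 1)
    (hFs : ∀ t < 1, ∃ a, t < F a) (hGs : ∀ t < 1, ∃ a, t < G a)
    (h : ∀ a b, F a * G b ≤ H ((a + b) / 2) ^ 2) :
    (∫⁻ a, ENNReal.ofReal (F a)) + ∫⁻ a, ENNReal.ofReal (G a)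
      ≤ 2 * ∫⁻ a, ENNReal.ofReal (H a) := by
  rw [lintegral_eq_lintegral_meas_lt _ (ae_of_all _ hF0) hF.aemeasurable,
    lintegral_eq_lintegral_meas_lt _ (ae_of_all _ hG0) hG.aemeasurable,
    lintegral_eq_lintegral_meas_lt _ (ae_of_all _ hH0) hH.aemeasurable,
    ← lintegral_add_left, ← lintegral_const_mul]
  · refine setLIntegral_mono' measurableSet_Ioi fun t ht => ?_
    have ht : 0 < t := ht
    rcases lt_or_ge t 1 with ht1 | ht1
    · refine volume_add_le_two_mul (measurableSet_lt measurable_const hF)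
        (measurableSet_lt measurable_const hG) (hFs t ht1) (hGs t ht1) ?_
      intro a ha b hb
      simp only [Set.mem_ofPred_eq] at ha hb ⊢
      refine lt_of_pow_lt_pow_left₀ 2 (hH0 _) (lt_of_lt_of_le ?_ (h a b))
      nlinarith
    · have e1 : {a | t < F a} = ∅ := by
        ext a; simpa using (hF1 a).trans ht1
      have e2 : {a | t < G a} = ∅ := by
        ext a; simpa using (hG1 a).trans ht1
      simp [e1, e2]
  · exact Antitone.measurable fun s t hst => measure_mono fun a (ha : t < _) => hst.trans_lt ha
  · exact Antitone.measurable fun s t hst => measure_mono fun a (ha : t < _) => hst.trans_lt ha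

theorem ENNReal.mul_le_sq_of_add_le {a b c : ℝ≥0∞} (h : a + b ≤ 2 * c) : a * b ≤ c ^ 2 := by
  rcases eq_or_ne c ∞ with rfl | hc
  · simp
  have hs : a + b ≠ ∞ := ne_top_of_le_ne_top (ENNReal.mul_ne_top (by simp) hc) h
  lift a to ℝ≥0 using (ENNReal.add_ne_top.1 hs).1
  lift b to ℝ≥0 using (ENNReal.add_ne_top.1 hs).2
  lift c to ℝ≥0 using hc
  norm_cast at h ⊢
  rw [← NNReal.coe_le_coe] at h ⊢
  push_cast at h ⊢
  nlinarith [sq_nonneg ((a : ℝ) - b), a.2, b.2, c.2]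

/-- Prékopa–Leindler inequality on the line. -/
theorem lintegral_mul_le_sq {f g : ℝ → ℝ≥0∞} {h : ℝ → ℝ} (hf : Measurable f) (hg : Measurable g)
    (hh : Measurable h) (h0 : ∀ a, 0 ≤ h a) {M : ℝ} (hM : ∀ a, h a ≤ M)
    (hfg : ∀ a b, f a * g b ≤ ENNReal.ofReal (h ((a + b) / 2) ^ 2)) :
    (∫⁻ a, f a) * ∫⁻ a, g a ≤ (∫⁻ a, ENNReal.ofReal (h a)) ^ 2 := by
  have fin : ∀ {f g : ℝ → ℝ≥0∞}, (∀ a b, f a * g b ≤ ENNReal.ofReal (h ((a + b) / 2) ^ 2)) →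
      (⨆ a, g a) ≠ 0 → (⨆ a, f a) ≠ ∞ := by
    intro f g hfg hg0
    obtain ⟨b, hb⟩ : ∃ b, g b ≠ 0 := by
      by_contra! hcon
      exact hg0 (by simp [hcon])
    have : (⨆ a, f a) ≤ ENNReal.ofReal (M ^ 2) / g b := by
      refine iSup_le fun a => ?_
      rw [ENNReal.le_div_iff_mul_le (Or.inl hb) (Or.inr ENNReal.ofReal_ne_top)]
      refine (hfg a b).trans (ENNReal.ofReal_le_ofReal ?_)
      exact pow_le_pow_left₀ (h0 _) (hM _) 2
    exact ne_top_of_le_ne_top (ENNReal.div_ne_top ENNReal.ofReal_ne_top hb) this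
  set Mf := ⨆ a, f a
  set Mg := ⨆ a, g a
  rcases eq_or_ne Mf 0 with hf0 | hf0
  · have : ∀ a, f a = 0 := fun a => le_antisymm (hf0 ▸ le_iSup f a) bot_le
    simp [this]
  rcases eq_or_ne Mg 0 with hg0 | hg0
  · have : ∀ a, g a = 0 := fun a => le_antisymm (hg0 ▸ le_iSup g a) bot_le
    simp [this]
  have hft : Mf ≠ ∞ := fin hfg hg0
  have hgt : Mg ≠ ∞ := fin (f := g) (g := f) (fun a b => by
    rw [mul_comm, add_comm]; exact hfg b a) hf0
  have key : ∀ {f : ℝ → ℝ≥0∞} {m : ℝ≥0∞}, (⨆ a, f a) = m → m ≠ 0 → m ≠ ∞ →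
      (∀ a, (f a / m).toReal ≤ 1) ∧ (∀ t < 1, ∃ a, t < (f a / m).toReal) ∧
      (∀ a, ENNReal.ofReal (f a / m).toReal = f a / m) := by
    rintro f m rfl hm hm'
    have h1 : ∀ a, f a / (⨆ a, f a) ≤ 1 := fun a =>
      ENNReal.div_le_of_le_mul (by simpa using le_iSup f a)
    have h2 : ∀ a, f a / (⨆ a, f a) ≠ ∞ := fun a => ne_top_of_le_ne_top (by simp) (h1 a)
    refine ⟨fun a => ?_, fun t ht => ?_, fun a => ENNReal.ofReal_toReal (h2 a)⟩
    · exact ENNReal.toReal_le_of_le_ofReal zero_le_one (by simpa using h1 a)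
    · have : ENNReal.ofReal t * (⨆ a, f a) < ⨆ a, f a := by
        conv_rhs => rw [← one_mul (⨆ a, f a)]
        exact ENNReal.mul_lt_mul_left hm hm' (by simpa using ht)
      obtain ⟨a, ha⟩ := lt_iSup_iff.1 this
      refine ⟨a, ?_⟩
      rw [← ENNReal.lt_div_iff_mul_lt (Or.inl hm) (Or.inl hm')] at ha
      by_contra! hcon
      exact absurd ha (not_lt.2 ((ENNReal.ofReal_toReal (h2 a)).symm.le.trans (ENNReal.ofReal_le_ofReal hcon)))
  obtain ⟨kf1, kf2, kf3⟩ := key (f := f) (m := Mf) rfl hf0 hft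
  obtain ⟨kg1, kg2, kg3⟩ := key (f := g) (m := Mg) rfl hg0 hgt
  set P : ℝ := (Mf * Mg).toReal
  have hPt : Mf * Mg ≠ ∞ := ENNReal.mul_ne_top hft hgt
  have hP : 0 < P := ENNReal.toReal_pos (mul_ne_zero hf0 hg0) hPt
  have main := lintegral_add_le_of_sq_le (F := fun a => (f a / Mf).toReal)
    (G := fun a => (g a / Mg).toReal) (H := fun a => h a / √P) (by fun_prop) (by fun_prop)
    (by fun_prop) (fun _ => ENNReal.toReal_nonneg) (fun _ => ENNReal.toReal_nonneg)
    (fun a => div_nonneg (h0 a) (sqrt_nonneg _)) kf1 kg1 kf2 kg2 (fun a b => by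
      rw [div_pow, Real.sq_sqrt hP.le, le_div_iff₀ hP, ← ENNReal.toReal_mul, ← ENNReal.toReal_mul]
      refine ENNReal.toReal_le_of_le_ofReal (sq_nonneg _) (le_trans (le_of_eq ?_) (hfg a b))
      rw [ENNReal.div_eq_inv_mul, ENNReal.div_eq_inv_mul]
      calc Mf⁻¹ * f a * (Mg⁻¹ * g b) * (Mf * Mg) = (Mf⁻¹ * Mf) * (Mg⁻¹ * Mg) * (f a * g b) := by ring
        _ = f a * g b := by
          rw [ENNReal.inv_mul_cancel hf0 hft, ENNReal.inv_mul_cancel hg0 hgt, one_mul, one_mul])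
  simp only [kf3, kg3] at main
  have main2 := ENNReal.mul_le_sq_of_add_le main
  simp only [ENNReal.div_eq_inv_mul, div_eq_inv_mul] at main2
  rw [lintegral_const_mul _ hf, lintegral_const_mul _ hg] at main2
  simp_rw [ENNReal.ofReal_mul (inv_nonneg.2 (sqrt_nonneg P))] at main2
  rw [lintegral_const_mul _ (by fun_prop), mul_pow, ← ENNReal.ofReal_pow (by positivity), inv_pow,
    Real.sq_sqrt hP.le, ENNReal.ofReal_inv_of_pos hP, ENNReal.ofReal_toReal hPt] at main2
  calc (∫⁻ a, f a) * ∫⁻ a, g a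
      = (Mf * Mg) * (Mf⁻¹ * (∫⁻ a, f a) * (Mg⁻¹ * ∫⁻ a, g a)) := by
        calc _ = (Mf * Mf⁻¹) * (Mg * Mg⁻¹) * ((∫⁻ a, f a) * ∫⁻ a, g a) := by
              rw [ENNReal.mul_inv_cancel hf0 hft, ENNReal.mul_inv_cancel hg0 hgt, one_mul, one_mul]
          _ = _ := by ring
    _ ≤ (Mf * Mg) * ((Mf * Mg)⁻¹ * (∫⁻ a, ENNReal.ofReal (h a)) ^ 2) := by gcongr
    _ = _ := by
        rw [← mul_assoc, ENNReal.mul_inv_cancel (mul_ne_zero hf0 hg0) hPt, one_mul]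

theorem lintegral_Ioi_eq_lintegral_exp (φ : ℝ → ℝ≥0∞) :
    ∫⁻ s in Set.Ioi 0, φ s = ∫⁻ a, ENNReal.ofReal (rexp a) * φ (rexp a) := by
  have := lintegral_image_eq_lintegral_abs_deriv_mul (s := Set.univ) MeasurableSet.univ
    (fun x _ => (Real.hasDerivAt_exp x).hasDerivWithinAt) Real.exp_injective.injOn φ
  simpa [Set.image_univ, Real.range_exp, abs_of_pos (Real.exp_pos _)] using this

theorem lintegral_Ioi_gaussian :
    ∫⁻ s in Set.Ioi (0 : ℝ), ENNReal.ofReal (rexp (-s ^ 2 / 2)) = ENNReal.ofReal √(π / 2) := by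
  have h := integral_gaussian_Ioi (1 / 2)
  have e : ∀ s : ℝ, rexp (-s ^ 2 / 2) = rexp (-(1 / 2) * s ^ 2) := fun s => by ring_nf
  simp_rw [e]
  rw [← ofReal_integral_eq_lintegral_ofReal, h]
  · congr 1
    rw [show π / (1 / 2) = 2 ^ 2 * (π / 2) by ring, Real.sqrt_mul (by positivity),
      Real.sqrt_sq (by positivity)]
    ring
  · exact (integrable_exp_neg_mul_sq (by norm_num)).integrableOn
  · exact ae_of_all _ fun _ => (Real.exp_pos _).le

/-- The one-dimensional functional Santaló inequality on half-lines. -/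
theorem lintegral_Ioi_mul_le {φ ψ : ℝ → ℝ≥0∞} (hφ : Measurable φ) (hψ : Measurable ψ) {c : ℝ}
    (hc : 0 ≤ c)
    (h : ∀ s > 0, ∀ t > 0, φ s * ψ t ≤ ENNReal.ofReal (c * rexp (-(s * t)))) :
    (∫⁻ s in Set.Ioi 0, φ s) * ∫⁻ t in Set.Ioi 0, ψ t ≤ ENNReal.ofReal (c * (π / 2)) := by
  rw [lintegral_Ioi_eq_lintegral_exp, lintegral_Ioi_eq_lintegral_exp]
  refine (lintegral_mul_le_sq (h := fun m => √c * (rexp m * rexp (-(rexp m) ^ 2 / 2)))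
    (M := √c) (by fun_prop) (by fun_prop) (by fun_prop) (fun a => by positivity) ?_ ?_).trans ?_
  · intro a
    refine mul_le_of_le_one_right (sqrt_nonneg _) ?_
    rw [← Real.exp_add, Real.exp_le_one_iff]
    nlinarith [Real.add_one_le_exp a, sq_nonneg (rexp a - 1)]
  · intro a b
    have hab := h (rexp a) (Real.exp_pos a) (rexp b) (Real.exp_pos b)
    calc ENNReal.ofReal (rexp a) * φ (rexp a) * (ENNReal.ofReal (rexp b) * ψ (rexp b))
        = ENNReal.ofReal (rexp a) * ENNReal.ofReal (rexp b) * (φ (rexp a) * ψ (rexp b)) := by ring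
      _ ≤ ENNReal.ofReal (rexp a) * ENNReal.ofReal (rexp b) *
          ENNReal.ofReal (c * rexp (-(rexp a * rexp b))) := by gcongr
      _ = _ := by
        rw [← ENNReal.ofReal_mul (Real.exp_pos a).le, ← ENNReal.ofReal_mul (by positivity)]
        congr 1
        rw [mul_pow, Real.sq_sqrt hc, mul_pow]
        have e1 : rexp ((a + b) / 2) ^ 2 = rexp a * rexp b := by
          rw [← Real.exp_nat_mul, ← Real.exp_add]; congr 1; push_cast; ring
        rw [e1, ← Real.exp_nat_mul]
        have : (2 : ℕ) * (-(rexp a * rexp b) / 2) = -(rexp a * rexp b) := by push_cast; ring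
        rw [this]; ring
  · have := lintegral_Ioi_eq_lintegral_exp (fun s => ENNReal.ofReal (rexp (-s ^ 2 / 2)))
    rw [lintegral_Ioi_gaussian] at this
    simp_rw [ENNReal.ofReal_mul (sqrt_nonneg c), ENNReal.ofReal_mul (Real.exp_pos _).le]
    rw [lintegral_const_mul _ (by fun_prop), ← this, mul_pow, ← ENNReal.ofReal_pow (sqrt_nonneg _),
      ← ENNReal.ofReal_pow (sqrt_nonneg _), Real.sq_sqrt hc, Real.sq_sqrt (by positivity),
      ENNReal.ofReal_mul hc]

/-- The functional Blaschke–Santaló inequality in `ℝⁿ` for functions whose barycentre is the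
origin. -/
def CenteredSantalo (n : ℕ) : Prop :=
  ∀ f g : (Fin n → ℝ) → ℝ≥0∞, Measurable f → Measurable g → ∫⁻ x, f x ≠ ∞ →
    (∀ i, Integrable (fun x : Fin n → ℝ => x i) (volume.withDensity f)) →
    (∀ i, ∫ x : Fin n → ℝ, x i ∂(volume.withDensity f) = 0) →
    (∀ x y, f x * g y ≤ ENNReal.ofReal (rexp (-(x ⬝ᵥ y)))) →
    (∫⁻ x, f x) * ∫⁻ y, g y ≤ ENNReal.ofReal ((2 * π) ^ n)

theorem lintegral_sign_mul {ε : ℝ} (hε : ε = 1 ∨ ε = -1) (F : ℝ → ℝ≥0∞) :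
    ∫⁻ s, F (ε * s) = ∫⁻ s, F s := by
  rcases hε with rfl | rfl
  · simp
  · simpa using lintegral_neg_eq_self (μ := (volume : Measure ℝ)) F

theorem lintegral_prod_shear {n : ℕ} {ε : ℝ} (hε : ε = 1 ∨ ε = -1) (c : ℝ) (z v : Fin n → ℝ)
    {Φ : ℝ × (Fin n → ℝ) → ℝ≥0∞} (hΦ : Measurable Φ) :
    ∫⁻ x, ∫⁻ s, Φ (c + ε * s, z + x + (ε * s) • v) = ∫⁻ p, Φ p := by
  rw [lintegral_lintegral_swap (by fun_prop), Measure.volume_eq_prod, lintegral_prod _ (by fun_prop)]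
  rw [lintegral_sign_mul hε (fun s => ∫⁻ x, Φ (c + s, z + x + s • v)),
    ← lintegral_add_left_eq_self (fun a => ∫⁻ b, Φ (a, b)) c]
  refine lintegral_congr fun s => ?_
  rw [← lintegral_add_left_eq_self (fun b => Φ (c + s, b)) (z + s • v)]
  refine lintegral_congr fun x => ?_
  congr 2
  abel

/-- Sections of a mass distribution along a direction push forward to its projection. -/
theorem withDensity_shear_eq_map {n : ℕ} {ε : ℝ} (hε : ε = 1 ∨ ε = -1) (c : ℝ) (z v : Fin n → ℝ)
    {f : ℝ × (Fin n → ℝ) → ℝ≥0∞} (hf : Measurable f) :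
    volume.withDensity (fun x => ∫⁻ s in Set.Ioi 0, f (c + ε * s, z + x + (ε * s) • v)) =
      ((volume.withDensity f).restrict {p | 0 < ε * (p.1 - c)}).map
        (fun p => p.2 - z - (p.1 - c) • v) := by
  have hH : MeasurableSet {p : ℝ × (Fin n → ℝ) | 0 < ε * (p.1 - c)} :=
    measurableSet_lt measurable_const (by fun_prop)
  have hT : Measurable (fun p : ℝ × (Fin n → ℝ) => p.2 - z - (p.1 - c) • v) := by fun_prop
  ext S hS
  rw [withDensity_apply _ hS, Measure.map_apply hT hS, Measure.restrict_apply (hT hS),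
    withDensity_apply _ ((hT hS).inter hH), ← lintegral_indicator ((hT hS).inter hH),
    ← lintegral_prod_shear hε c z v (hf.indicator ((hT hS).inter hH)), ← lintegral_indicator hS]
  refine lintegral_congr fun x => ?_
  have hεε : ∀ s, ε * (ε * s) = s := fun s => by rcases hε with rfl | rfl <;> ring
  by_cases hx : x ∈ S
  · rw [Set.indicator_of_mem hx, ← lintegral_indicator measurableSet_Ioi]
    refine lintegral_congr fun s => ?_
    by_cases hs : 0 < s
    · rw [Set.indicator_of_mem (by exact hs), Set.indicator_of_mem]
      refine ⟨?_, ?_⟩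
      · simpa [add_sub_cancel_left] using (by convert hx using 1; abel :
          z + x + (ε * s) • v - z - (ε * s) • v ∈ S)
      · simpa [hεε] using hs
    · rw [Set.indicator_of_notMem (by exact hs), Set.indicator_of_notMem]
      rintro ⟨-, h2⟩
      exact hs (by simpa [hεε] using h2)
  · rw [Set.indicator_of_notMem hx]
    symm
    rw [lintegral_eq_zero_iff' (by
      have := hf.indicator ((hT hS).inter hH)
      fun_prop)]
    refine ae_of_all _ fun s => Set.indicator_of_notMem ?_ _
    rintro ⟨h1, -⟩
    refine hx ?_
    have : z + x + (ε * s) • v - z - (c + ε * s - c) • v = x := by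
      rw [add_sub_cancel_left]; abel
    simpa only [Set.mem_preimage, this] using h1

theorem santalo_half {n : ℕ} (hB : CenteredSantalo n) {ε : ℝ} (hε : ε = 1 ∨ ε = -1) (c : ℝ)
    (z v : Fin n → ℝ) {f g : ℝ × (Fin n → ℝ) → ℝ≥0∞} (hf : Measurable f) (hg : Measurable g)
    (hfin : ∫⁻ p, f p ≠ ∞)
    (hintg : ∀ i, Integrable (fun p : ℝ × (Fin n → ℝ) => p.2 i - z i - (p.1 - c) * v i)
      (volume.withDensity f))
    (hbar : ∀ i, ∫ p in {p | 0 < ε * (p.1 - c)}, (p.2 i - z i - (p.1 - c) * v i)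
      ∂(volume.withDensity f) = 0)
    (hfg : ∀ s x t y, f (c + s, z + x) * g (t, y) ≤ ENNReal.ofReal (rexp (-(s * t + x ⬝ᵥ y)))) :
    volume.withDensity f {p | 0 < ε * (p.1 - c)} *
      (∫⁻ y, ∫⁻ t in Set.Ioi 0, g (ε * t - v ⬝ᵥ y, y)) ≤
        ENNReal.ofReal (π / 2 * (2 * π) ^ n) := by
  set F : (Fin n → ℝ) → ℝ≥0∞ := fun x => ∫⁻ s in Set.Ioi 0, f (c + ε * s, z + x + (ε * s) • v)
    with hF
  set G : (Fin n → ℝ) → ℝ≥0∞ := fun y => ∫⁻ t in Set.Ioi 0, g (ε * t - v ⬝ᵥ y, y) with hG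
  have hdot : Measurable fun y : Fin n → ℝ => v ⬝ᵥ y := by
    simp only [dotProduct]; fun_prop
  have hFm : Measurable F := Measurable.lintegral_prod_right' (f := fun q : (Fin n → ℝ) × ℝ =>
    f (c + ε * q.2, z + q.1 + (ε * q.2) • v)) (by fun_prop)
  have hGm : Measurable G := Measurable.lintegral_prod_right' (f := fun q : (Fin n → ℝ) × ℝ =>
    g (ε * q.2 - v ⬝ᵥ q.1, q.1)) (by fun_prop)
  have hmap := withDensity_shear_eq_map hε c z v hf
  rw [← hF] at hmap
  have hT : Measurable (fun p : ℝ × (Fin n → ℝ) => p.2 - z - (p.1 - c) • v) := by fun_prop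
  have hmass : ∫⁻ x, F x = volume.withDensity f {p | 0 < ε * (p.1 - c)} := by
    have := congrArg (fun m => m Set.univ) hmap
    simpa [Measure.map_apply hT, withDensity_apply] using this
  have hcoord : ∀ i, AEStronglyMeasurable (fun x : Fin n → ℝ => x i)
      (((volume.withDensity f).restrict {p | 0 < ε * (p.1 - c)}).map
        (fun p => p.2 - z - (p.1 - c) • v)) := fun i =>
    (measurable_pi_apply i).aestronglyMeasurable
  have hε2 : ε * ε = 1 := by rcases hε with rfl | rfl <;> norm_num
  have := hB F (fun y => ENNReal.ofReal (2 / π) * G y) hFm (by fun_prop) ?_ ?_ ?_ ?_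
  · rw [lintegral_const_mul _ hGm, hmass] at this
    calc _ = ENNReal.ofReal (π / 2) * ((volume.withDensity f {p | 0 < ε * (p.1 - c)}) *
          (ENNReal.ofReal (2 / π) * ∫⁻ y, G y)) := by
          rw [mul_left_comm, ← mul_assoc (ENNReal.ofReal (π / 2)), ← ENNReal.ofReal_mul
            (by positivity), show π / 2 * (2 / π) = 1 by field_simp]
          simp
      _ ≤ ENNReal.ofReal (π / 2) * ENNReal.ofReal ((2 * π) ^ n) := by gcongr
      _ = _ := by rw [ENNReal.ofReal_mul (by positivity)]
  · rw [hmass]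
    refine ne_top_of_le_ne_top hfin ((measure_mono (Set.subset_univ _)).trans ?_)
    simp [withDensity_apply]
  · intro i
    rw [hmap, integrable_map_measure (hcoord i) hT.aemeasurable]
    exact (hintg i).restrict
  · intro i
    rw [hmap, integral_map hT.aemeasurable (hcoord i)]
    exact hbar i
  · intro x y
    have := lintegral_Ioi_mul_le (φ := fun s => f (c + ε * s, z + x + (ε * s) • v))
      (ψ := fun t => g (ε * t - v ⬝ᵥ y, y)) (c := rexp (-(x ⬝ᵥ y))) (by fun_prop) (by fun_prop)
      (Real.exp_pos _).le (fun s _ t _ => by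
        rw [add_assoc]
        refine (hfg _ _ _ _).trans (le_of_eq ?_)
        rw [← Real.exp_add, add_dotProduct, smul_dotProduct]
        congr 2
        simp only [smul_eq_mul]
        linear_combination (-(s * t)) * hε2)
    calc F x * (ENNReal.ofReal (2 / π) * G y) = ENNReal.ofReal (2 / π) * (F x * G y) := by ring
      _ ≤ ENNReal.ofReal (2 / π) * ENNReal.ofReal (rexp (-(x ⬝ᵥ y)) * (π / 2)) := by gcongr
      _ = _ := by
        rw [← ENNReal.ofReal_mul (by positivity)]
        congr 1
        field_simp

theorem lintegral_half_add_half {n : ℕ} (v : Fin n → ℝ) {g : ℝ × (Fin n → ℝ) → ℝ≥0∞}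
    (hg : Measurable g) :
    (∫⁻ y, ∫⁻ t in Set.Ioi 0, g (1 * t - v ⬝ᵥ y, y)) +
      (∫⁻ y, ∫⁻ t in Set.Ioi 0, g (-1 * t - v ⬝ᵥ y, y)) = ∫⁻ p, g p := by
  have hdot : Measurable fun y : Fin n → ℝ => v ⬝ᵥ y := by
    simp only [dotProduct]; fun_prop
  have hGm : Measurable fun y => ∫⁻ t in Set.Ioi 0, g (1 * t - v ⬝ᵥ y, y) :=
    Measurable.lintegral_prod_right' (f := fun q : (Fin n → ℝ) × ℝ =>
    g (1 * q.2 - v ⬝ᵥ q.1, q.1)) (by fun_prop)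
  rw [← lintegral_add_left hGm, Measure.volume_eq_prod, lintegral_prod_symm _ (by fun_prop)]
  refine lintegral_congr fun y => ?_
  set G : ℝ → ℝ≥0∞ := fun t => g (t - v ⬝ᵥ y, y) with hG
  have h2 : ∫⁻ t in Set.Ioi 0, G (-1 * t) = ∫⁻ t in Set.Iic 0, G t := by
    rw [← setLIntegral_congr (μ := volume) Iio_ae_eq_Iic, ← lintegral_indicator measurableSet_Ioi,
      ← lintegral_indicator measurableSet_Iio,
      ← lintegral_neg_eq_self (fun a => (Set.Iio 0).indicator (fun t => G t) a)]
    refine lintegral_congr fun t => ?_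
    simp [Set.indicator]
  have h3 : ∫⁻ x, g (x, y) = ∫⁻ t, G t :=
    (lintegral_sub_right_eq_self (fun x => g (x, y)) (v ⬝ᵥ y)).symm
  have h4 := lintegral_add_compl (μ := volume) (fun t => G t) (measurableSet_Iic (a := (0 : ℝ)))
  rw [Set.compl_Iic] at h4
  rw [h3, ← h4, ← h2, add_comm]
  simp [hG]

theorem exists_measure_Ioi_eq_measure_Iio (ν : Measure ℝ) [IsFiniteMeasure ν] [NullSingletonClass ν] :
    ∃ c, ν (Set.Ioi c) = ν Set.univ / 2 ∧ ν (Set.Iio c) = ν Set.univ / 2 := by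
  rcases eq_or_ne (ν Set.univ) 0 with h0 | h0
  · exact ⟨0, by simp [Measure.measure_univ_eq_zero.1 h0], by simp [Measure.measure_univ_eq_zero.1 h0]⟩
  have hc : Continuous fun x => ν.real (Set.Iic x) := by
    have h := intervalIntegral.continuous_primitive (μ := ν) (f := fun _ => (1 : ℝ))
      (fun a b => by simp) 0
    have h2 : ∀ x, ∫ _ in (0:ℝ)..x, (1 : ℝ) ∂ν = ν.real (Set.Iic x) - ν.real (Set.Iic 0) := by
      intro x
      rw [← intervalIntegral.integral_Iic_sub_Iic (by simp) (by simp)]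
      simp
    simp only [h2] at h
    simpa using h.add_const (ν.real (Set.Iic 0))
  have hpos : 0 < ν.real Set.univ := by
    rw [measureReal_def]; exact ENNReal.toReal_pos h0 (measure_ne_top _ _)
  have htop : Tendsto (fun x => ν.real (Set.Iic x)) atTop (𝓝 (ν.real Set.univ)) :=
    (ENNReal.tendsto_toReal (measure_ne_top _ _)).comp (tendsto_measure_Iic_atTop ν)
  have hbot : Tendsto (fun x => ν.real (Set.Iic x)) atBot (𝓝 0) := by
    have h := (ENNReal.tendsto_toReal (measure_ne_top _ _)).comp (tendsto_measure_Ici_atBot ν)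
    have h' := (tendsto_const_nhds (x := ν.real Set.univ)).sub h
    rw [← measureReal_def, sub_self] at h'
    refine h'.congr fun x => ?_
    simp only [Function.comp_apply, ← measureReal_def]
    rw [← measureReal_compl measurableSet_Ici, Set.compl_Ici, measureReal_congr Iio_ae_eq_Iic]
  obtain ⟨a, ha⟩ := (hbot.eventually (ge_mem_nhds (half_pos hpos))).exists
  obtain ⟨b, hb⟩ := (htop.eventually (le_mem_nhds (half_lt_self hpos))).exists
  obtain ⟨c, hc⟩ := mem_range_of_exists_le_of_exists_ge hc ⟨a, ha⟩ ⟨b, hb⟩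
  have hI : ν (Set.Iic c) = ν Set.univ / 2 := by
    rw [← ENNReal.toReal_eq_toReal_iff' (measure_ne_top _ _)
      (ENNReal.div_ne_top (measure_ne_top _ _) (by simp))]
    simpa [measureReal_def] using hc
  refine ⟨c, ?_, by rw [measure_congr Iio_ae_eq_Iic, hI]⟩
  rw [← Set.compl_Iic, measure_compl measurableSet_Iic (measure_ne_top _ _), hI]
  exact ENNReal.sub_eq_of_eq_add (ENNReal.div_ne_top (measure_ne_top _ _) (by simp))
    (ENNReal.add_halves _).symm

/-- The inductive step of the functional Blaschke–Santaló inequality: some translate of `f`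
satisfies it against every dual function. -/
theorem exists_santalo_point_prod {n : ℕ} (hB : CenteredSantalo n) {f : ℝ × (Fin n → ℝ) → ℝ≥0∞}
    (hf : Measurable f) (h0 : ∫⁻ p, f p ≠ 0) (hfin : ∫⁻ p, f p ≠ ∞)
    (h1 : Integrable (fun p : ℝ × (Fin n → ℝ) => p.1) (volume.withDensity f))
    (h2 : ∀ i, Integrable (fun p : ℝ × (Fin n → ℝ) => p.2 i) (volume.withDensity f)) :
    ∃ (c : ℝ) (z : Fin n → ℝ), ∀ g : ℝ × (Fin n → ℝ) → ℝ≥0∞, Measurable g →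
      (∀ s x t y, f (c + s, z + x) * g (t, y) ≤ ENNReal.ofReal (rexp (-(s * t + x ⬝ᵥ y)))) →
      (∫⁻ p, f p) * ∫⁻ p, g p ≤ ENNReal.ofReal ((2 * π) ^ (n + 1)) := by
  set μ := (volume : Measure (ℝ × (Fin n → ℝ))).withDensity f with hμ
  have huniv : μ Set.univ = ∫⁻ p, f p := by simp [hμ, withDensity_apply]
  have : IsFiniteMeasure μ := ⟨by rw [huniv]; exact hfin.lt_top⟩
  have hnoat : NullSingletonClass (μ.map Prod.fst) := ⟨fun a => by
    rw [Measure.map_apply measurable_fst (measurableSet_singleton a)]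
    refine withDensity_absolutelyContinuous _ _ ?_
    rw [← Set.prod_univ, Measure.volume_eq_prod, Measure.prod_prod]
    simp⟩
  obtain ⟨c, hc1, hc2⟩ := exists_measure_Ioi_eq_measure_Iio (μ.map Prod.fst)
  rw [Measure.map_apply measurable_fst measurableSet_Ioi, Measure.map_apply measurable_fst
    MeasurableSet.univ, Set.preimage_univ, huniv] at hc1
  rw [Measure.map_apply measurable_fst measurableSet_Iio, Measure.map_apply measurable_fst
    MeasurableSet.univ, Set.preimage_univ, huniv] at hc2
  have e1 : {p : ℝ × (Fin n → ℝ) | 0 < (1 : ℝ) * (p.1 - c)} = Prod.fst ⁻¹' Set.Ioi c := by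
    ext p; simp
  have e2 : {p : ℝ × (Fin n → ℝ) | 0 < (-1 : ℝ) * (p.1 - c)} = Prod.fst ⁻¹' Set.Iio c := by
    ext p; simp
  set I := (∫⁻ p, f p).toReal with hI
  have hIpos : 0 < I := ENNReal.toReal_pos h0 hfin
  set Hp : Set (ℝ × (Fin n → ℝ)) := Prod.fst ⁻¹' Set.Ioi c
  set Hm : Set (ℝ × (Fin n → ℝ)) := Prod.fst ⁻¹' Set.Iio c
  have hHp : MeasurableSet Hp := measurable_fst measurableSet_Ioi
  have hHm : MeasurableSet Hm := measurable_fst measurableSet_Iio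
  have hrp : μ.real Hp = I / 2 := by simp [measureReal_def, hc1, hI]
  have hrm : μ.real Hm = I / 2 := by simp [measureReal_def, hc2, hI]
  have h1c : Integrable (fun p : ℝ × (Fin n → ℝ) => p.1 - c) μ := h1.sub (integrable_const c)
  set Mp := ∫ p in Hp, (p.1 - c) ∂μ
  set Mm := ∫ p in Hm, (p.1 - c) ∂μ
  have hMp : 0 < Mp := by
    rw [setIntegral_pos_iff_support_of_nonneg_ae _ h1c.integrableOn]
    · rw [Set.inter_eq_right.2, hc1]
      · exact ENNReal.half_pos h0
      · intro p hp; exact (sub_pos.2 hp).ne'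
    · filter_upwards [ae_restrict_mem hHp] with p hp using (sub_pos.2 hp).le
  have hMm : Mm ≤ 0 := setIntegral_nonpos hHm fun p hp => (sub_neg.2 hp).le
  set v : Fin n → ℝ := fun i => (∫ p in Hp, p.2 i ∂μ - ∫ p in Hm, p.2 i ∂μ) / (Mp - Mm) with hv
  set z : Fin n → ℝ := fun i => (∫ p in Hp, p.2 i ∂μ - v i * Mp) / (I / 2) with hz
  have hintg : ∀ i, Integrable (fun p : ℝ × (Fin n → ℝ) => p.2 i - z i - (p.1 - c) * v i) μ :=
    fun i => ((h2 i).sub (integrable_const _)).sub (h1c.mul_const _)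
  have hcalc : ∀ (H : Set (ℝ × (Fin n → ℝ))) i,
      ∫ p in H, (p.2 i - z i - (p.1 - c) * v i) ∂μ =
        ∫ p in H, p.2 i ∂μ - μ.real H * z i - (∫ p in H, (p.1 - c) ∂μ) * v i := by
    intro H i
    have h3 : Integrable (fun p : ℝ × (Fin n → ℝ) => p.2 i - z i) μ :=
      (h2 i).sub (integrable_const _)
    rw [integral_sub h3.integrableOn (h1c.mul_const _).integrableOn,
      integral_sub (h2 i).integrableOn (integrable_const _), integral_mul_const]
    simp
  have hzi : ∀ i, I / 2 * z i = ∫ p in Hp, p.2 i ∂μ - v i * Mp := fun i => by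
    simp only [hz]; field_simp
  have hvi : ∀ i, v i * (Mp - Mm) = ∫ p in Hp, p.2 i ∂μ - ∫ p in Hm, p.2 i ∂μ := fun i =>
    div_mul_cancel₀ _ (by linarith)
  refine ⟨c, z, fun g hg hfg => ?_⟩
  have A := santalo_half hB (ε := 1) (Or.inl rfl) c z v hf hg hfin hintg (fun i => by
    rw [e1, hcalc, hrp, hzi]; ring) hfg
  have B := santalo_half hB (ε := -1) (Or.inr rfl) c z v hf hg hfin hintg (fun i => by
    rw [e2, hcalc, hrm, hzi]; linear_combination hvi i) hfg
  rw [e1, hc1] at A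
  rw [e2, hc2] at B
  rw [← lintegral_half_add_half v hg]
  have hhalf : ∫⁻ p, f p = 2 * ((∫⁻ p, f p) / 2) := by
    rw [ENNReal.mul_div_cancel (by simp) (by simp)]
  rw [hhalf, mul_assoc, mul_add]
  calc _ ≤ 2 * (ENNReal.ofReal (π / 2 * (2 * π) ^ n) + ENNReal.ofReal (π / 2 * (2 * π) ^ n)) := by
        gcongr
    _ = _ := by
        rw [← ENNReal.ofReal_add (by positivity) (by positivity), ← ENNReal.ofReal_ofNat 2,
          ← ENNReal.ofReal_mul (by positivity)]
        congr 1; ring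

theorem MeasureTheory.MeasurePreserving.withDensity_comp {α β : Type*} [MeasurableSpace α]
    [MeasurableSpace β] {μ : Measure α} {ν : Measure β} {T : α → β} (hT : MeasurePreserving T μ ν)
    {f : β → ℝ≥0∞} (hf : Measurable f) :
    MeasurePreserving T (μ.withDensity (f ∘ T)) (ν.withDensity f) := by
  refine ⟨hT.measurable, ?_⟩
  ext S hS
  rw [Measure.map_apply hT.measurable hS, withDensity_apply _ hS,
    withDensity_apply _ (hT.measurable hS)]
  exact hT.setLIntegral_comp_preimage hS hf

theorem exists_santalo_point {n : ℕ} (hB : CenteredSantalo n) {f : (Fin (n + 1) → ℝ) → ℝ≥0∞}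
    (hf : Measurable f) (h0 : ∫⁻ x, f x ≠ 0) (hfin : ∫⁻ x, f x ≠ ∞)
    (h1 : ∀ i, Integrable (fun x : Fin (n + 1) → ℝ => x i) (volume.withDensity f)) :
    ∃ z : Fin (n + 1) → ℝ, ∀ g : (Fin (n + 1) → ℝ) → ℝ≥0∞, Measurable g →
      (∀ x y, f (z + x) * g y ≤ ENNReal.ofReal (rexp (-(x ⬝ᵥ y)))) →
      (∫⁻ x, f x) * ∫⁻ y, g y ≤ ENNReal.ofReal ((2 * π) ^ (n + 1)) := by
  have hE := (volume_preserving_piFinSuccAbove (fun _ : Fin (n + 1) => ℝ) 0).symm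
  set T := (MeasurableEquiv.piFinSuccAbove (fun _ : Fin (n + 1) => ℝ) 0).symm with hT
  have hTa : ∀ p, T p = Fin.cons p.1 p.2 := fun p => by
    simp only [hT, MeasurableEquiv.piFinSuccAbove_symm_apply]
    exact Fin.insertNth_zero' _ _
  have hd := hE.withDensity_comp hf
  have hi : ∀ i, Integrable (fun p => T p i) (volume.withDensity (f ∘ T)) := fun i =>
    hd.integrable_comp_of_integrable (g := fun x : Fin (n + 1) → ℝ => x i) (h1 i)
  have hl : ∀ g : (Fin (n + 1) → ℝ) → ℝ≥0∞, Measurable g → ∫⁻ p, (g ∘ T) p = ∫⁻ x, g x :=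
    fun g hg => hE.lintegral_comp hg
  obtain ⟨c, z, h⟩ := exists_santalo_point_prod hB (f := f ∘ T) (hf.comp T.measurable)
    (by rwa [hl f hf]) (by rwa [hl f hf]) (by simpa [hTa] using hi 0)
    (fun i => by simpa [hTa] using hi i.succ)
  refine ⟨Fin.cons c z, fun g hg hfg => ?_⟩
  have := h (g ∘ T) (hg.comp T.measurable) ?_
  · rwa [hl f hf, hl g hg] at this
  intro s x t y
  have key := hfg (Fin.cons s x) (Fin.cons t y)
  simp only [Function.comp_apply, hTa]
  refine le_trans (le_of_eq ?_) (key.trans (le_of_eq ?_))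
  · congr 2
    ext i
    refine Fin.cases ?_ (fun j => ?_) i <;> simp
  · congr 3
    simp [dotProduct, Fin.sum_univ_succ]

theorem centeredSantalo_zero : CenteredSantalo 0 := by
  intro f g hf hg _ _ _ h
  rw [lintegral_unique, lintegral_unique]
  simp only [Measure.volume_pi_eq_dirac (ι := Fin 0) default, measure_univ, mul_one]
  refine (h _ _).trans ?_
  simp

/-- Tilting a centred mass distribution exponentially does not decrease its mass. -/
theorem measure_univ_le_lintegral_exp_dotProduct {n : ℕ} (μ : Measure (Fin n → ℝ))
    [IsFiniteMeasure μ] (h1 : ∀ i, Integrable (fun x : Fin n → ℝ => x i) μ)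
    (h2 : ∀ i, ∫ x : Fin n → ℝ, x i ∂μ = 0) (z : Fin n → ℝ) :
    μ Set.univ ≤ ∫⁻ x, ENNReal.ofReal (rexp (x ⬝ᵥ z)) ∂μ := by
  have hi : Integrable (fun x : Fin n → ℝ => x ⬝ᵥ z) μ := by
    simp only [dotProduct]
    exact integrable_finsetSum _ fun i _ => (h1 i).mul_const _
  have hz : ∫ x : Fin n → ℝ, x ⬝ᵥ z ∂μ = 0 := by
    simp only [dotProduct]
    rw [integral_finsetSum _ fun i _ => (h1 i).mul_const _]
    simp [integral_mul_const, h2]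
  have h : ∫ x : Fin n → ℝ, (1 + x ⬝ᵥ z) ∂μ = μ.real Set.univ := by
    rw [integral_add (integrable_const _) hi, hz]; simp
  rcases eq_or_ne (∫⁻ x, ENNReal.ofReal (rexp (x ⬝ᵥ z)) ∂μ) ∞ with htop | htop
  · rw [htop]; exact le_top
  have hdot : Measurable fun y : Fin n → ℝ => y ⬝ᵥ z := by
    simp only [dotProduct]; fun_prop
  have hintg : Integrable (fun x : Fin n → ℝ => rexp (x ⬝ᵥ z)) μ :=
    ⟨by fun_prop, by
      rw [hasFiniteIntegral_iff_ofReal (ae_of_all _ fun _ => (Real.exp_pos _).le)]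
      exact htop.lt_top⟩
  rw [← ofReal_integral_eq_lintegral_ofReal hintg (ae_of_all _ fun _ => (Real.exp_pos _).le),
    ← ENNReal.ofReal_toReal (measure_ne_top μ Set.univ), ← measureReal_def, ← h]
  refine ENNReal.ofReal_le_ofReal (integral_mono ((integrable_const _).add hi) hintg fun x => ?_)
  simpa [add_comm] using Real.add_one_le_exp (x ⬝ᵥ z)

theorem centeredSantalo_succ {n : ℕ} (hB : CenteredSantalo n) : CenteredSantalo (n + 1) := by
  intro f g hf hg hfin h1 h2 hfg
  have hdot : ∀ z : Fin (n + 1) → ℝ, Measurable fun y : Fin (n + 1) → ℝ => y ⬝ᵥ z := fun z => by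
    simp only [dotProduct]; fun_prop
  set G : ℕ → (Fin (n + 1) → ℝ) → ℝ≥0∞ := fun k =>
    (Metric.closedBall 0 (k : ℝ)).indicator fun y => min (g y) k with hG
  have hGm : ∀ k, Measurable (G k) := fun k =>
    (hg.min measurable_const).indicator Metric.isClosed_closedBall.measurableSet
  have hGle : ∀ k y, G k y ≤ g y := fun k y => by
    simp only [hG, Set.indicator]
    split_ifs
    · exact min_le_left _ _
    · exact zero_le
  have hmono : Monotone G := by
    intro k l hkl y
    simp only [hG, Set.indicator, Metric.mem_closedBall, dist_zero_right]
    have hkl' : (k : ℝ) ≤ l := by exact_mod_cast hkl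
    split_ifs with h3 h4
    · gcongr
    · exact absurd (h3.trans hkl') h4
    · exact zero_le
    · exact le_rfl
  have hsup : ∀ y, ⨆ k, G k y = g y := by
    intro y
    refine le_antisymm (iSup_le fun k => hGle k y) ?_
    have : ⨆ k : ℕ, min (g y) (k : ℝ≥0∞) = g y := by
      rw [← inf_iSup_eq, ENNReal.iSup_natCast]; simp
    rw [← this]
    refine iSup_le fun k => ?_
    obtain ⟨m, hm⟩ := exists_nat_ge ‖y‖
    refine le_iSup_of_le (max k m) ?_
    have hy : y ∈ Metric.closedBall 0 ((max k m : ℕ) : ℝ) := by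
      simp only [Metric.mem_closedBall, dist_zero_right]
      exact hm.trans (by exact_mod_cast le_max_right _ _)
    simp only [hG]
    rw [Set.indicator_of_mem hy]
    gcongr
    exact le_max_left _ _
  have hgsup : ∫⁻ y, g y = ⨆ k, ∫⁻ y, G k y := by
    rw [← lintegral_iSup hGm hmono]
    simp only [hsup]
  rw [hgsup, ENNReal.mul_iSup]
  refine iSup_le fun k => ?_
  rcases eq_or_ne (∫⁻ y, G k y) 0 with h0 | h0
  · simp [h0]
  have hball : volume (Metric.closedBall (0 : Fin (n + 1) → ℝ) k) ≠ ∞ :=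
    (isCompact_closedBall _ _).measure_lt_top.ne
  have hGfin : ∫⁻ y, G k y ≠ ∞ := by
    refine ne_top_of_le_ne_top (b := (k : ℝ≥0∞) * volume (Metric.closedBall (0 : Fin (n + 1) → ℝ) k))
      (ENNReal.mul_ne_top (by simp) hball) ?_
    rw [hG, lintegral_indicator Metric.isClosed_closedBall.measurableSet, ← setLIntegral_const]
    exact lintegral_mono fun y => min_le_right _ _
  have hfinG : IsFiniteMeasure (volume.withDensity (G k)) :=
    ⟨by simpa [withDensity_apply] using hGfin.lt_top⟩
  obtain ⟨z, hz⟩ := exists_santalo_point hB (hGm k) h0 hGfin (fun i => by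
    refine Integrable.of_bound (C := k) (measurable_pi_apply i).aestronglyMeasurable ?_
    rw [ae_withDensity_iff (hGm k)]
    refine ae_of_all _ fun x hx => ?_
    have : x ∈ Metric.closedBall (0 : Fin (n + 1) → ℝ) k := Set.mem_of_indicator_ne_zero hx
    exact (norm_le_pi_norm x i).trans (by simpa using this))
  have hfm : IsFiniteMeasure (volume.withDensity f) :=
    ⟨by simpa [withDensity_apply] using hfin.lt_top⟩
  have key := hz (fun x => f x * ENNReal.ofReal (rexp (x ⬝ᵥ z)))
    (hf.mul (by have := hdot z; fun_prop)) ?_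
  · have htilt := measure_univ_le_lintegral_exp_dotProduct _ h1 h2 z
    rw [lintegral_withDensity_eq_lintegral_mul _ hf (by have := hdot z; fun_prop),
      withDensity_apply _ MeasurableSet.univ, Measure.restrict_univ] at htilt
    rw [mul_comm]
    refine le_trans ?_ key
    exact mul_le_mul_right htilt _
  intro y x
  calc G k (z + y) * (f x * ENNReal.ofReal (rexp (x ⬝ᵥ z)))
      = (f x * G k (z + y)) * ENNReal.ofReal (rexp (x ⬝ᵥ z)) := by ring
    _ ≤ ENNReal.ofReal (rexp (-(x ⬝ᵥ (z + y)))) * ENNReal.ofReal (rexp (x ⬝ᵥ z)) := by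
        gcongr
        exact (mul_le_mul_right (hGle k _) _).trans (hfg _ _)
    _ = _ := by
        rw [← ENNReal.ofReal_mul (Real.exp_pos _).le, ← Real.exp_add, dotProduct_add,
          dotProduct_comm x y]
        congr 2; ring

theorem centeredSantalo (n : ℕ) : CenteredSantalo n := by
  induction n with
  | zero => exact centeredSantalo_zero
  | succ n ih => exact centeredSantalo_succ ih

/-- The functional Blaschke–Santaló inequality for centred functions on Euclidean space. -/
theorem lintegral_mul_lintegral_le_of_centered {n : ℕ}
    {f g : EuclideanSpace ℝ (Fin n) → ℝ≥0∞} (hf : Measurable f) (hg : Measurable g)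
    (hfin : ∫⁻ x, f x ≠ ∞)
    (h1 : ∀ w : EuclideanSpace ℝ (Fin n), Integrable (fun x => ⟪x, w⟫) (volume.withDensity f))
    (h2 : ∀ w : EuclideanSpace ℝ (Fin n), ∫ x, ⟪x, w⟫ ∂(volume.withDensity f) = 0)
    (hfg : ∀ x y, f x * g y ≤ ENNReal.ofReal (rexp (-⟪x, y⟫))) :
    (∫⁻ x, f x) * ∫⁻ y, g y ≤ ENNReal.ofReal ((2 * π) ^ n) := by
  have hT := PiLp.volume_preserving_toLp (Fin n)
  have hd := hT.withDensity_comp hf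
  have hl : ∀ g : EuclideanSpace ℝ (Fin n) → ℝ≥0∞, Measurable g →
    ∫⁻ x, (g ∘ WithLp.toLp 2) x = ∫⁻ x, g x := fun g hg => hT.lintegral_comp hg
  have hinner : ∀ (x : Fin n → ℝ) i, ⟪WithLp.toLp 2 x, EuclideanSpace.single i (1 : ℝ)⟫ = x i :=
    fun x i => by simp [EuclideanSpace.inner_single_right]
  have := centeredSantalo n (f ∘ WithLp.toLp 2) (g ∘ WithLp.toLp 2) (hf.comp hT.measurable)
    (hg.comp hT.measurable) (by rwa [hl f hf])
    (fun i => by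
      have := hd.integrable_comp_of_integrable (h1 (EuclideanSpace.single i 1))
      simpa [Function.comp_def, hinner] using this)
    (fun i => by
      have h3 := h2 (EuclideanSpace.single i 1)
      rw [← hd.map_eq, integral_map hT.measurable.aemeasurable
        (by fun_prop)] at h3
      simpa only [hinner] using h3)
    (fun x y => by
      have := hfg (WithLp.toLp 2 x) (WithLp.toLp 2 y)
      simpa [EuclideanSpace.inner_toLp_toLp, dotProduct_comm] using this)
  rwa [hl f hf, hl g hg] at this

section UniformMeasures

variable {X : Type*} [PseudoMetricSpace X] [SecondCountableTopology X] [MeasurableSpace X]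
  [BorelSpace X]

theorem lintegral_measure_inter_ball_comm (μ ν : Measure X) [IsFiniteMeasure μ]
    [IsFiniteMeasure ν] {U : Set X} (hU : IsOpen U) (r : ℝ) :
    ∫⁻ x, ν (U ∩ Metric.ball x r) ∂μ = ∫⁻ y in U, μ (Metric.ball y r) ∂ν := by
  have hS : MeasurableSet {p : X × X | p.2 ∈ U ∧ dist p.1 p.2 < r} :=
    (measurable_snd hU.measurableSet).inter (measurableSet_lt measurable_dist measurable_const)
  have h1 := Measure.prod_apply (μ := μ) (ν := ν) hS
  have h2 := Measure.prod_apply_symm (μ := μ) (ν := ν) hS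
  rw [h1] at h2
  rw [← lintegral_indicator hU.measurableSet]
  convert h2 using 1
  · refine lintegral_congr fun x => congrArg _ ?_
    ext y; simp [dist_comm]
  · refine lintegral_congr fun y => ?_
    by_cases hy : y ∈ U
    · rw [Set.indicator_of_mem hy]
      congr 1; ext x; simp [hy]
    · rw [Set.indicator_of_notMem hy]
      simp [hy]

theorem measure_isOpen_mul_le_of_uniform {μ ν : Measure X} [IsFiniteMeasure μ]
    [IsFiniteMeasure ν] (hμ : ∀ x y r, μ (Metric.ball x r) = μ (Metric.ball y r))
    (hν : ∀ x y r, ν (Metric.ball x r) = ν (Metric.ball y r))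
    (hpos : ∀ x, ∀ r > 0, ν (Metric.ball x r) ≠ 0) {U : Set X} (hU : IsOpen U) :
    μ U * ν Set.univ ≤ μ Set.univ * ν U := by
  rcases isEmpty_or_nonempty X with hX | ⟨⟨x₀⟩⟩
  · simp [Set.eq_empty_of_isEmpty]
  set r : ℕ → ℝ := fun k => 1 / ((k : ℝ) + 1)
  have hr : ∀ k, 0 < r k := fun k => by positivity
  have hr0 : Tendsto r atTop (𝓝 0) := tendsto_one_div_add_atTop_nhds_zero_nat
  have hcomm : ∀ (V : Set X), IsOpen V → ∀ k,
      ∫⁻ x, ν (V ∩ Metric.ball x (r k)) ∂μ = μ (Metric.ball x₀ (r k)) * ν V := by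
    intro V hV k
    rw [lintegral_measure_inter_ball_comm μ ν hV]
    simp [hμ _ x₀]
  have hall : ∀ k, ν (Metric.ball x₀ (r k)) * μ Set.univ =
      μ (Metric.ball x₀ (r k)) * ν Set.univ := by
    intro k
    rw [← hcomm _ isOpen_univ]
    simp [hν _ x₀]
  have hmeas : ∀ k, Measurable fun x => ν (U ∩ Metric.ball x (r k)) := by
    intro k
    have hS : MeasurableSet {p : X × X | p.2 ∈ U ∧ dist p.2 p.1 < r k} :=
      (measurable_snd hU.measurableSet).inter 
        (measurableSet_lt (measurable_snd.dist measurable_fst) measurable_const)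
    exact measurable_measure_prodMk_left hS
  set h : ℕ → ℝ≥0∞ := fun k => ν (Metric.ball x₀ (r k))
  have hh : ∀ k, h k ≠ 0 := fun k => hpos _ _ (hr k)
  have hht : ∀ k, h k ≠ ∞ := fun k => measure_ne_top _ _
  have hlim : U.indicator (fun _ => (1 : ℝ≥0∞)) ≤
      fun x => liminf (fun k => (h k)⁻¹ * ν (U ∩ Metric.ball x (r k))) atTop := by
    intro x
    by_cases hx : x ∈ U
    · rw [Set.indicator_of_mem hx]
      obtain ⟨ε, hε, hball⟩ := Metric.isOpen_iff.1 hU x hx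
      have : ∀ᶠ k in atTop, (h k)⁻¹ * ν (U ∩ Metric.ball x (r k)) = 1 := by
        filter_upwards [hr0.eventually (gt_mem_nhds hε)] with k hk
        rw [Set.inter_eq_right.2 ((Metric.ball_subset_ball hk.le).trans hball), hν x x₀]
        exact ENNReal.inv_mul_cancel (hh k) (hht k)
      exact (liminf_const (1 : ℝ≥0∞)).symm.le.trans (liminf_congr this).symm.le
    · rw [Set.indicator_of_notMem hx]; exact zero_le
  have hfatou : μ U ≤ liminf (fun k => (h k)⁻¹ * (μ (Metric.ball x₀ (r k)) * ν U)) atTop := by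
    calc μ U = ∫⁻ x, U.indicator (fun _ => (1 : ℝ≥0∞)) x ∂μ := by
          rw [lintegral_indicator hU.measurableSet]; simp
      _ ≤ ∫⁻ x, liminf (fun k => (h k)⁻¹ * ν (U ∩ Metric.ball x (r k))) atTop ∂μ :=
          lintegral_mono hlim
      _ ≤ liminf (fun k => ∫⁻ x, (h k)⁻¹ * ν (U ∩ Metric.ball x (r k)) ∂μ) atTop :=
          lintegral_liminf_le fun k => (hmeas k).const_mul _
      _ = _ := by
          congr 1; ext k
          rw [lintegral_const_mul _ (hmeas k), hcomm U hU]
  have hν0 : ν Set.univ ≠ 0 := fun h0 => hpos x₀ 1 one_pos (measure_mono_null (Set.subset_univ _) h0)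
  have hconst : ∀ k, (h k)⁻¹ * (μ (Metric.ball x₀ (r k)) * ν U) =
      μ Set.univ * (ν Set.univ)⁻¹ * ν U := by
    intro k
    have : μ (Metric.ball x₀ (r k)) = h k * (μ Set.univ * (ν Set.univ)⁻¹) := by
      rw [← mul_assoc, hall k, mul_assoc, ENNReal.mul_inv_cancel hν0 (measure_ne_top _ _), mul_one]
    rw [this, ← mul_assoc, ← mul_assoc, ENNReal.inv_mul_cancel (hh k) (hht k), one_mul]
  simp only [hconst, liminf_const] at hfatou
  calc μ U * ν Set.univ ≤ μ Set.univ * (ν Set.univ)⁻¹ * ν U * ν Set.univ := by gcongr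
    _ = μ Set.univ * ν U * ((ν Set.univ)⁻¹ * ν Set.univ) := by ring
    _ = _ := by rw [ENNReal.inv_mul_cancel hν0 (measure_ne_top _ _), mul_one]

/-- Christensen's lemma: uniformly distributed measures are proportional. -/
theorem smul_eq_smul_of_uniform {μ ν : Measure X} [IsFiniteMeasure μ] [IsFiniteMeasure ν]
    (hμ : ∀ x y r, μ (Metric.ball x r) = μ (Metric.ball y r))
    (hν : ∀ x y r, ν (Metric.ball x r) = ν (Metric.ball y r))
    (hμpos : ∀ x, ∀ r > 0, μ (Metric.ball x r) ≠ 0)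
    (hνpos : ∀ x, ∀ r > 0, ν (Metric.ball x r) ≠ 0) :
    ν Set.univ • μ = μ Set.univ • ν := by
  have : IsFiniteMeasure (ν Set.univ • μ) := Measure.smul_finite _ (measure_ne_top _ _)
  refine ext_of_generate_finite {s | IsOpen s} (BorelSpace.measurable_eq) isPiSystem_isOpen ?_ ?_
  · intro U hU
    simp only [Measure.smul_apply, smul_eq_mul]
    refine le_antisymm ?_ ?_
    · rw [mul_comm]; exact measure_isOpen_mul_le_of_uniform hμ hν hνpos hU
    · rw [mul_comm]; exact measure_isOpen_mul_le_of_uniform hν hμ hμpos hU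
  · simp [mul_comm]

end UniformMeasures

theorem hausdorffMeasure_sphere_ne_top (m : ℕ) :
    μH[(m : ℝ)] (Metric.sphere (0 : EuclideanSpace ℝ (Fin (m + 1))) 1) ≠ ∞ := by
  set w : Fin (m + 1) → ℝ → (Fin m → ℝ) → EuclideanSpace ℝ (Fin (m + 1)) :=
    fun i ε y => WithLp.toLp 2 (i.insertNth ε y) with hw
  set φ : Fin (m + 1) → ℝ → (Fin m → ℝ) → EuclideanSpace ℝ (Fin (m + 1)) :=
    fun i ε y => ‖w i ε y‖⁻¹ • w i ε y with hφ
  have hw0 : ∀ i ε y, ε ≠ 0 → w i ε y ≠ 0 := by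
    intro i ε y hε h
    apply hε
    have := congrArg (fun v => v i) h
    simpa [hw] using this
  have hwc : ∀ i ε, ContDiff ℝ 1 (w i ε) := by
    intro i ε
    rw [contDiff_euclidean]
    intro j
    refine Fin.succAboveCases i ?_ (fun k => ?_) j
    · simpa [hw] using contDiff_const
    · simpa [hw] using contDiff_apply ℝ ℝ k
  have hφc : ∀ i ε, ε ≠ 0 → ContDiff ℝ 1 (φ i ε) := fun i ε hε =>
    (((hwc i ε).norm ℝ fun y => hw0 i ε y hε).inv fun y => norm_ne_zero_iff.2 (hw0 i ε y hε)).smul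
      (hwc i ε)
  have hfin : ∀ i ε, ε ≠ 0 → μH[(m : ℝ)] (φ i ε '' Metric.closedBall 0 1) ≠ ∞ := by
    intro i ε hε
    obtain ⟨K, hK⟩ := (LocallyLipschitz.locallyLipschitzOn (hφc i ε hε).locallyLipschitz)
      |>.exists_lipschitzOnWith_of_compact (isCompact_closedBall (0 : Fin m → ℝ) 1)
    refine ne_top_of_le_ne_top ?_ (hK.hausdorffMeasure_image_le (by positivity))
    have hv : (μH[(m : ℝ)] : Measure (Fin m → ℝ)) = volume := by
      simpa using hausdorffMeasure_pi_real (ι := Fin m)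
    rw [hv]
    exact ENNReal.mul_ne_top (by simp) (isCompact_closedBall _ _).measure_lt_top.ne
  have hcover : Metric.sphere (0 : EuclideanSpace ℝ (Fin (m + 1))) 1 ⊆
      ⋃ i, (φ i 1 '' Metric.closedBall 0 1 ∪ φ i (-1) '' Metric.closedBall 0 1) := by
    intro x hx
    have hx1 : ‖x‖ = 1 := by simpa using hx
    obtain ⟨i, hi⟩ := Finite.exists_max fun i => |x i|
    have hxi : x i ≠ 0 := by
      intro h0
      have : x = 0 := by
        ext j
        have := hi j
        simp only [h0, abs_zero] at this
        simpa using this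
      rw [this] at hx1; simp at hx1
    have habs : 0 < |x i| := abs_pos.2 hxi
    refine Set.mem_iUnion.2 ⟨i, ?_⟩
    have key : φ i (x i / |x i|) (fun j => x (i.succAbove j) / |x i|) = x := by
      have hwx : w i (x i / |x i|) (fun j => x (i.succAbove j) / |x i|) = |x i|⁻¹ • x := by
        ext j
        refine Fin.succAboveCases i ?_ (fun k => ?_) j <;> simp [hw, div_eq_inv_mul]
      simp only [hφ, hwx, norm_smul, hx1, norm_inv, Real.norm_eq_abs, abs_abs, mul_one, inv_inv,
        smul_smul, mul_inv_cancel₀ habs.ne', one_smul]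
    have hmem : (fun j => x (i.succAbove j) / |x i|) ∈ Metric.closedBall (0 : Fin m → ℝ) 1 := by
      rw [mem_closedBall_zero_iff, pi_norm_le_iff_of_nonneg zero_le_one]
      intro j
      rw [Real.norm_eq_abs, abs_div, abs_abs, div_le_one habs]
      exact hi _
    rcases hxi.lt_or_gt with h | h
    · rw [show x i / |x i| = -1 by rw [abs_of_neg h, div_neg, div_self hxi]] at key
      exact Or.inr ⟨_, hmem, key⟩
    · rw [show x i / |x i| = 1 by rw [abs_of_pos h, div_self hxi]] at key
      exact Or.inl ⟨_, hmem, key⟩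
  refine ne_top_of_le_ne_top ?_ (measure_mono hcover)
  refine ne_top_of_le_ne_top ?_ (measure_iUnion_fintype_le _ _)
  refine ENNReal.sum_ne_top.2 fun i _ => ne_top_of_le_ne_top ?_ (measure_union_le _ _)
  exact ENNReal.add_ne_top.2 ⟨hfin _ _ one_ne_zero, hfin _ _ (by norm_num)⟩

theorem hausdorffMeasure_sphere_ne_zero (m : ℕ) :
    μH[(m : ℝ)] (Metric.sphere (0 : EuclideanSpace ℝ (Fin (m + 1))) 1) ≠ 0 := by
  set P : EuclideanSpace ℝ (Fin (m + 1)) → EuclideanSpace ℝ (Fin m) :=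
    fun x => WithLp.toLp 2 (fun i => x i.succ) with hP
  have hL : LipschitzWith 1 P := by
    refine LipschitzWith.of_dist_le_mul fun x y => ?_
    rw [NNReal.coe_one, one_mul, EuclideanSpace.dist_eq, EuclideanSpace.dist_eq]
    refine Real.sqrt_le_sqrt ?_
    rw [Fin.sum_univ_succ]
    simp [hP]
  have hsub : Metric.ball 0 1 ⊆ P '' Metric.sphere (0 : EuclideanSpace ℝ (Fin (m + 1))) 1 := by
    intro y hy
    have hy1 : ‖y‖ < 1 := by simpa using hy
    refine ⟨WithLp.toLp 2 (Fin.cons (√(1 - ‖y‖ ^ 2)) y), ?_, ?_⟩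
    · rw [mem_sphere_zero_iff_norm, EuclideanSpace.norm_eq, Real.sqrt_eq_one, Fin.sum_univ_succ]
      have h2 : ‖y‖ ^ 2 = ∑ i, ‖y i‖ ^ 2 := EuclideanSpace.norm_sq_eq y
      have h3 : 0 ≤ 1 - ‖y‖ ^ 2 := by nlinarith [norm_nonneg y]
      simp only [Fin.cons_zero, Fin.cons_succ, Real.norm_eq_abs, sq_abs, Real.sq_sqrt h3] at h2 ⊢
      linarith
    · ext i; simp [hP]
  intro h0
  have h1 := hL.hausdorffMeasure_image_le (d := (m : ℝ)) (by positivity)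
    (Metric.sphere (0 : EuclideanSpace ℝ (Fin (m + 1))) 1)
  rw [h0, mul_zero, nonpos_iff_eq_zero] at h1
  have h2 := measure_mono_null hsub h1
  have h3 : (μH[(m : ℝ)] : Measure (EuclideanSpace ℝ (Fin m))).IsAddHaarMeasure := by
    simpa using isAddHaarMeasure_hausdorffMeasure (E := EuclideanSpace ℝ (Fin m))
  exact (Metric.measure_ball_pos (μH[(m : ℝ)]) (0 : EuclideanSpace ℝ (Fin m)) one_pos).ne' h2

section

open scoped Pointwise

section Polar
variable {m : ℕ}

local notation "𝔼" => EuclideanSpace ℝ (Fin (m + 1))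
local notation "𝕊" => Metric.sphere (0 : EuclideanSpace ℝ (Fin (m + 1))) 1

/-- The isometry of the unit sphere induced by a linear isometry. -/
def LinearIsometryEquiv.sphereIsometry (R : 𝔼 ≃ₗᵢ[ℝ] 𝔼) : 𝕊 ≃ᵢ 𝕊 where
  toFun x := ⟨R x, by simp⟩
  invFun x := ⟨R.symm x, by simp⟩
  left_inv x := by ext1; simp
  right_inv x := by ext1; simp
  isometry_toFun := Isometry.of_dist_eq fun x y => by
    simp only [Subtype.dist_eq]; exact R.isometry.dist_eq _ _

theorem exists_sphereIsometry_apply_eq (x y : 𝕊) :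
    ∃ R : 𝔼 ≃ₗᵢ[ℝ] 𝔼, R.sphereIsometry x = y := by
  refine ⟨(ℝ ∙ ((x : 𝔼) - y))ᗮ.reflection, Subtype.ext ?_⟩
  exact Submodule.reflection_sub (by simp)

theorem hausdorffMeasure_sphere_ball_eq (x y : 𝕊) (r : ℝ) :
    (μH[(m : ℝ)] : Measure 𝕊) (Metric.ball x r) = μH[(m : ℝ)] (Metric.ball y r) := by
  obtain ⟨R, rfl⟩ := exists_sphereIsometry_apply_eq x y
  rw [← IsometryEquiv.image_ball, IsometryEquiv.hausdorffMeasure_image]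

theorem toSphere_ball_eq (x y : 𝕊) (r : ℝ) :
    (volume : Measure 𝔼).toSphere (Metric.ball x r) =
      (volume : Measure 𝔼).toSphere (Metric.ball y r) := by
  obtain ⟨R, rfl⟩ := exists_sphereIsometry_apply_eq x y
  rw [Measure.toSphere_apply' _ measurableSet_ball, Measure.toSphere_apply' _ measurableSet_ball,
    ← IsometryEquiv.image_ball]
  congr 1
  have : Set.Ioo (0 : ℝ) 1 • ((↑) '' (R.sphereIsometry '' Metric.ball x r) : Set 𝔼) =
      R '' (Set.Ioo (0 : ℝ) 1 • ((↑) '' Metric.ball x r : Set 𝔼)) := by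
    ext v
    simp only [Set.mem_smul, Set.mem_image, exists_exists_and_eq_and]
    constructor
    · rintro ⟨a, ha, b, hb, rfl⟩
      exact ⟨_, ⟨a, ha, b, hb, rfl⟩, by simp [LinearIsometryEquiv.sphereIsometry]⟩
    · rintro ⟨_, ⟨a, ha, b, hb, rfl⟩, rfl⟩
      exact ⟨a, ha, b, hb, by simp [LinearIsometryEquiv.sphereIsometry]⟩
  rw [this, LinearIsometryEquiv.image_eq_preimage_symm]
  exact (R.symm.measurePreserving.measure_preimage_emb
    R.symm.toHomeomorph.measurableEmbedding _).symm

variable (m) in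
theorem exists_toSphere_eq_smul_hausdorffMeasure : ∃ a : ℝ≥0∞, a ≠ 0 ∧ a ≠ ∞ ∧
    (volume : Measure (EuclideanSpace ℝ (Fin (m + 1)))).toSphere =
      a • (μH[(m : ℝ)] : Measure (Metric.sphere (0 : EuclideanSpace ℝ (Fin (m + 1))) 1)) := by
  have hu : (μH[(m : ℝ)] : Measure 𝕊) Set.univ = μH[(m : ℝ)] (Metric.sphere (0 : 𝔼) 1) := by
    rw [← isometry_subtype_coe.hausdorffMeasure_image (Or.inl (by positivity)), Set.image_univ,
      Subtype.range_coe]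
  have h0 := hausdorffMeasure_sphere_ne_zero m
  have ht := hausdorffMeasure_sphere_ne_top m
  rw [← hu] at h0 ht
  have : IsFiniteMeasure (μH[(m : ℝ)] : Measure 𝕊) := ⟨ht.lt_top⟩
  have hs0 : (volume : Measure 𝔼).toSphere Set.univ ≠ 0 := by
    simpa using (Metric.measure_ball_pos volume (0 : 𝔼) one_pos).ne'
  have key := smul_eq_smul_of_uniform (μ := (μH[(m : ℝ)] : Measure 𝕊))
    (ν := (volume : Measure 𝔼).toSphere) hausdorffMeasure_sphere_ball_eq toSphere_ball_eq ?_ ?_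
  · refine ⟨(μH[(m : ℝ)] (Set.univ : Set 𝕊))⁻¹ * (volume : Measure 𝔼).toSphere Set.univ,
      mul_ne_zero (ENNReal.inv_ne_zero.2 ht) hs0,
      ENNReal.mul_ne_top (ENNReal.inv_ne_top.2 h0) (measure_ne_top _ _), ?_⟩
    rw [mul_smul, key, smul_smul, ENNReal.inv_mul_cancel h0 ht, one_smul]
  · intro x r hr hx
    refine h0 (measure_null_of_locally_null _ fun y _ => ⟨Metric.ball y r,
      mem_nhdsWithin_of_mem_nhds (Metric.ball_mem_nhds _ hr), ?_⟩)
    rw [hausdorffMeasure_sphere_ball_eq y x, hx]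
  · intro x r hr
    exact (Metric.measure_ball_pos _ _ hr).ne'

variable (m) in
/-- Integration in polar coordinates against the Hausdorff measure of the unit sphere. -/
theorem exists_lintegral_polar : ∃ k : ℝ≥0∞, k ≠ 0 ∧ k ≠ ∞ ∧
    ∀ Φ : EuclideanSpace ℝ (Fin (m + 1)) → ℝ≥0∞, Measurable Φ →
      ∫⁻ x, Φ x = k * ∫⁻ u in Metric.sphere (0 : EuclideanSpace ℝ (Fin (m + 1))) 1,
        (∫⁻ r in Set.Ioi (0 : ℝ), ENNReal.ofReal (r ^ m) * Φ (r • u)) ∂μH[(m : ℝ)] := by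
  obtain ⟨a, ha0, hat, ha⟩ := exists_toSphere_eq_smul_hausdorffMeasure m
  refine ⟨a, ha0, hat, fun Φ hΦ => ?_⟩
  have hp := (volume : Measure 𝔼).measurePreserving_homeomorphUnitSphereProd
  have hm : Measurable fun q : 𝔼 × ℝ => ENNReal.ofReal (q.2 ^ m) * Φ (q.2 • q.1) := by fun_prop
  have hres : (μH[(m : ℝ)] : Measure 𝔼).restrict (Metric.sphere 0 1) =
      Measure.map Subtype.val (μH[(m : ℝ)] : Measure 𝕊) := by
    rw [isometry_subtype_coe.map_hausdorffMeasure (Or.inl (by positivity)), Subtype.range_coe]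
  rw [hres, lintegral_map hm.lintegral_prod_right' measurable_subtype_coe]
  have h1 : ∫⁻ x, Φ x = ∫⁻ x : ({0}ᶜ : Set 𝔼), Φ x ∂(volume.comap Subtype.val) := by
    rw [lintegral_subtype_comap (measurableSet_singleton _).compl, restrict_compl_singleton]
  have h3 : ∫⁻ p : 𝕊 × Set.Ioi (0 : ℝ), Φ ((p.2 : ℝ) • (p.1 : 𝔼))
      ∂(volume.toSphere.prod (Measure.volumeIoiPow (Module.finrank ℝ 𝔼 - 1))) =
      ∫⁻ x : ({0}ᶜ : Set 𝔼), Φ x ∂(volume.comap Subtype.val) := by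
    rw [← hp.lintegral_comp (by fun_prop)]
    refine lintegral_congr fun x => congrArg Φ ?_
    have := congrArg Subtype.val ((homeomorphUnitSphereProd 𝔼).symm_apply_apply x)
    exact this
  rw [h1, ← h3]
  have hfr : Module.finrank ℝ 𝔼 - 1 = m := by simp
  rw [hfr, lintegral_prod _ (by fun_prop), ha, lintegral_smul_measure, smul_eq_mul]
  congr 1
  refine lintegral_congr fun u => ?_
  rw [Measure.volumeIoiPow, lintegral_withDensity_eq_lintegral_mul _ (by fun_prop) (by fun_prop),
    ← lintegral_subtype_comap measurableSet_Ioi]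
  rfl

end Polar

end

section

open scoped Pointwise

/-- `ι` parametrizes the orthogonal complement of `e` isometrically. -/
structure IsOrthParam {d : ℕ} (e : Esp d) (ι : EuclideanSpace ℝ (Fin d) →ₗᵢ[ℝ] Esp d) : Prop where
  norm_eq_one : ‖e‖ = 1
  inner_eq_zero : ∀ y, ⟪ι y, e⟫ = 0
  exists_eq : ∀ x, ⟪x, e⟫ = 0 → ∃ y, ι y = x

theorem exists_isOrthParam {d : ℕ} {e : Esp d} (he : e ∈ uSphere d) :
    ∃ ι : EuclideanSpace ℝ (Fin d) →ₗᵢ[ℝ] Esp d, IsOrthParam e ι := by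
  have he1 : ‖e‖ = 1 := by simpa [uSphere] using he
  have he0 : e ≠ 0 := by rintro rfl; simp at he1
  have : Fact (Module.finrank ℝ (Esp d) = d + 1) := ⟨by simp⟩
  set b := OrthonormalBasis.fromOrthogonalSpanSingleton (𝕜 := ℝ) d he0
  refine ⟨(ℝ ∙ e)ᗮ.subtypeₗᵢ.comp b.repr.symm.toLinearIsometry, he1, fun y => ?_, fun x hx => ?_⟩
  · rw [real_inner_comm]
    exact (Submodule.mem_orthogonal_singleton_iff_inner_right.1 (b.repr.symm y).2)
  · refine ⟨b.repr ⟨x, Submodule.mem_orthogonal_singleton_iff_inner_right.2 ?_⟩, by simp⟩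
    rw [real_inner_comm]; exact hx

namespace IsOrthParam

variable {d : ℕ} {e : Esp d} {ι : EuclideanSpace ℝ (Fin d) →ₗᵢ[ℝ] Esp d}

theorem inner_eq_zero' (h : IsOrthParam e ι) (y) : ⟪e, ι y⟫ = 0 := by
  rw [real_inner_comm, h.inner_eq_zero]

theorem inner_add (h : IsOrthParam e ι) (s t : ℝ) (x y) :
    ⟪s • e + ι x, t • e + ι y⟫ = s * t + ⟪x, y⟫ := by
  simp [_root_.inner_add_left, _root_.inner_add_right, real_inner_smul_left,
    real_inner_smul_right, h.inner_eq_zero, h.inner_eq_zero', h.norm_eq_one, mul_comm]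

theorem norm_sq_add (h : IsOrthParam e ι) (t : ℝ) (y) : ‖t • e + ι y‖ ^ 2 = t ^ 2 + ‖y‖ ^ 2 := by
  rw [← real_inner_self_eq_norm_sq, h.inner_add, real_inner_self_eq_norm_sq]; ring

theorem equator_eq (h : IsOrthParam e ι) : equator e = ι '' Metric.sphere 0 1 := by
  ext x
  simp only [equator, uSphere, Set.mem_inter_iff, mem_sphere_zero_iff_norm, Set.mem_ofPred_eq,
    Set.mem_image]
  constructor
  · rintro ⟨h1, h2⟩
    obtain ⟨y, rfl⟩ := h.exists_eq x h2
    exact ⟨y, by simpa using h1, rfl⟩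
  · rintro ⟨y, hy, rfl⟩
    exact ⟨by simpa using hy, h.inner_eq_zero y⟩

theorem inner_add_right (h : IsOrthParam e ι) (t : ℝ) (y) : ⟪t • e + ι y, e⟫ = t := by
  simpa using h.inner_add t 1 y 0

theorem exists_eq_add (h : IsOrthParam e ι) (x : Esp d) : ∃ y, x = ⟪x, e⟫ • e + ι y := by
  obtain ⟨y, hy⟩ := h.exists_eq (x - ⟪x, e⟫ • e) (by
    simp [inner_sub_left, real_inner_smul_left, h.norm_eq_one])
  exact ⟨y, by rw [hy]; abel⟩

/-- The splitting of the ambient space along `e`. -/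
def splitting (h : IsOrthParam e ι) : (ℝ × EuclideanSpace ℝ (Fin d)) ≃L[ℝ] Esp d :=
  (LinearEquiv.ofBijective
    (LinearMap.coprod (LinearMap.toSpanSingleton ℝ (Esp d) e) ι.toLinearMap) (by
      constructor
      · rintro ⟨s, x⟩ ⟨t, y⟩ hxy
        simp only [LinearMap.coprod_apply, LinearMap.toSpanSingleton_apply,
          LinearIsometry.coe_toLinearMap] at hxy
        have h1 : s = t := by rw [← h.inner_add_right s x, hxy, h.inner_add_right]
        subst h1
        simpa using ι.injective (add_left_cancel hxy)
      · intro x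
        obtain ⟨y, hy⟩ := h.exists_eq_add x
        exact ⟨(⟪x, e⟫, y), hy.symm⟩)).toContinuousLinearEquiv

theorem exists_lintegral_eq (h : IsOrthParam e ι) : ∃ c : ℝ≥0∞, c ≠ 0 ∧ c ≠ ∞ ∧
    ∀ Φ : Esp d → ℝ≥0∞, Measurable Φ →
      ∫⁻ x, Φ x = c * ∫⁻ y, ∫⁻ t : ℝ, Φ (t • e + ι y) := by
  have : (volume : Measure (ℝ × EuclideanSpace ℝ (Fin d))).IsAddHaarMeasure :=
    inferInstanceAs ((volume : Measure ℝ).prod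
      (volume : Measure (EuclideanSpace ℝ (Fin d)))).IsAddHaarMeasure
  have hH : ((volume : Measure (ℝ × EuclideanSpace ℝ (Fin d))).map h.splitting).IsAddHaarMeasure :=
    h.splitting.isAddHaarMeasure_map _
  have hs := Measure.isAddLeftInvariant_eq_smul (volume : Measure (Esp d))
    ((volume : Measure (ℝ × EuclideanSpace ℝ (Fin d))).map h.splitting)
  set c := Measure.addHaarScalarFactor (volume : Measure (Esp d))
    ((volume : Measure (ℝ × EuclideanSpace ℝ (Fin d))).map h.splitting)
  have hc : c ≠ 0 := (Measure.addHaarScalarFactor_pos_of_isAddHaarMeasure _ _).ne'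
  refine ⟨c, by simpa using hc, by simp, fun Φ hΦ => ?_⟩
  rw [hs, lintegral_smul_measure, ENNReal.smul_def, smul_eq_mul,
    lintegral_map hΦ h.splitting.continuous.measurable,
    Measure.volume_eq_prod, lintegral_prod_symm (fun a => Φ (h.splitting a))
      (hΦ.comp h.splitting.continuous.measurable).aemeasurable]
  rfl

end IsOrthParam

theorem map_hausdorffMeasure_sphere {m : ℕ} {e : Esp (m + 1)}
    {ι : EuclideanSpace ℝ (Fin (m + 1)) →ₗᵢ[ℝ] Esp (m + 1)} (h : IsOrthParam e ι) :
    ((μH[(m : ℝ)]).restrict (Metric.sphere 0 1)).map ι =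
      (μH[(m : ℝ)]).restrict (equator e) := by
  have hs : ι ⁻¹' equator e = Metric.sphere 0 1 := by
    rw [h.equator_eq, Set.preimage_image_eq _ ι.injective]
  have hm : MeasurableSet (equator e) := by
    rw [h.equator_eq]
    exact ((isCompact_sphere _ _).image ι.continuous).isClosed.measurableSet
  rw [← hs, ← Measure.restrict_map ι.continuous.measurable hm,
    ι.isometry.map_hausdorffMeasure (Or.inl (by positivity)), Measure.restrict_restrict hm,
    Set.inter_eq_left.2]
  rw [h.equator_eq]
  exact Set.image_subset_range _ _

/-- The normalized Hausdorff measure on the unit sphere. -/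
def sphereProb (m : ℕ) : Measure (EuclideanSpace ℝ (Fin (m + 1))) :=
  (μH[(m : ℝ)] (Metric.sphere (0 : EuclideanSpace ℝ (Fin (m + 1))) 1))⁻¹ •
    (μH[(m : ℝ)]).restrict (Metric.sphere 0 1)

instance (m : ℕ) : IsProbabilityMeasure (sphereProb m) := ⟨by
  simp [sphereProb, ENNReal.inv_mul_cancel (hausdorffMeasure_sphere_ne_zero m)
    (hausdorffMeasure_sphere_ne_top m)]⟩

theorem ae_sphereProb_norm_eq_one (m : ℕ) : ∀ᵐ u ∂(sphereProb m), ‖u‖ = 1 := by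
  refine Measure.ae_smul_measure ?_ _
  filter_upwards [ae_restrict_mem Metric.isClosed_sphere.measurableSet] with u hu
  simpa using hu

theorem map_sphereProb {m : ℕ} {e : Esp (m + 1)}
    {ι : EuclideanSpace ℝ (Fin (m + 1)) →ₗᵢ[ℝ] Esp (m + 1)} (h : IsOrthParam e ι) :
    (sphereProb m).map ι = sigma0 (m + 1) e := by
  have hc : (((m + 1 : ℕ) : ℝ) - 1) = m := by push_cast; ring
  rw [sphereProb, sigma0, Measure.map_smul, map_hausdorffMeasure_sphere h, hc, h.equator_eq,
    ι.isometry.hausdorffMeasure_image (Or.inl (by positivity))]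

/-- Polar coordinates with respect to the uniform probability measure on the sphere. -/
theorem exists_lintegral_sphereProb (m : ℕ) : ∃ k : ℝ≥0∞, k ≠ 0 ∧ k ≠ ∞ ∧
    ∀ Φ : EuclideanSpace ℝ (Fin (m + 1)) → ℝ≥0∞, Measurable Φ →
      ∫⁻ x, Φ x = k * ∫⁻ u,
        (∫⁻ r in Set.Ioi (0 : ℝ), ENNReal.ofReal (r ^ m) * Φ (r • u)) ∂(sphereProb m) := by
  obtain ⟨k, hk0, hkt, hk⟩ := exists_lintegral_polar m
  have h0 := hausdorffMeasure_sphere_ne_zero m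
  have ht := hausdorffMeasure_sphere_ne_top m
  refine ⟨k * μH[(m : ℝ)] (Metric.sphere (0 : EuclideanSpace ℝ (Fin (m + 1))) 1),
    mul_ne_zero hk0 h0, ENNReal.mul_ne_top hkt ht, fun Φ hΦ => ?_⟩
  rw [hk Φ hΦ, sphereProb, lintegral_smul_measure, smul_eq_mul, mul_assoc, ← mul_assoc (μH[_] _),
    ENNReal.mul_inv_cancel h0 ht, one_mul]

end

/-- Polar coordinates in the upper half plane. -/
theorem lintegral_upperHalfPlane_polar {f : ℝ × ℝ → ℝ≥0∞} (hf : Measurable f) :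
    ∫⁻ s in Set.Ioi (0 : ℝ), ∫⁻ t : ℝ, f (t, s) =
      ∫⁻ θ in Set.Ioo 0 π, ∫⁻ r in Set.Ioi (0 : ℝ),
        ENNReal.ofReal r * f (r * Real.cos θ, r * Real.sin θ) := by
  set g : ℝ × ℝ → ℝ≥0∞ := fun p => (Set.Ioi (0 : ℝ)).indicator (fun s => f (p.1, s)) p.2 with hg
  have hgm : Measurable g := by
    have : g = {p : ℝ × ℝ | 0 < p.2}.indicator f := by
      ext p; simp [hg, Set.indicator]
    rw [this]
    exact hf.indicator (measurableSet_lt measurable_const measurable_snd)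
  have h1 : ∫⁻ s in Set.Ioi (0 : ℝ), ∫⁻ t : ℝ, f (t, s) = ∫⁻ p : ℝ × ℝ, g p := by
    rw [Measure.volume_eq_prod, lintegral_prod_symm _ hgm.aemeasurable,
      ← lintegral_indicator measurableSet_Ioi]
    refine lintegral_congr fun s => ?_
    by_cases hs : s ∈ Set.Ioi (0 : ℝ) <;> simp [hg, hs]
  have hmeas : Measurable fun p : ℝ × ℝ =>
      ENNReal.ofReal p.1 * g (p.1 * Real.cos p.2, p.1 * Real.sin p.2) := by fun_prop
  rw [h1, ← lintegral_comp_polarCoord_symm, polarCoord_target, Measure.volume_eq_prod,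
    ← Measure.prod_restrict]
  simp only [polarCoord_symm_apply, smul_eq_mul]
  rw [lintegral_prod_symm _ hmeas.aemeasurable, ← lintegral_indicator measurableSet_Ioo,
    ← lintegral_indicator measurableSet_Ioo]
  refine lintegral_congr fun θ => ?_
  by_cases h : θ ∈ Set.Ioo 0 π
  · rw [Set.indicator_of_mem h, Set.indicator_of_mem
      (show θ ∈ Set.Ioo (-π) π from ⟨by linarith [h.1, pi_pos], h.2⟩)]
    refine setLIntegral_congr_fun measurableSet_Ioi fun r hr => ?_
    have : 0 < r * Real.sin θ := mul_pos hr (Real.sin_pos_of_pos_of_lt_pi h.1 h.2)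
    simp [hg, this]
  · rw [Set.indicator_of_notMem h]
    by_cases hIoo : θ ∈ Set.Ioo (-π) π
    · rw [Set.indicator_of_mem hIoo]
      have hθ : θ ≤ 0 := by
        by_contra hc
        exact h ⟨not_le.1 hc, hIoo.2⟩
      refine (setLIntegral_congr_fun (g := fun _ => 0) measurableSet_Ioi fun r hr => ?_).trans
        (by simp)
      have : r * Real.sin θ ≤ 0 := mul_nonpos_of_nonneg_of_nonpos (le_of_lt hr)
        (Real.sin_nonpos_of_nonpos_of_neg_pi_le hθ hIoo.1.le)
      simp [hg, this]
    · rw [Set.indicator_of_notMem hIoo]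

/-- Spherical integration along the great circles through `e`. -/
theorem IsOrthParam.exists_lintegral_sigmaMeas {m : ℕ} {e : Esp (m + 1)}
    {ι : EuclideanSpace ℝ (Fin (m + 1)) →ₗᵢ[ℝ] Esp (m + 1)} (h : IsOrthParam e ι) :
    ∃ c : ℝ≥0∞, c ≠ 0 ∧ c ≠ ∞ ∧ ∀ f : Esp (m + 1) → ℝ≥0∞, Measurable f →
      ∫⁻ x, f x ∂(sigmaMeas (m + 1)) = c * ∫⁻ u, (∫⁻ θ in Set.Ioo 0 π,
        ENNReal.ofReal (Real.sin θ ^ m) * f (Real.cos θ • e + Real.sin θ • ι u))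
          ∂(sphereProb m) := by
  obtain ⟨k₁, h10, h1t, h1⟩ := exists_lintegral_polar (m + 1)
  obtain ⟨k₂, h20, h2t, h2⟩ := h.exists_lintegral_eq
  obtain ⟨k₃, h30, h3t, h3⟩ := exists_lintegral_sphereProb m
  set w : ℝ → ℝ≥0∞ := (Set.Iio (1 : ℝ)).indicator 1 with hw
  have hwm : Measurable w := measurable_one.indicator measurableSet_Iio
  set I := ∫⁻ r in Set.Ioi (0 : ℝ), ENNReal.ofReal (r ^ (m + 1)) * w r with hI
  have hmI : Measurable fun r : ℝ => ENNReal.ofReal (r ^ (m + 1)) * w r := by fun_prop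
  have hI0 : I ≠ 0 := by
    rw [hI, ← pos_iff_ne_zero, setLIntegral_pos_iff hmI]
    have hsub : Set.Ioo (0 : ℝ) 1 ⊆
        Function.support (fun r : ℝ => ENNReal.ofReal (r ^ (m + 1)) * w r) ∩ Set.Ioi 0 := by
      intro r hr
      refine ⟨?_, hr.1⟩
      have : 0 < r ^ (m + 1) := pow_pos hr.1 _
      simp [hw, hr.2, hr.1]
    exact lt_of_lt_of_le (by simp) (measure_mono hsub)
  have hIt : I ≠ ∞ := by
    have : I ≤ ∫⁻ r in Set.Ioi (0 : ℝ), (Set.Ioo (0 : ℝ) 1).indicator 1 r := by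
      refine setLIntegral_mono (measurable_one.indicator measurableSet_Ioo) fun r hr => ?_
      by_cases hr1 : r < 1
      · have : r ^ (m + 1) ≤ 1 := pow_le_one₀ (le_of_lt hr) hr1.le
        have hr' : r ∈ Set.Ioo (0 : ℝ) 1 := ⟨hr, hr1⟩
        simpa [hw, hr1, hr'] using this
      · simp [hw, hr1]
    refine ne_top_of_le_ne_top ?_ (this.trans (lintegral_mono' Measure.restrict_le_self le_rfl))
    rw [lintegral_indicator_one measurableSet_Ioo]
    simp
  refine ⟨(k₁ * I)⁻¹ * (k₂ * (k₃ * I)), ?_, ?_, fun f hf => ?_⟩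
  · simp [ENNReal.mul_eq_top, h10, h1t, h20, h30, hI0, hIt]
  · refine ENNReal.mul_ne_top (ENNReal.inv_ne_top.2 (mul_ne_zero h10 hI0))
      (ENNReal.mul_ne_top h2t (ENNReal.mul_ne_top h3t hIt))
  set Φ : Esp (m + 1) → ℝ≥0∞ := fun x => f (‖x‖⁻¹ • x) * w ‖x‖ with hΦ
  have hΦm : Measurable Φ := by fun_prop
  have key : ∀ r : ℝ, 0 < r → ∀ v : Esp (m + 1), ‖v‖ = 1 → Φ (r • v) = f v * w r := by
    intro r hr v hv
    have : ‖r • v‖ = r := by rw [norm_smul, hv, mul_one, Real.norm_of_nonneg hr.le]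
    simp only [hΦ, this, smul_smul, inv_mul_cancel₀ hr.ne', one_smul]
  have hL : ∫⁻ x, Φ x = k₁ * I * ∫⁻ x, f x ∂(sigmaMeas (m + 1)) := by
    rw [h1 Φ hΦm, mul_assoc, sigmaMeas, uSphere, ← lintegral_const_mul _ hf]
    congr 1
    refine setLIntegral_congr_fun Metric.isClosed_sphere.measurableSet fun u hu => ?_
    rw [hI, ← lintegral_mul_const _ hmI]
    refine setLIntegral_congr_fun measurableSet_Ioi fun r hr => ?_
    rw [key r hr u (by simpa using hu)]
    ring
  have hm2 : Measurable fun y => ∫⁻ t : ℝ, Φ (t • e + ι y) := by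
    have : Measurable fun p : EuclideanSpace ℝ (Fin (m + 1)) × ℝ => Φ (p.2 • e + ι p.1) := by
      have := ι.continuous.measurable
      fun_prop
    exact this.lintegral_prod_right'
  have hR : ∫⁻ x, Φ x = k₂ * (k₃ * I) * ∫⁻ u, (∫⁻ θ in Set.Ioo 0 π,
        ENNReal.ofReal (Real.sin θ ^ m) * f (Real.cos θ • e + Real.sin θ • ι u))
          ∂(sphereProb m) := by
    rw [h2 Φ hΦm, h3 _ hm2, mul_assoc, mul_assoc k₃]
    congr 2
    have hm3 : Measurable fun u => ∫⁻ θ in Set.Ioo 0 π, ENNReal.ofReal (Real.sin θ ^ m) *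
        f (Real.cos θ • e + Real.sin θ • ι u) := by
      have : Measurable fun p : EuclideanSpace ℝ (Fin (m + 1)) × ℝ =>
          ENNReal.ofReal (Real.sin p.2 ^ m) * f (Real.cos p.2 • e + Real.sin p.2 • ι p.1) := by
        have := ι.continuous.measurable
        fun_prop
      exact this.lintegral_prod_right'
    rw [← lintegral_const_mul _ hm3]
    refine lintegral_congr_ae ?_
    filter_upwards [ae_sphereProb_norm_eq_one m] with u hu
    have e1 : ∫⁻ r in Set.Ioi (0 : ℝ), ENNReal.ofReal (r ^ m) * ∫⁻ t : ℝ, Φ (t • e + ι (r • u)) =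
        ∫⁻ s in Set.Ioi (0 : ℝ), ∫⁻ t : ℝ,
          (fun p : ℝ × ℝ => ENNReal.ofReal (p.2 ^ m) * Φ (p.1 • e + p.2 • ι u)) (t, s) := by
      refine lintegral_congr fun s => ?_
      rw [← lintegral_const_mul _ (by fun_prop)]
      simp
    rw [e1, lintegral_upperHalfPlane_polar
      (f := fun p : ℝ × ℝ => ENNReal.ofReal (p.2 ^ m) * Φ (p.1 • e + p.2 • ι u)) (by fun_prop),
      ← lintegral_const_mul _ (by fun_prop)]
    refine setLIntegral_congr_fun measurableSet_Ioo fun θ hθ => ?_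
    have hs : 0 < Real.sin θ := Real.sin_pos_of_pos_of_lt_pi hθ.1 hθ.2
    simp only
    rw [hI, ← lintegral_mul_const _ hmI]
    refine setLIntegral_congr_fun measurableSet_Ioi fun r hr => ?_
    have hr0 : 0 < r := hr
    have hv : ‖Real.cos θ • e + Real.sin θ • ι u‖ = 1 := by
      have := h.norm_sq_add (Real.cos θ) (Real.sin θ • u)
      rw [norm_smul, hu, mul_one, Real.norm_of_nonneg hs.le, Real.cos_sq_add_sin_sq] at this
      rw [map_smul] at this
      nlinarith [norm_nonneg (Real.cos θ • e + Real.sin θ • ι u)]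
    have := key r hr _ hv
    simp only [smul_add, smul_smul] at this
    rw [this, mul_pow, ENNReal.ofReal_mul (by positivity), pow_succ' r m,
      ENNReal.ofReal_mul hr0.le]
    ring
  have hk : k₁ * I ≠ 0 := mul_ne_zero h10 hI0
  have hk' : k₁ * I ≠ ∞ := ENNReal.mul_ne_top h1t hIt
  rw [mul_assoc, ← hR, hL, ← mul_assoc, ENNReal.inv_mul_cancel hk hk', one_mul]

/-- `C` and `C'` are mutually dual cones, both strictly positive in the direction `e`. -/
structure IsDualConePair {d : ℕ} (e : Esp d) (C C' : Set (Esp d)) : Prop where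
  mem_iff : ∀ x, x ∈ C ↔ ∀ y ∈ C', 0 ≤ ⟪x, y⟫
  mem_iff' : ∀ y, y ∈ C' ↔ ∀ x ∈ C, 0 ≤ ⟪x, y⟫
  exists_pos : ∃ δ > 0, ∀ x ∈ C, δ * ‖x‖ ≤ ⟪x, e⟫
  exists_pos' : ∃ δ > 0, ∀ x ∈ C', δ * ‖x‖ ≤ ⟪x, e⟫

/-- The height over the hyperplane orthogonal to `e` at which a vertical line enters `C`. -/
def coneHeight {d : ℕ} (e : Esp d) (ι : EuclideanSpace ℝ (Fin d) →ₗᵢ[ℝ] Esp d)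
    (C : Set (Esp d)) (y : EuclideanSpace ℝ (Fin d)) : ℝ :=
  sInf {t : ℝ | t • e + ι y ∈ C}

namespace IsDualConePair

variable {d : ℕ} {e : Esp d} {C C' : Set (Esp d)} {ι : EuclideanSpace ℝ (Fin d) →ₗᵢ[ℝ] Esp d}

theorem symm (h : IsDualConePair e C C') : IsDualConePair e C' C where
  mem_iff y := by
    rw [h.mem_iff']
    exact forall₂_congr fun x _ => by rw [real_inner_comm]
  mem_iff' y := by
    rw [h.mem_iff]
    exact forall₂_congr fun x _ => by rw [real_inner_comm]
  exists_pos := h.exists_pos'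
  exists_pos' := h.exists_pos

theorem isClosed (h : IsDualConePair e C C') : IsClosed C := by
  have : C = ⋂ y ∈ C', {x : Esp d | 0 ≤ ⟪x, y⟫} := by
    ext x; simp [h.mem_iff]
  rw [this]
  exact isClosed_biInter fun y _ => isClosed_le continuous_const (by fun_prop)

theorem add_mem (h : IsDualConePair e C C') {x y : Esp d} (hx : x ∈ C) (hy : y ∈ C) :
    x + y ∈ C := by
  rw [h.mem_iff] at *
  intro z hz
  rw [inner_add_left]
  exact add_nonneg (hx z hz) (hy z hz)

theorem smul_mem (h : IsDualConePair e C C') {x : Esp d} {r : ℝ} (hr : 0 ≤ r) (hx : x ∈ C) :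
    r • x ∈ C := by
  rw [h.mem_iff] at *
  intro z hz
  rw [real_inner_smul_left]
  exact mul_nonneg hr (hx z hz)

theorem exists_mem (h : IsDualConePair e C C') :
    ∃ R > 0, ∀ y t, R * ‖y‖ ≤ t → t • e + ι y ∈ C := by
  obtain ⟨δ, hδ, hC⟩ := h.exists_pos'
  refine ⟨δ⁻¹, inv_pos.2 hδ, fun y t ht => (h.mem_iff _).2 fun z hz => ?_⟩
  have h1 : ‖y‖ ≤ δ * t := by
    rw [inv_mul_le_iff₀ hδ] at ht; exact ht
  have h2 : -(‖y‖ * ‖z‖) ≤ ⟪ι y, z⟫ := by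
    have := abs_le.1 (abs_real_inner_le_norm (ι y) z)
    rw [ι.norm_map] at this
    exact this.1
  have ht0 : 0 ≤ t := le_trans (by positivity) ht
  rw [inner_add_left, real_inner_smul_left, real_inner_comm]
  have h3 := mul_le_mul_of_nonneg_left (hC z hz) ht0
  have h4 := mul_le_mul_of_nonneg_right h1 (norm_nonneg z)
  linarith

theorem coneHeight_le_iff (h : IsDualConePair e C C') (hι : IsOrthParam e ι) {y} {t : ℝ} :
    coneHeight e ι C y ≤ t ↔ t • e + ι y ∈ C := by
  obtain ⟨R, -, hR⟩ := h.exists_mem (ι := ι)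
  obtain ⟨δ, hδ, hC⟩ := h.exists_pos
  have hne : {t : ℝ | t • e + ι y ∈ C}.Nonempty := ⟨R * ‖y‖, hR y _ le_rfl⟩
  have hbdd : BddBelow {t : ℝ | t • e + ι y ∈ C} := by
    refine ⟨0, fun t ht => ?_⟩
    have := hC _ ht
    rw [hι.inner_add_right] at this
    exact le_trans (by positivity) this
  have hcl : IsClosed {t : ℝ | t • e + ι y ∈ C} := h.isClosed.preimage (by fun_prop)
  have he : e ∈ C := by simpa using hR 0 1 (by simp)
  refine ⟨fun ht => ?_, fun ht => csInf_le hbdd ht⟩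
  have := h.add_mem (hcl.csInf_mem hne hbdd)
    (h.smul_mem (sub_nonneg.2 ht) he)
  convert this using 1
  rw [sub_smul, coneHeight]
  abel

theorem coneHeight_mem (h : IsDualConePair e C C') (hι : IsOrthParam e ι) (y) :
    coneHeight e ι C y • e + ι y ∈ C :=
  (h.coneHeight_le_iff hι).1 le_rfl

theorem coneHeight_smul (h : IsDualConePair e C C') (hι : IsOrthParam e ι) {r : ℝ} (hr : 0 < r)
    (y) : coneHeight e ι C (r • y) = r * coneHeight e ι C y := by
  have key : ∀ (s : ℝ), 0 < s → ∀ z, coneHeight e ι C (s • z) ≤ s * coneHeight e ι C z := by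
    intro s hs z
    rw [h.coneHeight_le_iff hι, mul_smul, map_smul, ← smul_add]
    exact h.smul_mem hs.le (h.coneHeight_mem hι z)
  refine le_antisymm (key r hr y) ?_
  have := key r⁻¹ (inv_pos.2 hr) (r • y)
  rwa [smul_smul, inv_mul_cancel₀ hr.ne', one_smul, ← div_eq_inv_mul, le_div_iff₀ hr, mul_comm] at this

theorem exists_le_coneHeight (h : IsDualConePair e C C') (hι : IsOrthParam e ι) :
    ∃ δ > 0, ∀ y, δ * ‖y‖ ≤ coneHeight e ι C y := by
  obtain ⟨δ, hδ, hC⟩ := h.exists_pos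
  refine ⟨δ, hδ, fun y => ?_⟩
  have h1 := hC _ (h.coneHeight_mem hι y)
  rw [hι.inner_add_right] at h1
  refine le_trans (mul_le_mul_of_nonneg_left ?_ hδ.le) h1
  refine abs_le_of_sq_le_sq' ?_ (norm_nonneg _) |>.2
  rw [hι.norm_sq_add]
  nlinarith [sq_nonneg (coneHeight e ι C y)]

theorem coneHeight_nonneg (h : IsDualConePair e C C') (hι : IsOrthParam e ι) (y) :
    0 ≤ coneHeight e ι C y := by
  obtain ⟨δ, hδ, hC⟩ := h.exists_le_coneHeight hι
  exact le_trans (by positivity) (hC y)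

theorem coneHeight_pos (h : IsDualConePair e C C') (hι : IsOrthParam e ι) {y} (hy : y ≠ 0) :
    0 < coneHeight e ι C y := by
  obtain ⟨δ, hδ, hC⟩ := h.exists_le_coneHeight hι
  exact lt_of_lt_of_le (mul_pos hδ (norm_pos_iff.2 hy)) (hC y)

theorem measurable_coneHeight (h : IsDualConePair e C C') (hι : IsOrthParam e ι) :
    Measurable (coneHeight e ι C) := by
  refine measurable_of_Iic fun t => ?_
  have : coneHeight e ι C ⁻¹' Set.Iic t = {y | t • e + ι y ∈ C} := by
    ext y; exact h.coneHeight_le_iff hι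
  rw [this]
  exact (h.isClosed.preimage (f := fun y => t • e + ι y)
    (continuous_const.add ι.continuous)).measurableSet

theorem neg_inner_le_coneHeight_mul (h : IsDualConePair e C C') (hι : IsOrthParam e ι) (x y) :
    -⟪x, y⟫ ≤ coneHeight e ι C x * coneHeight e ι C' y := by
  have := (h.mem_iff _).1 (h.coneHeight_mem hι x) _ (h.symm.coneHeight_mem hι y)
  rw [hι.inner_add] at this
  linarith

theorem cos_smul_add_mem_iff (h : IsDualConePair e C C') (hι : IsOrthParam e ι) {u}
    (hu : u ≠ 0) {θ : ℝ} (hθ : θ ∈ Set.Ioo 0 π) :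
    Real.cos θ • e + Real.sin θ • ι u ∈ C ↔ θ ≤ arctan (coneHeight e ι C u)⁻¹ := by
  have hs : 0 < Real.sin θ := Real.sin_pos_of_pos_of_lt_pi hθ.1 hθ.2
  have hp := h.coneHeight_pos hι hu
  rw [← map_smul, ← h.coneHeight_le_iff hι, h.coneHeight_smul hι hs]
  rcases lt_or_ge θ (π / 2) with hlt | hge
  · have hc : 0 < Real.cos θ := Real.cos_pos_of_mem_Ioo ⟨by linarith [hθ.1], hlt⟩
    rw [← arctan_tan (x := θ) (by linarith [hθ.1]) hlt, arctan_le_arctan_iff,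
      arctan_tan (by linarith [hθ.1]) hlt, tan_eq_sin_div_cos, ← one_div, div_le_div_iff₀ hc hp,
      one_mul]
  · have hc : Real.cos θ ≤ 0 := Real.cos_nonpos_of_pi_div_two_le_of_le hge (by linarith [hθ.2])
    constructor
    · intro h'
      linarith [mul_pos hs hp]
    · intro h'
      linarith [arctan_lt_pi_div_two (coneHeight e ι C u)⁻¹]

theorem sphRadial_eq (h : IsDualConePair e C C') (hι : IsOrthParam e ι) {u} (hu : ‖u‖ = 1) :
    sphRadial (C ∩ uSphere d) e (ι u) = arctan (coneHeight e ι C u)⁻¹ := by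
  have hu0 : u ≠ 0 := by rintro rfl; simp at hu
  have hp := h.coneHeight_pos hι hu0
  have he : e ∈ C := by
    obtain ⟨R, -, hR⟩ := h.exists_mem (ι := ι)
    simpa using hR 0 1 (by simp)
  have hset : {t : ℝ | 0 ≤ t ∧ t ≤ π / 2 ∧
      Real.cos t • e + Real.sin t • ι u ∈ C ∩ uSphere d} =
      Set.Icc 0 (arctan (coneHeight e ι C u)⁻¹) := by
    ext t
    have hS : Real.cos t • e + Real.sin t • ι u ∈ uSphere d := by
      have := hι.norm_sq_add (Real.cos t) (Real.sin t • u)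
      rw [norm_smul, hu, mul_one, Real.norm_eq_abs, sq_abs, Real.cos_sq_add_sin_sq,
        map_smul] at this
      rw [uSphere, mem_sphere_zero_iff_norm]
      nlinarith [norm_nonneg (Real.cos t • e + Real.sin t • ι u)]
    simp only [Set.mem_ofPred_eq, Set.mem_inter_iff, hS, and_true, Set.mem_Icc]
    have hlt := arctan_lt_pi_div_two (coneHeight e ι C u)⁻¹
    constructor
    · rintro ⟨h0, h1, h2⟩
      refine ⟨h0, ?_⟩
      rcases h0.eq_or_lt with rfl | h0
      · exact (arctan_pos.2 (inv_pos.2 hp)).le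
      · exact (h.cos_smul_add_mem_iff hι hu0 ⟨h0, by linarith [pi_pos]⟩).1 h2
    · rintro ⟨h0, h1⟩
      refine ⟨h0, by linarith, ?_⟩
      rcases h0.eq_or_lt with rfl | h0
      · simpa using he
      · exact (h.cos_smul_add_mem_iff hι hu0 ⟨h0, by linarith [pi_pos]⟩).2 h1
  rw [sphRadial, hset, csSup_Icc (arctan_pos.2 (inv_pos.2 hp)).le]

end IsDualConePair

section

section Dfun

variable {m : ℕ}

theorem Dfun_succ (x : ℝ) : Dfun (m + 1) x = ∫ t in (0 : ℝ)..x, Real.sin t ^ m := rfl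

theorem intervalIntegrable_sin_pow (a b : ℝ) :
    IntervalIntegrable (fun t => Real.sin t ^ m) volume a b :=
  (by fun_prop : Continuous fun t => Real.sin t ^ m).intervalIntegrable a b

theorem Dfun_sub (a b : ℝ) : Dfun (m + 1) b - Dfun (m + 1) a = ∫ t in a..b, Real.sin t ^ m := by
  rw [Dfun_succ, Dfun_succ, intervalIntegral.integral_interval_sub_left
    (intervalIntegrable_sin_pow _ _) (intervalIntegrable_sin_pow _ _)]

theorem hasDerivAt_Dfun (x : ℝ) : HasDerivAt (Dfun (m + 1)) (Real.sin x ^ m) x := by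
  have hc : Continuous fun t => Real.sin t ^ m := by fun_prop
  exact intervalIntegral.integral_hasDerivAt_right (intervalIntegrable_sin_pow _ _)
    (hc.stronglyMeasurableAtFilter _ _) hc.continuousAt

theorem continuous_Dfun : Continuous (Dfun (m + 1)) :=
  continuous_iff_continuousAt.2 fun x => (hasDerivAt_Dfun x).continuousAt

@[simp]
theorem Dfun_zero : Dfun (m + 1) 0 = 0 := by simp [Dfun_succ]

theorem Dfun_mono {a b : ℝ} (ha : 0 ≤ a) (hab : a ≤ b) (hb : b ≤ π) :
    Dfun (m + 1) a ≤ Dfun (m + 1) b := by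
  rw [← sub_nonneg, Dfun_sub]
  exact intervalIntegral.integral_nonneg hab fun t ht =>
    pow_nonneg (Real.sin_nonneg_of_nonneg_of_le_pi (ha.trans ht.1) (ht.2.trans hb)) _

theorem Dfun_nonneg {a : ℝ} (ha : 0 ≤ a) (hb : a ≤ π) : 0 ≤ Dfun (m + 1) a := by
  simpa using Dfun_mono (m := m) le_rfl ha hb

theorem Dfun_pos {a : ℝ} (ha : 0 < a) (hb : a ≤ π) : 0 < Dfun (m + 1) a :=
  intervalIntegral.intervalIntegral_pos_of_pos_on (intervalIntegrable_sin_pow _ _)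
    (fun _ ht => pow_pos (Real.sin_pos_of_pos_of_lt_pi ht.1 (ht.2.trans_le hb)) _) ha

theorem Dfun_lt {a b : ℝ} (ha : 0 ≤ a) (hab : a < b) (hb : b ≤ π) :
    Dfun (m + 1) a < Dfun (m + 1) b := by
  rw [← sub_pos, Dfun_sub]
  exact intervalIntegral.intervalIntegral_pos_of_pos_on (intervalIntegrable_sin_pow _ _)
    (fun _ ht => pow_pos (Real.sin_pos_of_pos_of_lt_pi (ha.trans_lt ht.1) (ht.2.trans_le hb)) _) hab

theorem Dfun_pi_sub (x : ℝ) : Dfun (m + 1) (π - x) = Dfun (m + 1) π - Dfun (m + 1) x := by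
  rw [eq_sub_iff_add_eq', ← eq_sub_iff_add_eq, Dfun_sub, Dfun_succ]
  have := intervalIntegral.integral_comp_sub_left (fun t => Real.sin t ^ m) π (a := 0) (b := x)
  simp only [Real.sin_pi_sub, sub_zero] at this
  exact this

theorem Dfun_pi : Dfun (m + 1) π = 2 * Dfun (m + 1) (π / 2) := by
  have := Dfun_pi_sub (m := m) (π / 2)
  rw [show π - π / 2 = π / 2 by ring] at this
  linarith

theorem Dfun_pi_div_two_le_one (hm : 1 ≤ m) : Dfun (m + 1) (π / 2) ≤ 1 := by
  have : Dfun (m + 1) (π / 2) ≤ ∫ t in (0 : ℝ)..(π / 2), Real.sin t := by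
    rw [Dfun_succ]
    refine intervalIntegral.integral_mono_on (by positivity) (intervalIntegrable_sin_pow _ _)
      (Real.continuous_sin.intervalIntegrable _ _) fun t ht => ?_
    have h0 := Real.sin_nonneg_of_nonneg_of_le_pi ht.1 (by linarith [ht.2, pi_pos])
    exact pow_le_of_le_one h0 (Real.sin_le_one t) (by omega)
  simpa using this

theorem lintegral_Ioo_sin_pow {a b : ℝ} (ha : 0 ≤ a) (hab : a ≤ b) (hb : b ≤ π) :
    ∫⁻ θ in Set.Ioo a b, ENNReal.ofReal (Real.sin θ ^ m) =
      ENNReal.ofReal (Dfun (m + 1) b - Dfun (m + 1) a) := by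
  rw [Dfun_sub, intervalIntegral.integral_of_le hab, ← restrict_Ioo_eq_restrict_Ioc,
    ofReal_integral_eq_lintegral_ofReal]
  · exact (intervalIntegrable_sin_pow a b).1.mono_set Set.Ioo_subset_Ioc_self
  · filter_upwards [ae_restrict_mem measurableSet_Ioo] with t ht
    exact pow_nonneg (Real.sin_nonneg_of_nonneg_of_le_pi (ha.trans ht.1.le) (ht.2.le.trans hb)) _

end Dfun

/-- The normalizing constant of `sigmaMeas` in geodesic polar coordinates. -/
def sigmaConst (m : ℕ) : ℝ≥0∞ :=
  sigmaMeas (m + 1) (uSphere (m + 1)) / ENNReal.ofReal (2 * Dfun (m + 1) (π / 2))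

variable {m : ℕ}

theorem Dfun_pi_div_two_pos : 0 < Dfun (m + 1) (π / 2) :=
  Dfun_pos (by positivity) (by linarith [pi_pos])

theorem sigmaMeas_uSphere_ne_top : sigmaMeas (m + 1) (uSphere (m + 1)) ≠ ∞ := by
  rw [sigmaMeas, Measure.restrict_apply_self]
  exact hausdorffMeasure_sphere_ne_top (m + 1)

theorem sigmaMeas_uSphere_ne_zero : sigmaMeas (m + 1) (uSphere (m + 1)) ≠ 0 := by
  rw [sigmaMeas, Measure.restrict_apply_self]
  exact hausdorffMeasure_sphere_ne_zero (m + 1)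

instance : IsFiniteMeasure (sigmaMeas (m + 1)) := ⟨by
  have : sigmaMeas (m + 1) Set.univ = sigmaMeas (m + 1) (uSphere (m + 1)) := by
    simp [sigmaMeas]
  rw [this]
  exact sigmaMeas_uSphere_ne_top.lt_top⟩

theorem sigmaConst_ne_zero : sigmaConst m ≠ 0 :=
  (ENNReal.div_pos sigmaMeas_uSphere_ne_zero ENNReal.ofReal_ne_top).ne'

theorem sigmaConst_ne_top : sigmaConst m ≠ ∞ :=
  ENNReal.div_ne_top sigmaMeas_uSphere_ne_top (by simpa using Dfun_pi_div_two_pos)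

theorem sigmaMeas_uSphere :
    sigmaMeas (m + 1) (uSphere (m + 1)) =
      sigmaConst m * ENNReal.ofReal (2 * Dfun (m + 1) (π / 2)) := by
  rw [sigmaConst, ENNReal.div_mul_cancel (by simpa using Dfun_pi_div_two_pos)
    ENNReal.ofReal_ne_top]

namespace IsOrthParam

variable {e : Esp (m + 1)} {ι : EuclideanSpace ℝ (Fin (m + 1)) →ₗᵢ[ℝ] Esp (m + 1)}

theorem lintegral_sigmaMeas (h : IsOrthParam e ι) {f : Esp (m + 1) → ℝ≥0∞} (hf : Measurable f) :
    ∫⁻ x, f x ∂(sigmaMeas (m + 1)) = sigmaConst m * ∫⁻ u, (∫⁻ θ in Set.Ioo 0 π,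
      ENNReal.ofReal (Real.sin θ ^ m) * f (Real.cos θ • e + Real.sin θ • ι u))
        ∂(sphereProb m) := by
  obtain ⟨c, hc0, hct, hc⟩ := h.exists_lintegral_sigmaMeas
  have h1 := hc 1 measurable_one
  simp only [Pi.one_apply, mul_one, lintegral_const, measure_univ] at h1
  rw [lintegral_Ioo_sin_pow le_rfl pi_pos.le le_rfl, Dfun_zero, sub_zero, Dfun_pi] at h1
  have : c = sigmaConst m := by
    rw [sigmaConst, ENNReal.eq_div_iff (by simpa using Dfun_pi_div_two_pos)
      ENNReal.ofReal_ne_top, mul_comm, ← h1]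
    simp [sigmaMeas]
  rw [hc f hf, this]

theorem sigmaMeas_apply (h : IsOrthParam e ι) {A : Set (Esp (m + 1))} (hA : MeasurableSet A)
    {a b : EuclideanSpace ℝ (Fin (m + 1)) → ℝ}
    (ha : ∀ u, ‖u‖ = 1 → 0 ≤ a u ∧ a u ≤ b u ∧ b u ≤ π)
    (hab : ∀ u, ‖u‖ = 1 → ∀ θ ∈ Set.Ioo 0 π,
      (Real.cos θ • e + Real.sin θ • ι u ∈ A ↔ a u ≤ θ ∧ θ ≤ b u)) :
    sigmaMeas (m + 1) A = sigmaConst m * ∫⁻ u,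
      ENNReal.ofReal (Dfun (m + 1) (b u) - Dfun (m + 1) (a u)) ∂(sphereProb m) := by
  rw [← lintegral_indicator_one hA, h.lintegral_sigmaMeas (measurable_one.indicator hA)]
  congr 1
  refine lintegral_congr_ae ?_
  filter_upwards [ae_sphereProb_norm_eq_one m] with u hu
  obtain ⟨h0, h1, h2⟩ := ha u hu
  rw [← lintegral_Ioo_sin_pow h0 h1 h2, ← lintegral_indicator measurableSet_Ioo,
    ← lintegral_indicator measurableSet_Ioo]
  refine lintegral_congr_ae ?_
  filter_upwards [(Measure.ae_ne volume (a u)), (Measure.ae_ne volume (b u))] with θ hθa hθb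
  by_cases hθ : θ ∈ Set.Ioo 0 π
  · have hiff : Real.cos θ • e + Real.sin θ • ι u ∈ A ↔ θ ∈ Set.Ioo (a u) (b u) := by
      rw [hab u hu θ hθ, Set.mem_Ioo, hθa.symm.le_iff_lt, hθb.le_iff_lt]
    by_cases hA' : θ ∈ Set.Ioo (a u) (b u)
    · simp only [Set.indicator_of_mem hθ, Set.indicator_of_mem hA',
        Set.indicator_of_mem (hiff.2 hA'), Pi.one_apply, mul_one]
    · simp only [Set.indicator_of_mem hθ, Set.indicator_of_notMem hA',
        Set.indicator_of_notMem (mt hiff.1 hA'), mul_zero]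
  · rw [Set.indicator_of_notMem hθ, Set.indicator_of_notMem]
    exact fun hc => hθ ⟨h0.trans_lt hc.1, hc.2.trans_le h2⟩

theorem norm_cos_smul_add (h : IsOrthParam e ι) {u} (hu : ‖u‖ = 1) (θ : ℝ) :
    ‖Real.cos θ • e + Real.sin θ • ι u‖ = 1 := by
  have := h.norm_sq_add (Real.cos θ) (Real.sin θ • u)
  rw [norm_smul, hu, mul_one, Real.norm_eq_abs, sq_abs, Real.cos_sq_add_sin_sq, map_smul] at this
  nlinarith [norm_nonneg (Real.cos θ • e + Real.sin θ • ι u)]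

theorem inner_cos_smul_add (h : IsOrthParam e ι) (u) (θ : ℝ) :
    ⟪Real.cos θ • e + Real.sin θ • ι u, e⟫ = Real.cos θ := by
  rw [← map_smul, h.inner_add_right]

end IsOrthParam

theorem measurableSet_uSphere : MeasurableSet (uSphere (m + 1)) :=
  Metric.isClosed_sphere.measurableSet

theorem sigmaMeas_cap {e : Esp (m + 1)} (he : e ∈ uSphere (m + 1)) {α : ℝ} (h0 : 0 ≤ α)
    (hα : α ≤ π) :
    sigmaMeas (m + 1) (cap e α) = sigmaConst m * ENNReal.ofReal (Dfun (m + 1) α) := by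
  obtain ⟨ι, hι⟩ := exists_isOrthParam he
  have hA : MeasurableSet (cap e α) := by
    refine measurableSet_uSphere.inter (IsClosed.measurableSet ?_)
    exact isClosed_le (f := fun x => geo x e) (by unfold geo; fun_prop) continuous_const
  rw [hι.sigmaMeas_apply hA (a := fun _ => 0) (b := fun _ => α) (fun _ _ => ⟨le_rfl, h0, hα⟩)]
  · simp
  · intro u hu θ hθ
    simp only [cap, uSphere, Set.mem_ofPred_eq, mem_sphere_zero_iff_norm,
      hι.norm_cos_smul_add hu, geo, hι.inner_cos_smul_add, Real.arccos_cos hθ.1.le hθ.2.le,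
      hθ.1.le, true_and]

theorem abs_inner_le_sin_of_mem_cap {e : Esp (m + 1)} (he : e ∈ uSphere (m + 1)) {α : ℝ}
    (h0 : 0 ≤ α) (hα : α ≤ π / 2) {x y : Esp (m + 1)} (hx : ‖x‖ = 1) (hy : y ∈ cap e α)
    (hxy : ⟪x, y⟫ = 0) : |⟪x, e⟫| ≤ Real.sin α := by
  have he1 : ‖e‖ = 1 := by simpa [uSphere] using he
  have hy1 : ‖y‖ = 1 := by simpa [uSphere] using hy.1
  have hc : Real.cos α ≤ ⟪y, e⟫ := by
    have h1 := abs_le.1 (abs_real_inner_le_norm y e)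
    rw [hy1, he1, mul_one] at h1
    rw [← Real.cos_arccos h1.1 h1.2]
    exact Real.cos_le_cos_of_nonneg_of_le_pi (Real.arccos_nonneg _) (by linarith [pi_pos]) hy.2
  have hc0 : 0 ≤ Real.cos α := Real.cos_nonneg_of_neg_pi_div_two_le_of_le (by linarith) hα
  have h2 : ⟪x, e⟫ = ⟪x, e - ⟪y, e⟫ • y⟫ := by
    rw [inner_sub_right, real_inner_smul_right, hxy]; ring
  have h3 : ‖e - ⟪y, e⟫ • y‖ ^ 2 = 1 - ⟪y, e⟫ ^ 2 := by
    rw [← real_inner_self_eq_norm_sq]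
    simp only [inner_sub_left, inner_sub_right, real_inner_smul_left, real_inner_smul_right,
      real_inner_comm y e]
    rw [real_inner_self_eq_norm_sq, real_inner_self_eq_norm_sq, he1, hy1]
    ring
  have h4 := abs_real_inner_le_norm x (e - ⟪y, e⟫ • y)
  rw [← h2, hx, one_mul] at h4
  refine h4.trans (abs_le_of_sq_le_sq' ?_
    (Real.sin_nonneg_of_nonneg_of_le_pi h0 (by linarith [pi_pos]))).2
  rw [h3, Real.sin_sq]
  nlinarith

theorem sigmaMeas_abs_inner_le {e : Esp (m + 1)} (he : e ∈ uSphere (m + 1)) {α : ℝ}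
    (h0 : 0 ≤ α) (hα : α ≤ π / 2) :
    sigmaMeas (m + 1) {x | |⟪x, e⟫| ≤ Real.sin α} = sigmaConst m *
      ENNReal.ofReal (2 * (Dfun (m + 1) (π / 2) - Dfun (m + 1) (π / 2 - α))) := by
  obtain ⟨ι, hι⟩ := exists_isOrthParam he
  have hA : MeasurableSet {x : Esp (m + 1) | |⟪x, e⟫| ≤ Real.sin α} :=
    (isClosed_le (by fun_prop) continuous_const).measurableSet
  rw [hι.sigmaMeas_apply hA (a := fun _ => π / 2 - α) (b := fun _ => π - (π / 2 - α))
    (fun _ _ => ⟨by linarith, by linarith, by linarith⟩)]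
  · rw [Dfun_pi_sub, Dfun_pi]
    simp only [lintegral_const, measure_univ, mul_one]
    congr 2; ring
  · intro u hu θ hθ
    rw [Set.mem_ofPred_eq, hι.inner_cos_smul_add, abs_le, ← Real.cos_pi_div_two_sub,
      ← Real.cos_pi_sub,
      Real.strictAntiOn_cos.le_iff_ge (by constructor <;> linarith) ⟨hθ.1.le, hθ.2.le⟩,
      Real.strictAntiOn_cos.le_iff_ge ⟨hθ.1.le, hθ.2.le⟩ (by constructor <;> linarith [pi_pos])]
    exact and_comm

theorem U1_cap_le {e : Esp (m + 1)} (he : e ∈ uSphere (m + 1)) {α : ℝ}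
    (h0 : 0 ≤ α) (hα : α ≤ π / 2) :
    U1 (m + 1) (cap e α) ≤ (Dfun (m + 1) (π / 2) - Dfun (m + 1) (π / 2 - α)) /
      (2 * Dfun (m + 1) (π / 2)) := by
  have hD := Dfun_pi_div_two_pos (m := m)
  have hc : 0 < (sigmaConst m).toReal := ENNReal.toReal_pos sigmaConst_ne_zero sigmaConst_ne_top
  have hS : 0 ≤ Dfun (m + 1) (π / 2) - Dfun (m + 1) (π / 2 - α) :=
    sub_nonneg.2 (Dfun_mono (by linarith) (by linarith) (by linarith [pi_pos]))
  have hle : sigmaMeas (m + 1) {x | ∃ y ∈ cap e α, ⟪x, y⟫ = 0} ≤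
      sigmaMeas (m + 1) {x | |⟪x, e⟫| ≤ Real.sin α} := by
    refine measure_mono_ae ?_
    filter_upwards [ae_restrict_mem measurableSet_uSphere] with x hx
    rintro ⟨y, hy, hxy⟩
    exact abs_inner_le_sin_of_mem_cap he h0 hα (by simpa [uSphere] using hx) hy hxy
  have hle' := ENNReal.toReal_mono (measure_ne_top _ _) hle
  rw [sigmaMeas_abs_inner_le he h0 hα, ENNReal.toReal_mul, ENNReal.toReal_ofReal (by positivity)]
    at hle'
  rw [U1, omegaTot, sigmaMeas_uSphere, ENNReal.toReal_mul, ENNReal.toReal_ofReal (by positivity)]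
  refine (mul_le_mul_of_nonneg_left hle' (by positivity)).trans (le_of_eq ?_)
  field_simp

namespace IsDualConePair

variable {e : Esp (m + 1)} {C C' : Set (Esp (m + 1))}
  {ι : EuclideanSpace ℝ (Fin (m + 1)) →ₗᵢ[ℝ] Esp (m + 1)}

theorem measurable_Dfun_arctan (h : IsDualConePair e C C') (hι : IsOrthParam e ι) :
    Measurable fun u => Dfun (m + 1) (arctan (coneHeight e ι C u)⁻¹) :=
  continuous_Dfun.measurable.comp
    (continuous_arctan.measurable.comp (h.measurable_coneHeight hι).inv)

theorem integrable_Dfun_arctan (h : IsDualConePair e C C') (hι : IsOrthParam e ι) :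
    Integrable (fun u => Dfun (m + 1) (arctan (coneHeight e ι C u)⁻¹)) (sphereProb m) := by
  refine Integrable.of_bound (h.measurable_Dfun_arctan hι).aestronglyMeasurable
    (Dfun (m + 1) π) (.of_forall fun u => ?_)
  have h0 : 0 ≤ arctan (coneHeight e ι C u)⁻¹ :=
    arctan_nonneg.2 (inv_nonneg.2 (h.coneHeight_nonneg hι u))
  have h1 := arctan_lt_pi_div_two (coneHeight e ι C u)⁻¹
  rw [Real.norm_of_nonneg (Dfun_nonneg h0 (by linarith [pi_pos]))]
  exact Dfun_mono h0 (by linarith [pi_pos]) le_rfl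

theorem sigmaMeas_inter (h : IsDualConePair e C C') (hι : IsOrthParam e ι) :
    sigmaMeas (m + 1) (C ∩ uSphere (m + 1)) = sigmaConst m *
      ENNReal.ofReal (∫ u, Dfun (m + 1) (arctan (coneHeight e ι C u)⁻¹) ∂(sphereProb m)) := by
  have hb : ∀ u, 0 ≤ arctan (coneHeight e ι C u)⁻¹ ∧ arctan (coneHeight e ι C u)⁻¹ ≤ π :=
    fun u => ⟨arctan_nonneg.2 (inv_nonneg.2 (h.coneHeight_nonneg hι u)),
      by linarith [arctan_lt_pi_div_two (coneHeight e ι C u)⁻¹, pi_pos]⟩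
  rw [hι.sigmaMeas_apply (h.isClosed.measurableSet.inter measurableSet_uSphere) (a := fun _ => 0)
    (b := fun u => arctan (coneHeight e ι C u)⁻¹) (fun u _ => ⟨le_rfl, hb u⟩),
    ofReal_integral_eq_lintegral_ofReal (h.integrable_Dfun_arctan hι)
      (.of_forall fun u => Dfun_nonneg (hb u).1 (hb u).2)]
  · simp
  · intro u hu θ hθ
    rw [Set.mem_inter_iff, h.cos_smul_add_mem_iff hι (by rintro rfl; simp at hu) hθ]
    simp [uSphere, hι.norm_cos_smul_add hu, hθ.1.le]

theorem U1_ge (h : IsDualConePair e C C') (hι : IsOrthParam e ι) :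
    (Dfun (m + 1) (π / 2) -
      ∫ u, Dfun (m + 1) (arctan (coneHeight e ι C' u)⁻¹) ∂(sphereProb m)) /
        (2 * Dfun (m + 1) (π / 2)) ≤ U1 (m + 1) (C ∩ uSphere (m + 1)) := by
  set I := ∫ u, Dfun (m + 1) (arctan (coneHeight e ι C' u)⁻¹) ∂(sphereProb m) with hI
  have hI0 : 0 ≤ I := integral_nonneg fun u =>
    Dfun_nonneg (arctan_nonneg.2 (inv_nonneg.2 (h.symm.coneHeight_nonneg hι u)))
      (by linarith [arctan_lt_pi_div_two (coneHeight e ι C' u)⁻¹, pi_pos])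
  have hD := Dfun_pi_div_two_pos (m := m)
  have hc : 0 < (sigmaConst m).toReal := ENNReal.toReal_pos sigmaConst_ne_zero sigmaConst_ne_top
  set H : Set (Esp (m + 1)) := {x | ∃ y ∈ C ∩ uSphere (m + 1), ⟪x, y⟫ = 0}
  have hcover : uSphere (m + 1) ⊆
      H ∪ (C' ∩ uSphere (m + 1) ∪ Neg.neg ⁻¹' (C' ∩ uSphere (m + 1))) := by
    intro x hx
    by_cases hp : x ∈ C'
    · exact Or.inr (Or.inl ⟨hp, hx⟩)
    by_cases hn : -x ∈ C'
    · exact Or.inr (Or.inr ⟨hn, by simpa [uSphere] using hx⟩)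
    left
    rw [h.mem_iff'] at hp hn
    push Not at hp hn
    obtain ⟨y, hy, hyx⟩ := hp
    obtain ⟨z, hz, hzx⟩ := hn
    rw [inner_neg_right, neg_lt_zero] at hzx
    set v := ⟪z, x⟫ • y + (-⟪y, x⟫) • z with hv
    have hvC : v ∈ C := h.add_mem (h.smul_mem hzx.le hy) (h.smul_mem (by linarith) hz)
    have hvx : ⟪x, v⟫ = 0 := by
      rw [hv, inner_add_right, real_inner_smul_right, real_inner_smul_right, real_inner_comm x z,
        real_inner_comm x y]
      ring
    obtain ⟨δ, hδ, hpos⟩ := h.exists_pos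
    have hv0 : v ≠ 0 := by
      intro h0
      have h1 : ⟪v, e⟫ = 0 := by rw [h0, inner_zero_left]
      rw [hv, inner_add_left, real_inner_smul_left, real_inner_smul_left] at h1
      have hy0 : 0 < ‖y‖ := norm_pos_iff.2 (by rintro rfl; simp at hyx)
      have hye : 0 < ⟪y, e⟫ := lt_of_lt_of_le (mul_pos hδ hy0) (hpos y hy)
      have hze : 0 ≤ ⟪z, e⟫ := le_trans (by positivity) (hpos z hz)
      nlinarith [mul_pos hzx hye]
    exact ⟨‖v‖⁻¹ • v, ⟨h.smul_mem (by positivity) hvC, by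
      simp [uSphere, norm_smul, inv_mul_cancel₀ (norm_ne_zero_iff.2 hv0)]⟩, by
      rw [real_inner_smul_right, hvx, mul_zero]⟩
  have hneg : sigmaMeas (m + 1) (Neg.neg ⁻¹' (C' ∩ uSphere (m + 1))) =
      sigmaMeas (m + 1) (C' ∩ uSphere (m + 1)) := by
    have h1 : Neg.neg ⁻¹' (C' ∩ uSphere (m + 1)) ⊆ uSphere (m + 1) := fun x hx => by
      simpa [uSphere] using hx.2
    rw [sigmaMeas, Measure.restrict_eq_self _ h1, Measure.restrict_eq_self _ Set.inter_subset_right]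
    exact (IsometryEquiv.neg (Esp (m + 1))).hausdorffMeasure_preimage _ _
  have hle : sigmaMeas (m + 1) (uSphere (m + 1)) ≤ sigmaMeas (m + 1) H +
      (sigmaMeas (m + 1) (C' ∩ uSphere (m + 1)) + sigmaMeas (m + 1) (C' ∩ uSphere (m + 1))) := by
    refine (measure_mono hcover).trans ((measure_union_le _ _).trans ?_)
    gcongr
    exact (measure_union_le _ _).trans_eq (by rw [hneg])
  have hle' := ENNReal.toReal_mono (by simp [measure_ne_top]) hle
  rw [ENNReal.toReal_add (by simp) (by simp), ENNReal.toReal_add (by simp) (by simp),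
    h.symm.sigmaMeas_inter hι, sigmaMeas_uSphere, ENNReal.toReal_mul, ENNReal.toReal_mul,
    ENNReal.toReal_ofReal (by positivity), ENNReal.toReal_ofReal hI0] at hle'
  rw [U1, omegaTot, sigmaMeas_uSphere, ENNReal.toReal_mul, ENNReal.toReal_ofReal (by positivity),
    one_div_mul_eq_div, div_le_div_iff₀ (by positivity) (by positivity)]
  have := mul_le_mul_of_nonneg_left hle' hD.le
  nlinarith

end IsDualConePair

end

section

theorem le_of_hasDerivAt_sign_change {f f' : ℝ → ℝ} {b c x : ℝ}
    (hf : ∀ y ∈ Set.Ico 0 b, HasDerivAt f (f' y) y) (hc : c ∈ Set.Ico 0 b) (hx : x ∈ Set.Ico 0 b)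
    (h1 : ∀ y ∈ Set.Ioo 0 c, f' y ≤ 0) (h2 : ∀ y ∈ Set.Ioo c b, 0 ≤ f' y) : f c ≤ f x := by
  have hsub1 : Set.Icc 0 c ⊆ Set.Ico 0 b := fun y hy => ⟨hy.1, hy.2.trans_lt hc.2⟩
  have hsub2 : Set.Ico c b ⊆ Set.Ico 0 b := fun y hy => ⟨hc.1.trans hy.1, hy.2⟩
  rcases le_total x c with hxc | hxc
  · refine antitoneOn_of_deriv_nonpos (convex_Icc 0 c)
      (fun y hy => (hf y (hsub1 hy)).continuousAt.continuousWithinAt)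
      (fun y hy => (hf y (hsub1 (interior_subset hy))).differentiableAt.differentiableWithinAt)
      (fun y hy => ?_) ⟨hx.1, hxc⟩ ⟨hc.1, le_rfl⟩ hxc
    rw [(hf y (hsub1 (interior_subset hy))).deriv]
    rw [interior_Icc] at hy
    exact h1 y hy
  · refine monotoneOn_of_deriv_nonneg (convex_Ico c b)
      (fun y hy => (hf y (hsub2 hy)).continuousAt.continuousWithinAt)
      (fun y hy => (hf y (hsub2 (interior_subset hy))).differentiableAt.differentiableWithinAt)
      (fun y hy => ?_) ⟨le_rfl, hc.2⟩ ⟨hxc, hx.2⟩ hxc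
    rw [(hf y (hsub2 (interior_subset hy))).deriv]
    rw [interior_Ico] at hy
    exact h2 y hy

variable {m : ℕ}

theorem cos_pos_of_mem_Ico {x : ℝ} (hx : x ∈ Set.Ico 0 (π / 2)) : 0 < Real.cos x :=
  Real.cos_pos_of_mem_Ioo ⟨by linarith [hx.1, pi_pos], hx.2⟩

theorem sin_nonneg_of_mem_Ico {x : ℝ} (hx : x ∈ Set.Ico 0 (π / 2)) : 0 ≤ Real.sin x :=
  Real.sin_nonneg_of_nonneg_of_le_pi hx.1 (by linarith [hx.2, pi_pos])

theorem hasDerivAt_tan_pow {x : ℝ} (hx : x ∈ Set.Ico 0 (π / 2)) :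
    HasDerivAt (fun y => Real.tan y ^ (m + 1))
      ((m + 1) * (Real.sin x ^ m / Real.cos x ^ (m + 2))) x := by
  have hc := cos_pos_of_mem_Ico hx
  refine ((Real.hasDerivAt_tan hc.ne').fun_pow (m + 1)).congr_deriv ?_
  rw [tan_eq_sin_div_cos]
  simp only [Nat.add_sub_cancel, div_pow]
  push_cast
  field_simp
  ring

/-- `D` lies below its tangent when expressed as a function of `tan ^ d`. -/
theorem Dfun_sub_le_tan_pow {c x : ℝ} (hc : c ∈ Set.Ico 0 (π / 2)) (hx : x ∈ Set.Ico 0 (π / 2)) :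
    Dfun (m + 1) x - Dfun (m + 1) c ≤
      Real.cos c ^ (m + 2) / (m + 1) * (Real.tan x ^ (m + 1) - Real.tan c ^ (m + 1)) := by
  have hcc := cos_pos_of_mem_Ico hc
  have key := le_of_hasDerivAt_sign_change
    (f := fun y => Real.cos c ^ (m + 2) / (m + 1) * Real.tan y ^ (m + 1) - Dfun (m + 1) y)
    (f' := fun y => Real.cos c ^ (m + 2) / (m + 1) *
      ((m + 1) * (Real.sin y ^ m / Real.cos y ^ (m + 2))) - Real.sin y ^ m)
    (b := π / 2) (fun y hy => ((hasDerivAt_tan_pow hy).const_mul _).sub (hasDerivAt_Dfun y)) hc hx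
    ?_ ?_
  · linarith
  · intro y hy
    have hy' : y ∈ Set.Ico 0 (π / 2) := ⟨hy.1.le, hy.2.trans hc.2⟩
    have hcy := cos_pos_of_mem_Ico hy'
    have hle : Real.cos c ≤ Real.cos y :=
      Real.cos_le_cos_of_nonneg_of_le_pi hy.1.le (by linarith [hc.2, pi_pos]) hy.2.le
    have : Real.cos c ^ (m + 2) / (m + 1) * ((m + 1) * (Real.sin y ^ m / Real.cos y ^ (m + 2))) -
        Real.sin y ^ m = Real.sin y ^ m * ((Real.cos c ^ (m + 2) - Real.cos y ^ (m + 2)) /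
          Real.cos y ^ (m + 2)) := by field_simp
    rw [this]
    have hp := pow_le_pow_left₀ hcc.le hle (m + 2)
    exact mul_nonpos_of_nonneg_of_nonpos (pow_nonneg (sin_nonneg_of_mem_Ico hy') _)
      (div_nonpos_of_nonpos_of_nonneg (by linarith) (by positivity))
  · intro y hy
    have hy' : y ∈ Set.Ico 0 (π / 2) := ⟨hc.1.trans hy.1.le, hy.2⟩
    have hcy := cos_pos_of_mem_Ico hy'
    have hle : Real.cos y ≤ Real.cos c :=
      Real.cos_le_cos_of_nonneg_of_le_pi hc.1 (by linarith [hy.2, pi_pos]) hy.1.le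
    have : Real.cos c ^ (m + 2) / (m + 1) * ((m + 1) * (Real.sin y ^ m / Real.cos y ^ (m + 2))) -
        Real.sin y ^ m = Real.sin y ^ m * ((Real.cos c ^ (m + 2) - Real.cos y ^ (m + 2)) /
          Real.cos y ^ (m + 2)) := by field_simp
    rw [this]
    have hp := pow_le_pow_left₀ hcy.le hle (m + 2)
    exact mul_nonneg (pow_nonneg (sin_nonneg_of_mem_Ico hy') _)
      (div_nonneg (by linarith) (by positivity))

/-- Strong convexity of `tan ^ d` as a function of `D`, for `d ≥ 3`. -/
theorem tan_pow_ge_of_two_le (hm : 2 ≤ m) {a x : ℝ} (ha : a ∈ Set.Ico 0 (π / 2))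
    (hx : x ∈ Set.Ico 0 (π / 2)) :
    Real.tan a ^ (m + 1) + (m + 1) / Real.cos a ^ (m + 2) * (Dfun (m + 1) x - Dfun (m + 1) a) +
      (m + 1) * (m + 2) * (Dfun (m + 1) x - Dfun (m + 1) a) ^ 2 ≤ Real.tan x ^ (m + 1) := by
  have hca := cos_pos_of_mem_Ico ha
  set G : ℝ → ℝ := fun y => (m + 1) / Real.cos y ^ (m + 2) -
    2 * ((m + 1) * (m + 2)) * Dfun (m + 1) y with hG
  have hGd : ∀ y ∈ Set.Ico 0 (π / 2), HasDerivAt G ((m + 1) * ((m + 2) * Real.sin y /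
      Real.cos y ^ (m + 3)) - 2 * ((m + 1) * (m + 2)) * Real.sin y ^ m) y := by
    intro y hy
    have hcy := cos_pos_of_mem_Ico hy
    have h1 := (((Real.hasDerivAt_cos y).fun_pow (m + 2)).fun_inv (pow_pos hcy (m + 2)).ne').const_mul
      ((m : ℝ) + 1)
    refine HasDerivAt.sub ?_ ((hasDerivAt_Dfun y).const_mul _)
    simp only [div_eq_mul_inv]
    refine h1.congr_deriv ?_
    simp only [show m + 2 - 1 = m + 1 by omega]
    push_cast
    field_simp
    ring
  have hGmono : MonotoneOn G (Set.Ico 0 (π / 2)) := by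
    refine monotoneOn_of_deriv_nonneg (convex_Ico 0 (π / 2))
      (fun y hy => (hGd y hy).continuousAt.continuousWithinAt)
      (fun y hy => (hGd y (interior_subset hy)).differentiableAt.differentiableWithinAt)
      (fun y hy => ?_)
    have hy := interior_subset hy
    rw [(hGd y hy).deriv]
    have hcy := cos_pos_of_mem_Ico hy
    have hsy := sin_nonneg_of_mem_Ico hy
    have hhalf : 2 * (Real.sin y ^ (m - 1) * Real.cos y ^ (m + 3)) ≤ 1 := by
      have h1 : Real.sin y ^ (m - 1) ≤ Real.sin y :=
        pow_le_of_le_one hsy (Real.sin_le_one y) (by omega)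
      have h2 : Real.cos y ^ (m + 3) ≤ Real.cos y :=
        pow_le_of_le_one hcy.le (Real.cos_le_one y) (by omega)
      have h3 := mul_le_mul h1 h2 (by positivity) hsy
      nlinarith [Real.sin_sq_add_cos_sq y, sq_nonneg (Real.sin y - Real.cos y)]
    have hs : Real.sin y ^ m = Real.sin y * Real.sin y ^ (m - 1) := by
      rw [← pow_succ', Nat.sub_add_cancel (by omega)]
    have : (m + 1) * ((m + 2) * Real.sin y / Real.cos y ^ (m + 3)) -
        2 * ((m + 1) * (m + 2)) * Real.sin y ^ m = (m + 1) * (m + 2) * Real.sin y *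
        ((1 - 2 * (Real.sin y ^ (m - 1) * Real.cos y ^ (m + 3))) / Real.cos y ^ (m + 3)) := by
      rw [hs]; field_simp
    rw [this]
    exact mul_nonneg (by positivity) (div_nonneg (by linarith) (by positivity))
  have key := le_of_hasDerivAt_sign_change
    (f := fun y => Real.tan y ^ (m + 1) - (m + 1) / Real.cos a ^ (m + 2) * Dfun (m + 1) y -
      (m + 1) * (m + 2) * (Dfun (m + 1) y - Dfun (m + 1) a) ^ 2)
    (f' := fun y => Real.sin y ^ m * (G y - G a))
    (b := π / 2) (c := a) (x := x) ?_ ha hx ?_ ?_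
  · simp only [sub_self] at key
    linarith
  · intro y hy
    have hcy := cos_pos_of_mem_Ico hy
    refine (((hasDerivAt_tan_pow hy).fun_sub ((hasDerivAt_Dfun y).const_mul _)).fun_sub
      ((((hasDerivAt_Dfun y).sub_const (Dfun (m + 1) a)).fun_pow 2).const_mul _)).congr_deriv ?_
    simp only [hG]
    push_cast
    ring
  · intro y hy
    have hy' : y ∈ Set.Ico 0 (π / 2) := ⟨hy.1.le, hy.2.trans ha.2⟩
    exact mul_nonpos_of_nonneg_of_nonpos (pow_nonneg (sin_nonneg_of_mem_Ico hy') _)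
      (sub_nonpos.2 (hGmono hy' ha hy.2.le))
  · intro y hy
    have hy' : y ∈ Set.Ico 0 (π / 2) := ⟨ha.1.trans hy.1.le, hy.2⟩
    exact mul_nonneg (pow_nonneg (sin_nonneg_of_mem_Ico hy') _)
      (sub_nonneg.2 (hGmono ha hy' hy.1.le))

theorem Dfun_two (x : ℝ) : Dfun (1 + 1) x = 1 - Real.cos x := by
  simp [Dfun_succ]

theorem tan_sq_ge {a x : ℝ} (ha : a ∈ Set.Ico 0 (π / 2)) (hx : x ∈ Set.Ico 0 (π / 2)) :
    Real.tan a ^ 2 + 2 / Real.cos a ^ 3 * (Real.cos a - Real.cos x) +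
      (2 + Real.cos a) / Real.cos a ^ 3 * (Real.cos a - Real.cos x) ^ 2 ≤ Real.tan x ^ 2 := by
  have hca := cos_pos_of_mem_Ico ha
  have hcx := cos_pos_of_mem_Ico hx
  have h1 := Real.cos_le_one x
  have ht : ∀ y, 0 < Real.cos y → Real.tan y ^ 2 = 1 / Real.cos y ^ 2 - 1 := by
    intro y hy
    rw [tan_eq_sin_div_cos, div_pow, Real.sin_sq]
    field_simp
  rw [ht a hca, ht x hcx]
  set c := Real.cos x
  set c₀ := Real.cos a
  have hid : 1 / c ^ 2 - 1 - (1 / c₀ ^ 2 - 1 + 2 / c₀ ^ 3 * (c₀ - c) +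
      (2 + c₀) / c₀ ^ 3 * (c₀ - c) ^ 2) =
      (c₀ - c) ^ 2 / (c ^ 2 * c₀ ^ 3) * (2 * c + c₀ - c ^ 2 * (2 + c₀)) := by
    field_simp
    ring
  have h2 : 0 ≤ 2 * c + c₀ - c ^ 2 * (2 + c₀) := by
    have : c ^ 2 ≤ c := by nlinarith
    nlinarith
  have h3 : 0 ≤ (c₀ - c) ^ 2 / (c ^ 2 * c₀ ^ 3) * (2 * c + c₀ - c ^ 2 * (2 + c₀)) := by positivity
  linarith

theorem choose_two_cast (m : ℕ) : (((m + 1 + 1).choose 2 : ℕ) : ℝ) = (m + 1) * (m + 2) / 2 := by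
  rw [Nat.cast_choose_two]; push_cast; ring

/-- A quadratic lower bound for `tan ^ d` in terms of `D`, with a constant that is large compared
with `tan a ^ d`. -/
theorem exists_tan_pow_ge (hm : 1 ≤ m) {a : ℝ} (ha : a ∈ Set.Ico 0 (π / 2)) :
    ∃ κ > 0, (∀ x ∈ Set.Ico 0 (π / 2), Real.tan a ^ (m + 1) +
      (m + 1) / Real.cos a ^ (m + 2) * (Dfun (m + 1) x - Dfun (m + 1) a) +
      κ * (Dfun (m + 1) x - Dfun (m + 1) a) ^ 2 ≤ Real.tan x ^ (m + 1)) ∧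
      2 * ((m + 1 + 1).choose 2 : ℝ) * (Real.tan a ^ (m + 1) + κ) ≤
        κ * (Real.tan a ^ (m + 1) + ((m + 1 + 1).choose 2 : ℝ) * (π / 2) ^ 2) := by
  have hca := cos_pos_of_mem_Ico ha
  have hpi : 9.8 ≤ π ^ 2 := by nlinarith [pi_gt_d2]
  rcases eq_or_lt_of_le hm with rfl | hm
  · refine ⟨(2 + Real.cos a) / Real.cos a ^ 3, by positivity, fun x hx => ?_, ?_⟩
    · have := tan_sq_ge ha hx
      rw [Dfun_two, Dfun_two]
      norm_num
      ring_nf at this ⊢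
      exact this
    · rw [choose_two_cast]
      set κ := (2 + Real.cos a) / Real.cos a ^ 3 with hκ
      have ht : Real.tan a ^ 2 = 1 / Real.cos a ^ 2 - 1 := by
        rw [tan_eq_sin_div_cos, div_pow, Real.sin_sq]
        field_simp
      set c := Real.cos a
      have hc1 : c ≤ 1 := Real.cos_le_one a
      norm_num
      rw [ht]
      have hκ3 : 3 ≤ κ := by
        rw [hκ, le_div_iff₀ (by positivity)]
        nlinarith [pow_le_one₀ hca.le hc1 (n := 2), pow_pos hca 2, pow_pos hca 3]
      have hκx : 1 / c ^ 2 ≤ 2.3 ∨ 6 ≤ κ := by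
        by_cases h : c ^ 2 ≤ 1 / 2.3
        · right
          rw [hκ, le_div_iff₀ (by positivity)]
          nlinarith [pow_pos hca 2, pow_pos hca 3]
        · left
          rw [div_le_iff₀ (by positivity)]
          linarith
      have hx0 : 1 ≤ 1 / c ^ 2 := by
        rw [le_div_iff₀ (by positivity)]
        nlinarith
      set y := 1 / c ^ 2
      have h5 : κ * (3 * (π / 2) ^ 2) ≥ κ * 7.35 := by
        apply mul_le_mul_of_nonneg_left _ (by linarith)
        nlinarith
      rcases hκx with h | h <;> nlinarith
  · refine ⟨(m + 1) * (m + 2), by positivity, fun x hx => tan_pow_ge_of_two_le hm ha hx, ?_⟩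
    rw [choose_two_cast]
    have hm0 : (0 : ℝ) < (m + 1) * (m + 2) := by positivity
    have ht : 0 ≤ Real.tan a ^ (m + 1) :=
      pow_nonneg (Real.tan_nonneg_of_nonneg_of_le_pi_div_two ha.1 ha.2.le) _
    set b := ((m : ℝ) + 1) * (m + 2)
    nlinarith [mul_pos hm0 hm0]

end

section

variable {m : ℕ}

theorem integrable_Dfun_comp {Ω : Type*} [MeasurableSpace Ω] {μ : Measure Ω}
    [IsProbabilityMeasure μ] {f : Ω → ℝ} (hf : Measurable f)
    (hf' : ∀ ω, f ω ∈ Set.Ico 0 (π / 2)) (a : ℝ) (k : ℕ) :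
    Integrable (fun ω => (Dfun (m + 1) (f ω) - a) ^ k) μ := by
  have hc : Continuous fun x => (Dfun (m + 1) x - a) ^ k := by
    have := continuous_Dfun (m := m)
    fun_prop
  obtain ⟨B, hB⟩ := (isCompact_Icc (a := (0 : ℝ)) (b := π / 2)).exists_bound_of_continuousOn
    hc.continuousOn
  exact Integrable.of_bound (hc.measurable.comp hf).aestronglyMeasurable B
    (.of_forall fun ω => hB _ (Set.Ico_subset_Icc_self (hf' ω)))

theorem deviation_le {b s s₀ x κ V S p n : ℝ} (hb : 0 < b) (hs0 : s₀ ≤ s) (hs : 0 ≤ s)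
    (hx : 0 < x) (hκ : 0 < κ) (hV : 0 ≤ V) (hV1 : V ≤ 1) (hS0 : 0 ≤ S) (hS1 : S ≤ 1) (hn : 0 < n)
    (hκb : 2 * b * (x + κ) ≤ κ * (x + b * p ^ 2)) :
    2 * (b * s₀ / (n * x * (x + b * p ^ 2))) * V * S ≤ s / n * (1 / x - 1 / (x + κ * V)) := by
  have e1 : s / n * (1 / x - 1 / (x + κ * V)) = s * (κ * V) / (n * x * (x + κ * V)) := by
    field_simp; ring
  have e2 : 2 * (b * s₀ / (n * x * (x + b * p ^ 2))) * V * S =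
      2 * b * s₀ * V * S / (n * x * (x + b * p ^ 2)) := by ring
  rw [e1, e2, div_le_div_iff₀ (by positivity) (by positivity)]
  have h1 : 2 * b * (x + κ * V) ≤ κ * (x + b * p ^ 2) := by
    refine le_trans ?_ hκb
    gcongr
    exact mul_le_of_le_one_right hκ.le hV1
  have h2 : s₀ * S ≤ s :=
    (mul_le_mul_of_nonneg_right hs0 hS0).trans (mul_le_of_le_one_right hs hS1)
  calc 2 * b * s₀ * V * S * (n * x * (x + κ * V))
      = (2 * b * (x + κ * V)) * (s₀ * S) * (V * (n * x)) := by ring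
    _ ≤ (2 * b * (x + κ * V)) * s * (V * (n * x)) := by gcongr
    _ ≤ (κ * (x + b * p ^ 2)) * s * (V * (n * x)) := by gcongr
    _ = _ := by ring

/-- The quantitative comparison between `∫ D ∘ g` and `D (π / 2 - α)` when `f` and `g` satisfy a
polarity inequality. -/
theorem integral_Dfun_le_of_polar (hm : 1 ≤ m) {Ω : Type*} [MeasurableSpace Ω] {μ : Measure Ω}
    [IsProbabilityMeasure μ] {f g : Ω → ℝ} (hf : Measurable f) (hg : Measurable g)
    (hf' : ∀ ω, f ω ∈ Set.Ico 0 (π / 2)) (hg' : ∀ ω, g ω ∈ Set.Ico 0 (π / 2))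
    (hfi : Integrable (fun ω => Real.tan (f ω) ^ (m + 1)) μ)
    (hgi : Integrable (fun ω => Real.tan (g ω) ^ (m + 1)) μ)
    (hfg : (∫ ω, Real.tan (f ω) ^ (m + 1) ∂μ) * ∫ ω, Real.tan (g ω) ^ (m + 1) ∂μ ≤ 1)
    {α α₀ : ℝ} (h0 : 0 < α₀) (hα : α₀ ≤ α) (hα' : α < π / 2)
    (hfα : ∫ ω, Dfun (m + 1) (f ω) ∂μ = Dfun (m + 1) α) :
    ∫ ω, Dfun (m + 1) (g ω) ∂μ +
      2 * ((((m + 1 + 1).choose 2 : ℝ) * Real.sin α₀ ^ (m + 1 + 1) *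
        (Real.tan α ^ (2 * (m + 1)))⁻¹) / (((m + 1 : ℕ) : ℝ) + ((m + 1 : ℕ) : ℝ) *
          ((m + 1 + 1).choose 2 : ℝ) * (π / 2) ^ 2 * (Real.tan α ^ (m + 1))⁻¹)) *
      (∫ ω, (Dfun (m + 1) (f ω) - Dfun (m + 1) α) ^ 2 ∂μ) *
      (Dfun (m + 1) (π / 2) - Dfun (m + 1) (π / 2 - α)) ≤ Dfun (m + 1) (π / 2 - α) := by
  have hαp : 0 < α := h0.trans_le hα
  have hαI : α ∈ Set.Ico 0 (π / 2) := ⟨hαp.le, hα'⟩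
  obtain ⟨κ, hκ0, hκ, hκb⟩ := exists_tan_pow_ge hm hαI
  have hb0 : (0 : ℝ) < ((m + 1 + 1).choose 2 : ℝ) := by rw [choose_two_cast]; positivity
  set b : ℝ := ((m + 1 + 1).choose 2 : ℝ) with hb
  have hD1 := Dfun_pi_div_two_le_one hm
  have hDg0 : 0 ≤ Dfun (m + 1) (π / 2 - α) := Dfun_nonneg (by linarith) (by linarith)
  have hDh : Dfun (m + 1) (π / 2 - α) ≤ Dfun (m + 1) (π / 2) :=
    Dfun_mono (by linarith) (by linarith) (by linarith)
  set S := Dfun (m + 1) (π / 2) - Dfun (m + 1) (π / 2 - α) with hS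
  have hS0 : 0 ≤ S := by linarith
  have hS1 : S ≤ 1 := by linarith
  have hbound : ∀ x ∈ Set.Ico 0 (π / 2), Dfun (m + 1) x ∈ Set.Icc (0 : ℝ) 1 := fun x hx =>
    ⟨Dfun_nonneg hx.1 (by linarith [hx.2, pi_pos]),
      (Dfun_mono hx.1 hx.2.le (by linarith [pi_pos])).trans hD1⟩
  have hi1 := integrable_Dfun_comp (m := m) (μ := μ) hf hf' (Dfun (m + 1) α) 1
  have hi2 := integrable_Dfun_comp (m := m) (μ := μ) hf hf' (Dfun (m + 1) α) 2
  have hi0 : Integrable (fun ω => Dfun (m + 1) (f ω)) μ := by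
    simpa using integrable_Dfun_comp (m := m) (μ := μ) hf hf' 0 1
  have hig : Integrable (fun ω => Dfun (m + 1) (g ω)) μ := by
    simpa using integrable_Dfun_comp (m := m) (μ := μ) hg hg' 0 1
  simp only [pow_one] at hi1
  set V := ∫ ω, (Dfun (m + 1) (f ω) - Dfun (m + 1) α) ^ 2 ∂μ with hV
  have hV0 : 0 ≤ V := integral_nonneg fun ω => sq_nonneg _
  have hV1 : V ≤ 1 := by
    have : V ≤ ∫ _, (1 : ℝ) ∂μ := integral_mono hi2 (integrable_const _) fun ω => by
      have h1 := hbound _ (hf' ω)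
      have h2 := hbound _ hαI
      exact sq_le_one_iff_abs_le_one _ |>.2
        (abs_le.2 ⟨by linarith [h1.1, h2.2], by linarith [h1.2, h2.1]⟩)
    simpa using this
  set x := Real.tan α ^ (m + 1) with hx
  have hx0 : 0 < x := pow_pos (Real.tan_pos_of_pos_of_lt_pi_div_two hαp hα') _
  have hX : x + κ * V ≤ ∫ ω, Real.tan (f ω) ^ (m + 1) ∂μ := by
    have h1 := integral_mono (((integrable_const x).add
      (hi1.const_mul ((m + 1) / Real.cos α ^ (m + 2)))).add (hi2.const_mul κ)) hfi
      fun ω => hκ _ (hf' ω)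
    rw [integral_add' ((integrable_const x).add
      (hi1.const_mul ((m + 1) / Real.cos α ^ (m + 2)))) (hi2.const_mul κ),
      integral_add' (integrable_const x) (hi1.const_mul ((m + 1) / Real.cos α ^ (m + 2))),
      integral_const_mul, integral_const_mul, integral_sub hi0 (integrable_const _), hfα] at h1
    simpa using h1
  set Y := ∫ ω, Real.tan (g ω) ^ (m + 1) ∂μ with hY
  have hY0 : 0 ≤ Y := integral_nonneg fun ω =>
    pow_nonneg (Real.tan_nonneg_of_nonneg_of_le_pi_div_two (hg' ω).1 (hg' ω).2.le) _
  have hden : 0 < x + κ * V := by positivity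
  have hY1 : Y ≤ 1 / (x + κ * V) := by
    rw [le_div_iff₀ hden]
    nlinarith [mul_le_mul_of_nonneg_right hX hY0]
  have hγ : π / 2 - α ∈ Set.Ico 0 (π / 2) := ⟨by linarith, by linarith⟩
  have hs : 0 < Real.sin α := Real.sin_pos_of_pos_of_lt_pi hαp (by linarith [pi_pos])
  have hG : ∫ ω, Dfun (m + 1) (g ω) ∂μ - Dfun (m + 1) (π / 2 - α) ≤
      Real.sin α ^ (m + 2) / (m + 1) * (Y - 1 / x) := by
    have h1 := integral_mono (hig.sub (integrable_const (Dfun (m + 1) (π / 2 - α))))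
      ((hgi.sub (integrable_const (Real.tan (π / 2 - α) ^ (m + 1)))).const_mul
        (Real.cos (π / 2 - α) ^ (m + 2) / (m + 1))) fun ω => Dfun_sub_le_tan_pow hγ (hg' ω)
    simp only [Pi.sub_apply] at h1
    rw [integral_const_mul, integral_sub hig (integrable_const _),
      integral_sub hgi (integrable_const _), Real.cos_pi_div_two_sub, Real.tan_pi_div_two_sub,
      inv_pow, ← hx] at h1
    simpa using h1
  have hs0 : Real.sin α₀ ^ (m + 2) ≤ Real.sin α ^ (m + 2) :=
    pow_le_pow_left₀ (Real.sin_nonneg_of_nonneg_of_le_pi h0.le (by linarith [pi_pos]))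
      (Real.sin_le_sin_of_le_of_le_pi_div_two (by linarith) hα'.le hα) _
  set s := Real.sin α ^ (m + 2)
  set s₀ := Real.sin α₀ ^ (m + 2)
  have hsp : 0 < s := pow_pos hs _
  have hrw : b * Real.sin α₀ ^ (m + 1 + 1) * (Real.tan α ^ (2 * (m + 1)))⁻¹ /
      (((m + 1 : ℕ) : ℝ) + ((m + 1 : ℕ) : ℝ) * b * (π / 2) ^ 2 * x⁻¹) =
      b * s₀ / ((m + 1) * x * (x + b * (π / 2) ^ 2)) := by
    have : Real.tan α ^ (2 * (m + 1)) = x ^ 2 := by rw [hx, ← pow_mul, mul_comm]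
    rw [this]
    push_cast
    field_simp
    rfl
  rw [hrw]
  have hdev : 2 * (b * s₀ / ((m + 1) * x * (x + b * (π / 2) ^ 2))) * V * S ≤
      s / (m + 1) * (1 / x - 1 / (x + κ * V)) :=
    deviation_le hb0 hs0 hsp.le hx0 hκ0 hV0 hV1 hS0 hS1 (by positivity) hκb
  have hm1 : 0 ≤ s / (m + 1) := by positivity
  have hlast := mul_le_mul_of_nonneg_left hY1 hm1
  rw [mul_sub] at hG hdev
  linarith

end

theorem lintegral_Ioi_pow_mul_comp_mul {a : ℝ} (ha : 0 < a) (i : ℕ) {ψ : ℝ → ℝ≥0∞}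
    (hψ : Measurable ψ) :
    ∫⁻ r in Set.Ioi (0 : ℝ), ENNReal.ofReal (r ^ i) * ψ (r * a) =
      ENNReal.ofReal (a⁻¹ ^ (i + 1)) * ∫⁻ r in Set.Ioi (0 : ℝ), ENNReal.ofReal (r ^ i) * ψ r := by
  have hm : Measurable fun r : ℝ => ENNReal.ofReal (r ^ i) * ψ r := by fun_prop
  have h1 : ∫⁻ r in Set.Ioi (0 : ℝ), ENNReal.ofReal (r ^ i) * ψ r =
      ENNReal.ofReal a * ∫⁻ r in Set.Ioi (0 : ℝ), ENNReal.ofReal ((a * r) ^ i) * ψ (a * r) := by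
    rw [← lintegral_indicator measurableSet_Ioi]
    conv_lhs => rw [← Real.smul_map_volume_mul_left ha.ne']
    rw [lintegral_smul_measure, lintegral_map (hm.indicator measurableSet_Ioi) (by fun_prop),
      abs_of_pos ha, smul_eq_mul, ← lintegral_indicator measurableSet_Ioi]
    congr 1
    refine lintegral_congr fun r => ?_
    by_cases hr : 0 < r
    · rw [Set.indicator_of_mem (show a * r ∈ Set.Ioi 0 from mul_pos ha hr),
        Set.indicator_of_mem (show r ∈ Set.Ioi 0 from hr)]
    · rw [Set.indicator_of_notMem (show a * r ∉ Set.Ioi 0 by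
        simpa using mul_nonpos_of_nonneg_of_nonpos ha.le (not_lt.1 hr)),
        Set.indicator_of_notMem (show r ∉ Set.Ioi 0 from hr)]
  rw [h1, ← mul_assoc, ← ENNReal.ofReal_mul (by positivity),
    ← lintegral_const_mul _ (by fun_prop)]
  refine setLIntegral_congr_fun measurableSet_Ioi fun r hr => ?_
  have hr : 0 < r := hr
  rw [← mul_assoc, ← ENNReal.ofReal_mul (by positivity), mul_comm r a]
  congr 2
  rw [mul_pow, inv_pow]
  field_simp
  ring

/-- Polar coordinates for a function of a positively homogeneous gauge `p`, weighted by a positively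
homogeneous function of degree `j`. -/
theorem exists_lintegral_homogeneous (m : ℕ) : ∃ k : ℝ≥0∞, k ≠ 0 ∧ k ≠ ∞ ∧
    ∀ (p : EuclideanSpace ℝ (Fin (m + 1)) → ℝ) (j : ℕ)
      (g : EuclideanSpace ℝ (Fin (m + 1)) → ℝ≥0∞) (ψ : ℝ → ℝ≥0∞),
      Measurable p → (∀ r : ℝ, 0 < r → ∀ y, p (r • y) = r * p y) → (∀ y, y ≠ 0 → 0 < p y) →
      Measurable g → (∀ r : ℝ, 0 < r → ∀ y, g (r • y) = ENNReal.ofReal (r ^ j) * g y) →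
      Measurable ψ →
      ∫⁻ y, g y * ψ (p y) = k * (∫⁻ r in Set.Ioi (0 : ℝ), ENNReal.ofReal (r ^ (m + j)) * ψ r) *
        ∫⁻ u, g u * ENNReal.ofReal ((p u)⁻¹ ^ (m + j + 1)) ∂(sphereProb m) := by
  obtain ⟨k, hk0, hkt, hk⟩ := exists_lintegral_sphereProb m
  refine ⟨k, hk0, hkt, fun p j g ψ hp hps hp0 hg hgs hψ => ?_⟩
  rw [hk _ (by fun_prop), mul_assoc]
  congr 1
  rw [← lintegral_const_mul _ (by fun_prop)]
  refine lintegral_congr_ae ?_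
  filter_upwards [ae_sphereProb_norm_eq_one m] with u hu
  have hu0 : u ≠ 0 := by rintro rfl; simp at hu
  rw [mul_comm, mul_assoc, ← lintegral_Ioi_pow_mul_comp_mul (hp0 u hu0) _ hψ,
    ← lintegral_const_mul _ (by fun_prop)]
  refine setLIntegral_congr_fun measurableSet_Ioi fun r hr => ?_
  have hr : 0 < r := hr
  rw [hps r hr, hgs r hr, pow_add, ENNReal.ofReal_mul (by positivity)]
  ring

theorem lintegral_Ioi_pow_mul_exp_neg_sq_ne_top (i : ℕ) :
    ∫⁻ r in Set.Ioi (0 : ℝ), ENNReal.ofReal (r ^ i) * ENNReal.ofReal (rexp (-(r ^ 2 / 2))) ≠ ∞ := by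
  have h : IntegrableOn (fun r : ℝ => r ^ (i : ℝ) * rexp (-(1 / 2) * r ^ 2)) (Set.Ioi 0) :=
    integrableOn_rpow_mul_exp_neg_mul_sq (by norm_num) (by have := Nat.cast_nonneg (α := ℝ) i; linarith)
  have h' := h.lintegral_lt_top.ne
  convert h' using 1
  refine setLIntegral_congr_fun measurableSet_Ioi fun r hr => ?_
  have hr : 0 < r := hr
  rw [← ENNReal.ofReal_mul (by positivity), rpow_natCast]
  congr 3; ring

theorem lintegral_Ioi_pow_mul_exp_neg_mul_ne_top (i : ℕ) {l : ℝ} (hl : 0 < l) :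
    ∫⁻ r in Set.Ioi (0 : ℝ), ENNReal.ofReal (r ^ i) * ENNReal.ofReal (rexp (-(l * r))) ≠ ∞ := by
  have h : IntegrableOn (fun r : ℝ => r ^ (i : ℝ) * rexp (-l * r ^ (1 : ℝ))) (Set.Ioi 0) :=
    integrableOn_rpow_mul_exp_neg_mul_rpow (by have := Nat.cast_nonneg (α := ℝ) i; linarith)
      (by norm_num) hl
  have h' := h.lintegral_lt_top.ne
  convert h' using 1
  refine setLIntegral_congr_fun measurableSet_Ioi fun r hr => ?_
  have hr : 0 < r := hr
  rw [← ENNReal.ofReal_mul (by positivity), rpow_natCast, rpow_one, neg_mul]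

theorem lintegral_Ioi_pow_mul_ne_zero (i : ℕ) {ψ : ℝ → ℝ} (hψ : Measurable ψ) (hpos : ∀ r, 0 < ψ r) :
    ∫⁻ r in Set.Ioi (0 : ℝ), ENNReal.ofReal (r ^ i) * ENNReal.ofReal (ψ r) ≠ 0 := by
  rw [Ne, lintegral_eq_zero_iff (by fun_prop)]
  intro h
  rw [EventuallyEq, ae_restrict_iff' measurableSet_Ioi] at h
  have : ∀ᵐ r : ℝ, r ∉ Set.Ioi (0 : ℝ) := by
    filter_upwards [h] with r hr hr0
    have h1 := hr hr0
    have hr0 : 0 < r := hr0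
    have hp := hpos r
    rw [← ENNReal.ofReal_mul (by positivity)] at h1
    simp only [Pi.zero_apply, ENNReal.ofReal_eq_zero] at h1
    exact absurd h1 (not_le.2 (by positivity))
  have h2 := measure_mono_null (t := {r : ℝ | ¬ r ∉ Set.Ioi (0:ℝ)}) (s := Set.Ioi 0)
    (fun r hr => by simpa using hr) this
  simp at h2

/-- The constants in `exists_lintegral_homogeneous` for a Gaussian profile are normalized by the
Gaussian integral. -/
theorem lintegral_exp_neg_norm_sq (n : ℕ) :
    ∫⁻ x : EuclideanSpace ℝ (Fin n), ENNReal.ofReal (rexp (-(‖x‖ ^ 2 / 2))) =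
      ENNReal.ofReal (√(2 * π) ^ n) := by
  have h := GaussianFourier.integral_rexp_neg_mul_sq_norm (V := EuclideanSpace ℝ (Fin n))
    (b := 1 / 2) (by norm_num)
  have h2 : ∫ x : EuclideanSpace ℝ (Fin n), rexp (-(‖x‖ ^ 2 / 2)) = √(2 * π) ^ n := by
    have : ∀ x : EuclideanSpace ℝ (Fin n), rexp (-(‖x‖ ^ 2 / 2)) = rexp (-(1 / 2) * ‖x‖ ^ 2) := by
      intro x; congr 1; ring
    simp_rw [this]
    rw [h, Real.sqrt_eq_rpow, ← rpow_natCast, ← rpow_mul (by positivity)]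
    simp only [finrank_euclideanSpace, Fintype.card_fin]
    congr 1 <;> ring
  rw [← h2, ofReal_integral_eq_lintegral_ofReal]
  · by_contra hc
    rw [integral_undef hc] at h2
    have : 0 < √(2 * π) ^ n := by positivity
    linarith
  · exact Eventually.of_forall fun x => (exp_pos _).le

theorem integrable_and_integral_eq_zero_of_lintegral_eq {Ω : Type*} [MeasurableSpace Ω]
    {μ : Measure Ω} {X : Ω → ℝ} (hX : Measurable X)
    (h : ∫⁻ x, ENNReal.ofReal (X x) ∂μ = ∫⁻ x, ENNReal.ofReal (-X x) ∂μ)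
    (ht : ∫⁻ x, ENNReal.ofReal (X x) ∂μ ≠ ∞) : Integrable X μ ∧ ∫ x, X x ∂μ = 0 := by
  have hi : Integrable X μ := by
    refine ⟨hX.aestronglyMeasurable, ?_⟩
    rw [HasFiniteIntegral]
    have h1 : ∀ x, ‖X x‖ₑ = ENNReal.ofReal (X x) + ENNReal.ofReal (-X x) := by
      intro x
      rcases le_total 0 (X x) with h0 | h0
      · rw [ENNReal.ofReal_of_nonpos (p := -X x) (by linarith), add_zero,
          Real.enorm_eq_ofReal h0]
      · rw [ENNReal.ofReal_of_nonpos h0, zero_add, ← enorm_neg,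
          Real.enorm_eq_ofReal (by linarith)]
    simp_rw [h1]
    rw [lintegral_add_left (by fun_prop), ← h]
    exact (ENNReal.add_ne_top.2 ⟨ht, ht⟩).lt_top
  refine ⟨hi, ?_⟩
  rw [integral_eq_lintegral_pos_part_sub_lintegral_neg_part hi, h, sub_self]

namespace IsDualConePair

variable {m : ℕ} {e : Esp (m + 1)} {C C' : Set (Esp (m + 1))}
  {ι : EuclideanSpace ℝ (Fin (m + 1)) →ₗᵢ[ℝ] Esp (m + 1)}

theorem ae_inv_coneHeight_le (h : IsDualConePair e C C') (hι : IsOrthParam e ι) :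
    ∃ R, 0 ≤ R ∧ ∀ᵐ u ∂(sphereProb m), 0 ≤ (coneHeight e ι C u)⁻¹ ∧ (coneHeight e ι C u)⁻¹ ≤ R := by
  obtain ⟨δ, hδ, hle⟩ := h.exists_le_coneHeight hι
  refine ⟨δ⁻¹, by positivity, ?_⟩
  filter_upwards [ae_sphereProb_norm_eq_one m] with u hu
  have := hle u
  rw [hu, mul_one] at this
  exact ⟨inv_nonneg.2 (hδ.le.trans this), inv_anti₀ hδ this⟩

theorem integrable_inv_coneHeight_pow (h : IsDualConePair e C C') (hι : IsOrthParam e ι) (n : ℕ) :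
    Integrable (fun u => (coneHeight e ι C u)⁻¹ ^ n) (sphereProb m) := by
  obtain ⟨R, hR, hle⟩ := h.ae_inv_coneHeight_le hι
  refine Integrable.of_bound (C := R ^ n)
    ((h.measurable_coneHeight hι).inv.pow_const n).aestronglyMeasurable ?_
  filter_upwards [hle] with u hu
  rw [norm_pow, Real.norm_of_nonneg hu.1]
  exact pow_le_pow_left₀ hu.1 hu.2 n

theorem ofReal_integral_inv_coneHeight_pow (h : IsDualConePair e C C') (hι : IsOrthParam e ι)
    (n : ℕ) : ENNReal.ofReal (∫ u, (coneHeight e ι C u)⁻¹ ^ n ∂(sphereProb m)) =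
      ∫⁻ u, ENNReal.ofReal ((coneHeight e ι C u)⁻¹ ^ n) ∂(sphereProb m) :=
  ofReal_integral_eq_lintegral_ofReal (h.integrable_inv_coneHeight_pow hι n)
    (Eventually.of_forall fun u => pow_nonneg (inv_nonneg.2 (h.coneHeight_nonneg hι u)) n)

theorem lintegral_inner_mul_inv_coneHeight_ne_top (h : IsDualConePair e C C')
    (hι : IsOrthParam e ι) (w : EuclideanSpace ℝ (Fin (m + 1))) (n : ℕ) :
    ∫⁻ u, ENNReal.ofReal ⟪u, w⟫ * ENNReal.ofReal ((coneHeight e ι C u)⁻¹ ^ n) ∂(sphereProb m)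
      ≠ ∞ := by
  obtain ⟨R, hR, hle⟩ := h.ae_inv_coneHeight_le hι
  have : ∫⁻ u, ENNReal.ofReal ⟪u, w⟫ * ENNReal.ofReal ((coneHeight e ι C u)⁻¹ ^ n) ∂(sphereProb m)
      ≤ ∫⁻ _, ENNReal.ofReal ‖w‖ * ENNReal.ofReal (R ^ n) ∂(sphereProb m) := by
    refine lintegral_mono_ae ?_
    filter_upwards [hle, ae_sphereProb_norm_eq_one m] with u hu hu1
    refine mul_le_mul' (ENNReal.ofReal_le_ofReal ?_)
      (ENNReal.ofReal_le_ofReal (pow_le_pow_left₀ hu.1 hu.2 n))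
    simpa [hu1] using real_inner_le_norm u w
  refine ne_top_of_le_ne_top ?_ this
  rw [lintegral_const]
  exact ENNReal.mul_ne_top (ENNReal.mul_ne_top ENNReal.ofReal_ne_top ENNReal.ofReal_ne_top)
    (measure_ne_top _ _)

/-- A Blaschke–Santaló type inequality for the sections of a centered pair of dual cones. -/
theorem integral_mul_integral_le_one (h : IsDualConePair e C C') (hι : IsOrthParam e ι)
    (hB : ∀ w, ∫⁻ u, ENNReal.ofReal ⟪u, w⟫ *
        ENNReal.ofReal ((coneHeight e ι C u)⁻¹ ^ (m + 2)) ∂(sphereProb m) =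
      ∫⁻ u, ENNReal.ofReal ⟪u, -w⟫ *
        ENNReal.ofReal ((coneHeight e ι C u)⁻¹ ^ (m + 2)) ∂(sphereProb m)) :
    (∫ u, (coneHeight e ι C u)⁻¹ ^ (m + 1) ∂(sphereProb m)) *
      ∫ u, (coneHeight e ι C' u)⁻¹ ^ (m + 1) ∂(sphereProb m) ≤ 1 := by
  obtain ⟨k, hk0, hkt, hk⟩ := exists_lintegral_homogeneous m
  set ψ : ℝ → ℝ≥0∞ := fun r => ENNReal.ofReal (rexp (-(r ^ 2 / 2))) with hψ
  have hψm : Measurable ψ := by fun_prop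
  set p := coneHeight e ι C with hp
  set q := coneHeight e ι C' with hq
  have hpm : Measurable p := h.measurable_coneHeight hι
  have hqm : Measurable q := h.symm.measurable_coneHeight hι
  have hgauss : k * (∫⁻ r in Set.Ioi (0 : ℝ), ENNReal.ofReal (r ^ m) * ψ r) =
      ENNReal.ofReal (√(2 * π) ^ (m + 1)) := by
    have h1 := hk (fun x => ‖x‖) 0 (fun _ => 1) ψ (by fun_prop)
      (fun r hr y => by rw [norm_smul, Real.norm_of_nonneg hr.le]) (fun y hy => norm_pos_iff.2 hy)
      (by fun_prop) (fun r _ y => by simp) hψm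
    have h2 : ∫⁻ u, 1 * ENNReal.ofReal (‖u‖⁻¹ ^ (m + 0 + 1)) ∂(sphereProb m) = 1 := by
      have : ∫⁻ u, 1 * ENNReal.ofReal (‖u‖⁻¹ ^ (m + 0 + 1)) ∂(sphereProb m) =
          ∫⁻ _, 1 ∂(sphereProb m) := by
        refine lintegral_congr_ae ?_
        filter_upwards [ae_sphereProb_norm_eq_one m] with u hu
        simp [hu]
      rw [this]; simp
    rw [h2, mul_one] at h1
    simp only [one_mul, add_zero] at h1
    rw [← h1, hψ, lintegral_exp_neg_norm_sq]
  have hsec : ∀ D D' : Set (Esp (m + 1)), IsDualConePair e D D' →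
      ∫⁻ y, ψ (coneHeight e ι D y) = ENNReal.ofReal (√(2 * π) ^ (m + 1)) *
        ENNReal.ofReal (∫ u, (coneHeight e ι D u)⁻¹ ^ (m + 1) ∂(sphereProb m)) := by
    intro D D' hD
    have h1 := hk (coneHeight e ι D) 0 (fun _ => 1) ψ (hD.measurable_coneHeight hι)
      (fun r hr y => hD.coneHeight_smul hι hr y) (fun y hy => hD.coneHeight_pos hι hy)
      (by fun_prop) (fun r _ y => by simp) hψm
    simp only [one_mul, add_zero] at h1
    rw [h1, hgauss, hD.ofReal_integral_inv_coneHeight_pow hι]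
  have hmom : ∀ w, ∫⁻ y, ENNReal.ofReal ⟪y, w⟫ ∂(volume.withDensity fun y => ψ (p y)) =
      k * (∫⁻ r in Set.Ioi (0 : ℝ), ENNReal.ofReal (r ^ (m + 1)) * ψ r) *
        ∫⁻ u, ENNReal.ofReal ⟪u, w⟫ * ENNReal.ofReal ((p u)⁻¹ ^ (m + 2)) ∂(sphereProb m) := by
    intro w
    rw [lintegral_withDensity_eq_lintegral_mul _ (by fun_prop) (by fun_prop)]
    have h1 := hk p 1 (fun y => ENNReal.ofReal ⟪y, w⟫) ψ hpm
      (fun r hr y => h.coneHeight_smul hι hr y) (fun y hy => h.coneHeight_pos hι hy)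
      (by fun_prop) (fun r hr y => by
        rw [real_inner_smul_left, ENNReal.ofReal_mul hr.le, pow_one]) hψm
    rw [← h1]
    exact lintegral_congr fun y => by rw [Pi.mul_apply, mul_comm]
  have hcen : ∀ w, Integrable (fun y => ⟪y, w⟫) (volume.withDensity fun y => ψ (p y)) ∧
      ∫ y, ⟪y, w⟫ ∂(volume.withDensity fun y => ψ (p y)) = 0 := by
    intro w
    refine integrable_and_integral_eq_zero_of_lintegral_eq (by fun_prop) ?_ ?_
    · simp_rw [← inner_neg_right]
      rw [hmom, hmom, hB]
    · rw [hmom]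
      exact ENNReal.mul_ne_top
        (ENNReal.mul_ne_top hkt (lintegral_Ioi_pow_mul_exp_neg_sq_ne_top _))
        (h.lintegral_inner_mul_inv_coneHeight_ne_top hι w _)
  have hneg : ∫⁻ y, ψ (q (-y)) = ∫⁻ y, ψ (q y) := by
    have := (Measure.measurePreserving_neg (volume : Measure (EuclideanSpace ℝ (Fin (m + 1)))))
    exact this.lintegral_comp (f := fun y => ψ (q y)) (by fun_prop)
  have hS := lintegral_mul_lintegral_le_of_centered (f := fun y => ψ (p y))
    (g := fun y => ψ (q (-y))) (by fun_prop) (by fun_prop)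
    (by
      rw [hsec C C' h]
      exact ENNReal.mul_ne_top ENNReal.ofReal_ne_top ENNReal.ofReal_ne_top)
    (fun w => (hcen w).1) (fun w => (hcen w).2) (fun x y => by
      simp only [hψ]
      rw [← ENNReal.ofReal_mul (exp_pos _).le, ← Real.exp_add]
      refine ENNReal.ofReal_le_ofReal (Real.exp_le_exp.2 ?_)
      have h1 := h.neg_inner_le_coneHeight_mul hι x (-y)
      rw [inner_neg_right, neg_neg] at h1
      nlinarith [sq_nonneg (p x - q (-y))])
  rw [hneg, hsec C C' h, hsec C' C h.symm] at hS
  have hI : ∀ D D' : Set (Esp (m + 1)), IsDualConePair e D D' →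
      0 ≤ ∫ u, (coneHeight e ι D u)⁻¹ ^ (m + 1) ∂(sphereProb m) := fun D D' hD =>
    integral_nonneg fun u => pow_nonneg (inv_nonneg.2 (hD.coneHeight_nonneg hι u)) _
  have hI1 := hI C C' h
  have hI2 := hI C' C h.symm
  rw [← ENNReal.ofReal_mul (by positivity), ← ENNReal.ofReal_mul (by positivity),
    ← ENNReal.ofReal_mul (by positivity), ENNReal.ofReal_le_ofReal_iff (by positivity)] at hS
  have hsq : √(2 * π) ^ (m + 1) * √(2 * π) ^ (m + 1) = (2 * π) ^ (m + 1) := by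
    rw [← mul_pow, Real.mul_self_sqrt (by positivity)]
  have hpos : 0 < (2 * π) ^ (m + 1) := by positivity
  refine le_of_mul_le_mul_left ?_ hpos
  rw [mul_one]
  refine le_trans (le_of_eq ?_) hS
  rw [← hsq]; ring

end IsDualConePair

/-- A nonempty closed convex cone. -/
structure IsClosedConvexCone {d : ℕ} (C : Set (Esp d)) : Prop where
  isClosed : IsClosed C
  convex : Convex ℝ C
  smul_mem : ∀ x ∈ C, ∀ t : ℝ, 0 ≤ t → t • x ∈ C
  nonempty : C.Nonempty

namespace IsClosedConvexCone

variable {d : ℕ} {C : Set (Esp d)}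

theorem zero_mem (h : IsClosedConvexCone C) : (0 : Esp d) ∈ C := by
  obtain ⟨x, hx⟩ := h.nonempty
  simpa using h.smul_mem x hx 0 le_rfl

theorem add_mem (h : IsClosedConvexCone C) {x y : Esp d} (hx : x ∈ C) (hy : y ∈ C) : x + y ∈ C := by
  have h1 := h.smul_mem _ (h.convex hx hy (a := 1 / 2) (b := 1 / 2) (by norm_num) (by norm_num)
    (by norm_num)) 2 (by norm_num)
  rwa [smul_add, smul_smul, smul_smul, mul_one_div_cancel two_ne_zero, one_smul, one_smul] at h1

theorem exists_separating (h : IsClosedConvexCone C) {z : Esp d} (hz : z ∉ C) :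
    ∃ y, (∀ x ∈ C, 0 ≤ ⟪x, y⟫) ∧ ⟪z, y⟫ < 0 := by
  let P : ProperCone ℝ (Esp d) :=
    { carrier := C
      add_mem' := fun hx hy => h.add_mem hx hy
      zero_mem' := h.zero_mem
      smul_mem' := fun c x hx => h.smul_mem x hx c c.2
      isClosed' := h.isClosed }
  exact ProperCone.hyperplane_separation' P (x₀ := z) hz

theorem exists_mul_norm_le_inner (h : IsClosed C) (hs : ∀ x ∈ C, ∀ t : ℝ, 0 ≤ t → t • x ∈ C)
    {v : Esp d} (hv : ∀ x ∈ C, x ≠ 0 → 0 < ⟪x, v⟫) : ∃ δ > 0, ∀ x ∈ C, δ * ‖x‖ ≤ ⟪x, v⟫ := by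
  have hK : IsCompact (C ∩ Metric.sphere (0 : Esp d) 1) := (isCompact_sphere 0 1).inter_left h
  rcases (C ∩ Metric.sphere (0 : Esp d) 1).eq_empty_or_nonempty with he | hne
  · refine ⟨1, one_pos, fun x hx => ?_⟩
    by_cases hx0 : x = 0
    · simp [hx0]
    · have : ‖x‖⁻¹ • x ∈ C ∩ Metric.sphere (0 : Esp d) 1 :=
        ⟨hs x hx _ (by positivity), by simp [norm_smul, hx0]⟩
      rw [he] at this
      exact absurd this (Set.notMem_empty _)
  · obtain ⟨z, hz, hmin⟩ := hK.exists_isMinOn hne (f := fun x => ⟪x, v⟫) (by fun_prop)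
    have hz0 : z ≠ 0 := by
      rintro rfl
      simpa using hz.2
    refine ⟨⟪z, v⟫, hv z hz.1 hz0, fun x hx => ?_⟩
    by_cases hx0 : x = 0
    · simp [hx0]
    · have hn : 0 < ‖x‖ := norm_pos_iff.2 hx0
      have h1 : ⟪z, v⟫ ≤ ⟪‖x‖⁻¹ • x, v⟫ := hmin (a := ‖x‖⁻¹ • x)
        ⟨hs x hx _ (by positivity), by simp [norm_smul, hx0]⟩
      rw [real_inner_smul_left] at h1
      calc ⟪z, v⟫ * ‖x‖ ≤ ‖x‖⁻¹ * ⟪x, v⟫ * ‖x‖ := by gcongr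
        _ = ⟪x, v⟫ := by field_simp

theorem exists_inner_pos (h : IsClosedConvexCone C) (hl : ∀ x ∈ C, x ≠ 0 → -x ∉ C) :
    ∃ v : Esp d, ∀ x ∈ C, x ≠ 0 → 0 < ⟪x, v⟫ := by
  have hK : IsCompact (C ∩ Metric.sphere (0 : Esp d) 1) :=
    (isCompact_sphere 0 1).inter_left h.isClosed
  obtain ⟨v, -, hv⟩ : ∃ v : Esp d, (∀ x ∈ C, 0 ≤ ⟪x, v⟫) ∧
      ∀ x ∈ C ∩ Metric.sphere (0 : Esp d) 1, x ∈ C → 0 < ⟪x, v⟫ := by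
    refine hK.induction_on (p := fun S => ∃ v : Esp d, (∀ x ∈ C, 0 ≤ ⟪x, v⟫) ∧
      ∀ x ∈ S, x ∈ C → 0 < ⟪x, v⟫) ⟨0, by simp⟩ ?_ ?_ ?_
    · rintro S T hST ⟨v, h1, h2⟩
      exact ⟨v, h1, fun x hx => h2 x (hST hx)⟩
    · rintro S T ⟨v, h1, h2⟩ ⟨w, h3, h4⟩
      refine ⟨v + w, fun x hx => ?_, fun x hx hxC => ?_⟩
      · rw [inner_add_right]
        exact add_nonneg (h1 x hx) (h3 x hx)
      · rw [inner_add_right]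
        rcases hx with hx | hx
        · exact add_pos_of_pos_of_nonneg (h2 x hx hxC) (h3 x hxC)
        · exact add_pos_of_nonneg_of_pos (h1 x hxC) (h4 x hx hxC)
    · intro x hx
      have hx0 : x ≠ 0 := by
        rintro rfl
        simpa using hx.2
      obtain ⟨y, hy, hyx⟩ := h.exists_separating (hl x hx.1 hx0)
      rw [inner_neg_left, neg_lt_zero] at hyx
      refine ⟨{z | 0 < ⟪z, y⟫}, mem_nhdsWithin_of_mem_nhds
        ((isOpen_lt continuous_const (by fun_prop)).mem_nhds hyx), y, hy, fun z hz _ => hz⟩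
  refine ⟨v, fun x hx hx0 => ?_⟩
  have hn : 0 < ‖x‖ := norm_pos_iff.2 hx0
  have hmem : ‖x‖⁻¹ • x ∈ C := h.smul_mem x hx _ (by positivity)
  have h1 := hv (‖x‖⁻¹ • x) ⟨hmem, by simp [norm_smul, hx0]⟩ hmem
  rw [real_inner_smul_left] at h1
  exact (mul_pos_iff_of_pos_left (inv_pos.2 hn)).1 h1

end IsClosedConvexCone

/-- The exponential integral `∫_C exp(-⟨x,v⟩) dx` of a set. -/
def laplaceInt {d : ℕ} (C : Set (Esp d)) (v : Esp d) : ℝ≥0∞ :=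
  ∫⁻ x in C, ENNReal.ofReal (rexp (-⟪x, v⟫))

theorem lintegral_exp_neg_mul_norm_ne_top (d : ℕ) {δ : ℝ} (hδ : 0 < δ) :
    ∫⁻ x : Esp d, ENNReal.ofReal (rexp (-(δ * ‖x‖))) ≠ ∞ := by
  obtain ⟨k, hk0, hkt, hk⟩ := exists_lintegral_homogeneous d
  have h1 := hk (fun x => ‖x‖) 0 (fun _ => 1) (fun r => ENNReal.ofReal (rexp (-(δ * r))))
    (by fun_prop) (fun r hr y => by rw [norm_smul, Real.norm_of_nonneg hr.le])
    (fun y hy => norm_pos_iff.2 hy) (by fun_prop) (fun r _ y => by simp) (by fun_prop)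
  simp only [one_mul, add_zero] at h1
  rw [h1]
  refine ENNReal.mul_ne_top
    (ENNReal.mul_ne_top hkt (lintegral_Ioi_pow_mul_exp_neg_mul_ne_top _ hδ)) ?_
  have : ∫⁻ u, ENNReal.ofReal (‖u‖⁻¹ ^ (d + 1)) ∂(sphereProb d) = ∫⁻ _, 1 ∂(sphereProb d) := by
    refine lintegral_congr_ae ?_
    filter_upwards [ae_sphereProb_norm_eq_one d] with u hu
    simp [hu]
  rw [this]; simp

theorem laplaceInt_ne_top {d : ℕ} {C : Set (Esp d)} (hC : MeasurableSet C) {v : Esp d} {δ : ℝ}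
    (hδ : 0 < δ) (h : ∀ x ∈ C, δ * ‖x‖ ≤ ⟪x, v⟫) : laplaceInt C v ≠ ∞ := by
  refine ne_top_of_le_ne_top (lintegral_exp_neg_mul_norm_ne_top d hδ) ?_
  refine le_trans (setLIntegral_mono' hC fun x hx => ?_) (setLIntegral_le_lintegral C _)
  exact ENNReal.ofReal_le_ofReal (exp_le_exp.2 (neg_le_neg (h x hx)))

theorem lowerSemicontinuous_laplaceInt {d : ℕ} (C : Set (Esp d)) :
    LowerSemicontinuous (laplaceInt C) := by
  rw [lowerSemicontinuous_iff_isClosed_preimage]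
  refine fun a => IsSeqClosed.isClosed fun v w hv hw => ?_
  have hlim : ∀ x : Esp d, liminf (fun n => ENNReal.ofReal (rexp (-⟪x, v n⟫))) atTop =
      ENNReal.ofReal (rexp (-⟪x, w⟫)) := fun x => by
    refine Tendsto.liminf_eq ?_
    have : Continuous fun z : Esp d => ENNReal.ofReal (rexp (-⟪x, z⟫)) :=
      ENNReal.continuous_ofReal.comp (by fun_prop)
    exact (this.tendsto w).comp hw
  show laplaceInt C w ≤ a
  calc laplaceInt C w = ∫⁻ x in C, liminf (fun n => ENNReal.ofReal (rexp (-⟪x, v n⟫))) atTop := by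
        simp_rw [hlim]; rfl
    _ ≤ liminf (fun n => laplaceInt C (v n)) atTop := lintegral_liminf_le fun n => by fun_prop
    _ ≤ a := liminf_le_of_le (by isBoundedDefault) fun b hb => by
        obtain ⟨n, hn⟩ := hb.exists
        exact hn.trans (hv n)

theorem IsClosedConvexCone.inner_pos_of_laplaceInt_ne_top {d : ℕ} {C : Set (Esp d)}
    (h : IsClosedConvexCone C) (hl : ∀ x ∈ C, x ≠ 0 → -x ∉ C) (hvol : volume C ≠ 0) {v : Esp d}
    (hv : laplaceInt C v ≠ ∞) : ∀ x ∈ C, x ≠ 0 → 0 < ⟪x, v⟫ := by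
  intro z hz hz0
  by_contra! hneg
  have hCm := h.isClosed.measurableSet
  have hgm : Measurable fun x : Esp d => ENNReal.ofReal (rexp (-⟪x, v⟫)) := by fun_prop
  have hnull : ∀ n : ℕ, volume (C ∩ {x | x - (n : ℝ) • z ∉ C}) = 0 := by
    intro n
    set T : Set (Esp d) := {x | x - (n : ℝ) • z ∈ C} with hT
    have hTm : MeasurableSet T := (by fun_prop : Measurable fun x : Esp d => x - (n : ℝ) • z) hCm
    have hTC : T ⊆ C := fun x hx => by
      have := h.add_mem hx (h.smul_mem z hz n n.cast_nonneg)
      simpa using this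
    have h1 : laplaceInt C v ≤ ∫⁻ x in T, ENNReal.ofReal (rexp (-⟪x, v⟫)) := by
      rw [← lintegral_indicator hTm, ← lintegral_add_right_eq_self _ ((n : ℝ) • z), laplaceInt,
        ← lintegral_indicator hCm]
      refine lintegral_mono fun x => ?_
      by_cases hx : x ∈ C
      · rw [Set.indicator_of_mem hx, Set.indicator_of_mem (by simpa [hT] using hx)]
        refine ENNReal.ofReal_le_ofReal (exp_le_exp.2 ?_)
        rw [inner_add_left, real_inner_smul_left]
        nlinarith [mul_nonneg (n.cast_nonneg (α := ℝ)) (neg_nonneg.2 hneg)]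
      · simp [Set.indicator_of_notMem hx]
    have h2 := lintegral_inter_add_sdiff (μ := volume) 
      (fun x : Esp d => ENNReal.ofReal (rexp (-⟪x, v⟫))) C hTm
    rw [Set.inter_eq_self_of_subset_right hTC] at h2
    have h3 : ∫⁻ x in C \ T, ENNReal.ofReal (rexp (-⟪x, v⟫)) = 0 := by
      have h4 : ∫⁻ x in T, ENNReal.ofReal (rexp (-⟪x, v⟫)) ≠ ∞ :=
        ne_top_of_le_ne_top hv (lintegral_mono_set hTC)
      have h5 : (∫⁻ x in T, ENNReal.ofReal (rexp (-⟪x, v⟫))) +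
          ∫⁻ x in C \ T, ENNReal.ofReal (rexp (-⟪x, v⟫)) ≤
          (∫⁻ x in T, ENNReal.ofReal (rexp (-⟪x, v⟫))) + 0 := by
        rw [h2, add_zero]; exact h1
      exact le_antisymm ((ENNReal.add_le_add_iff_left h4).1 h5) zero_le
    rw [lintegral_eq_zero_iff hgm] at h3
    have h6 : (volume.restrict (C \ T)) Set.univ = 0 := by
      refine measure_mono_null (fun x _ => ?_) h3
      simp [exp_pos]
    rw [Measure.restrict_apply_univ] at h6
    exact h6
  refine hvol (measure_mono_null (fun x hx => ?_) (measure_iUnion_null hnull))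
  simp only [Set.mem_iUnion]
  by_contra! hc
  have hc : ∀ n : ℕ, x - (n : ℝ) • z ∈ C := fun n => by
    by_contra hn
    exact hc n ⟨hx, hn⟩
  refine hl z hz hz0 ?_
  have hlim : Tendsto (fun n : ℕ => (n : ℝ)⁻¹ • (x - (n : ℝ) • z)) atTop (𝓝 (-z)) := by
    have h1 : Tendsto (fun n : ℕ => (n : ℝ)⁻¹ • x - z) atTop (𝓝 ((0 : ℝ) • x - z)) :=
      (tendsto_inv_atTop_nhds_zero_nat.smul_const x).sub_const z
    rw [zero_smul, zero_sub] at h1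
    refine h1.congr' ?_
    filter_upwards [eventually_gt_atTop 0] with n hn
    rw [smul_sub, smul_smul, inv_mul_cancel₀ (by positivity), one_smul]
  exact h.isClosed.mem_of_tendsto hlim
    (Eventually.of_forall fun n => h.smul_mem _ (hc n) _ (by positivity))

namespace IsClosedConvexCone

variable {d : ℕ} {C : Set (Esp d)}

theorem exists_isMin_laplaceInt (h : IsClosedConvexCone C) (hl : ∀ x ∈ C, x ≠ 0 → -x ∉ C) :
    ∃ v : Esp d, laplaceInt C v ≠ ∞ ∧ ∀ w, laplaceInt C v + ENNReal.ofReal (‖v‖ ^ 2 / 2) ≤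
      laplaceInt C w + ENNReal.ofReal (‖w‖ ^ 2 / 2) := by
  obtain ⟨v₀, hv₀⟩ := h.exists_inner_pos hl
  obtain ⟨δ, hδ, hδ'⟩ := exists_mul_norm_le_inner h.isClosed h.smul_mem hv₀
  have hfin := laplaceInt_ne_top h.isClosed.measurableSet hδ hδ'
  set Φ : Esp d → ℝ≥0∞ := fun w => laplaceInt C w + ENNReal.ofReal (‖w‖ ^ 2 / 2) with hΦ
  have hΦfin : Φ v₀ ≠ ∞ := ENNReal.add_ne_top.2 ⟨hfin, ENNReal.ofReal_ne_top⟩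
  have hlsc : LowerSemicontinuous Φ :=
    (lowerSemicontinuous_laplaceInt C).add
      (ENNReal.continuous_ofReal.comp (by fun_prop)).lowerSemicontinuous
  set R : ℝ := max ‖v₀‖ (√(2 * (Φ v₀).toReal))
  obtain ⟨v, -, hv⟩ := (hlsc.lowerSemicontinuousOn (Metric.closedBall 0 R)).exists_isMinOn
    ⟨v₀, by simp [R]⟩ (isCompact_closedBall 0 R)
  have hvv₀ : Φ v ≤ Φ v₀ := hv (a := v₀) (by simp [R])
  refine ⟨v, fun htop => ?_, fun w => ?_⟩
  · refine ne_top_of_le_ne_top hΦfin hvv₀ ?_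
    simp [hΦ, htop]
  · by_cases hw : w ∈ Metric.closedBall 0 R
    · exact hv hw
    · refine hvv₀.trans (le_trans ?_ (le_add_left le_rfl : _ ≤ Φ w))
      have hw : R < ‖w‖ := by simpa using hw
      have h1 : √(2 * (Φ v₀).toReal) ≤ ‖w‖ := (le_max_right _ _).trans hw.le
      rw [Real.sqrt_le_left (norm_nonneg w)] at h1
      exact ENNReal.le_ofReal_iff_toReal_le hΦfin (by positivity) |>.2 (by linarith)

/-- The Euler–Lagrange equation for a minimizer of `laplaceInt C v + ‖v‖² / 2`. -/
theorem inner_eq_integral_of_isMin (h : IsClosedConvexCone C) {v : Esp d} {δ : ℝ} (hδ : 0 < δ)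
    (hv : ∀ x ∈ C, δ * ‖x‖ ≤ ⟪x, v⟫)
    (hmin : ∀ w, laplaceInt C v + ENNReal.ofReal (‖v‖ ^ 2 / 2) ≤
      laplaceInt C w + ENNReal.ofReal (‖w‖ ^ 2 / 2)) (z : Esp d) :
    Integrable (fun x => ⟪x, z⟫) ((volume.restrict C).withDensity
      fun x => ENNReal.ofReal (rexp (-⟪x, v⟫))) ∧
    ∫ x, ⟪x, z⟫ ∂((volume.restrict C).withDensity fun x => ENNReal.ofReal (rexp (-⟪x, v⟫))) =
      ⟪v, z⟫ := by
  set μ := (volume.restrict C).withDensity fun x => ENNReal.ofReal (rexp (-⟪x, v⟫)) with hμ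
  set X : Esp d → ℝ := fun x => -⟪x, z⟫ with hX
  have hlap : ∀ t : ℝ, ∫⁻ x, ENNReal.ofReal (rexp (t * X x)) ∂μ = laplaceInt C (v + t • z) := by
    intro t
    rw [hμ, lintegral_withDensity_eq_lintegral_mul _ (by fun_prop) (by fun_prop), laplaceInt]
    refine lintegral_congr fun x => ?_
    rw [Pi.mul_apply, ← ENNReal.ofReal_mul (exp_pos _).le, ← Real.exp_add, hX, inner_add_right,
      real_inner_smul_right]
    congr 2; ring
  obtain ⟨ε, hε, hfin⟩ : ∃ ε > 0, ∀ t : ℝ, |t| < ε → laplaceInt C (v + t • z) ≠ ∞ := by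
    refine ⟨δ / 2 / (‖z‖ + 1), by positivity, fun t ht => ?_⟩
    refine laplaceInt_ne_top h.isClosed.measurableSet (half_pos hδ) fun x hx => ?_
    rw [lt_div_iff₀ (by positivity)] at ht
    have h1 : |t * ⟪x, z⟫| ≤ δ / 2 * ‖x‖ := by
      rw [abs_mul]
      calc |t| * |⟪x, z⟫| ≤ |t| * (‖x‖ * ‖z‖) := by gcongr; exact abs_real_inner_le_norm x z
        _ = |t| * ‖z‖ * ‖x‖ := by ring
        _ ≤ δ / 2 * ‖x‖ := by gcongr; nlinarith [abs_nonneg t]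
    rw [inner_add_right, real_inner_smul_right]
    linarith [hv x hx, (abs_le.1 h1).1]
  have hintg : ∀ t : ℝ, |t| < ε → Integrable (fun x => rexp (t * X x)) μ := by
    intro t ht
    refine ⟨(by fun_prop : Measurable fun x => rexp (t * X x)).aestronglyMeasurable, ?_⟩
    rw [hasFiniteIntegral_iff_ofReal (Eventually.of_forall fun x => (exp_pos _).le), hlap]
    exact (hfin t ht).lt_top
  have hmgf : ∀ t : ℝ, ProbabilityTheory.mgf X μ t = (laplaceInt C (v + t • z)).toReal := by
    intro t
    rw [ProbabilityTheory.mgf, integral_eq_lintegral_of_nonneg_ae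
      (Eventually.of_forall fun x => (exp_pos _).le)
      (by fun_prop : Measurable fun x => rexp (t * X x)).aestronglyMeasurable, hlap]
  have hmem : 0 ∈ interior (ProbabilityTheory.integrableExpSet X μ) := by
    rw [mem_interior]
    refine ⟨Metric.ball 0 ε, fun t ht => hintg t (by simpa using ht), Metric.isOpen_ball,
      by simpa using hε⟩
  have hXint := ProbabilityTheory.integrable_of_mem_interior_integrableExpSet hmem
  have hder := ProbabilityTheory.hasDerivAt_mgf hmem
  simp only [zero_mul, Real.exp_zero, mul_one] at hder
  have hder2 : HasDerivAt (fun t : ℝ => ‖v + t • z‖ ^ 2 / 2) ⟪v, z⟫ 0 := by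
    have h1 : HasDerivAt (fun t : ℝ => v + t • z) z 0 := by
      simpa using ((hasDerivAt_id (0 : ℝ)).smul_const z).const_add v
    have h2 := h1.norm_sq.div_const 2
    simpa using h2
  have hmin0 : IsLocalMin (fun t => ProbabilityTheory.mgf X μ t + ‖v + t • z‖ ^ 2 / 2) 0 := by
    filter_upwards [Metric.ball_mem_nhds (0 : ℝ) hε] with t ht
    have ht : |t| < ε := by simpa using ht
    have h0 := hfin 0 (by simpa using hε)
    rw [zero_smul, add_zero] at h0
    have h1 := ENNReal.toReal_mono
      (ENNReal.add_ne_top.2 ⟨hfin t ht, ENNReal.ofReal_ne_top⟩) (hmin (v + t • z))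
    rw [ENNReal.toReal_add h0 ENNReal.ofReal_ne_top,
      ENNReal.toReal_add (hfin t ht) ENNReal.ofReal_ne_top,
      ENNReal.toReal_ofReal (by positivity), ENNReal.toReal_ofReal (by positivity)] at h1
    simpa [hmgf] using h1
  have hzero := hmin0.hasDerivAt_eq_zero (hder.add hder2)
  rw [hX, integral_neg] at hzero
  refine ⟨by simpa [hX] using hXint.neg, by linarith⟩

/-- Every line-free closed convex cone with nonempty interior can be centered: there is a unit
vector `e` such that the exponentially weighted centroid of the cone lies on the axis `e`. -/
theorem exists_isDualConePair_centered (h : IsClosedConvexCone C)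
    (hl : ∀ x ∈ C, x ≠ 0 → -x ∉ C) (hvol : volume C ≠ 0) :
    ∃ e ∈ uSphere d, ∃ C', IsDualConePair e C C' ∧ ∃ l > 0, ∀ z, ⟪e, z⟫ = 0 →
      ∫⁻ x in C, ENNReal.ofReal ⟪x, z⟫ * ENNReal.ofReal (rexp (-(l * ⟪x, e⟫))) =
      ∫⁻ x in C, ENNReal.ofReal ⟪x, -z⟫ * ENNReal.ofReal (rexp (-(l * ⟪x, e⟫))) := by
  obtain ⟨v, hfin, hmin⟩ := h.exists_isMin_laplaceInt hl
  have hpos := h.inner_pos_of_laplaceInt_ne_top hl hvol hfin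
  obtain ⟨δ, hδ, hδ'⟩ := exists_mul_norm_le_inner h.isClosed h.smul_mem hpos
  have hEL := h.inner_eq_integral_of_isMin hδ hδ' hmin
  have hCm := h.isClosed.measurableSet
  set μ := (volume.restrict C).withDensity fun x => ENNReal.ofReal (rexp (-⟪x, v⟫)) with hμ
  have hμC : ∀ᵐ x ∂μ, x ∈ C :=
    (withDensity_absolutelyContinuous _ _).ae_le (ae_restrict_mem hCm)
  have hv0 : v ≠ 0 := by
    rintro rfl
    refine hvol (measure_mono_null (t := {0}) (fun x hx => ?_) (by simp))
    by_contra hx0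
    simpa using hpos x hx hx0
  have hvn : 0 < ‖v‖ := norm_pos_iff.2 hv0
  set C' : Set (Esp d) := {y | ∀ x ∈ C, 0 ≤ ⟪x, y⟫} with hC'
  have hpos' : ∀ y ∈ C', y ≠ 0 → 0 < ⟪y, v⟫ := by
    intro y hy hy0
    rw [real_inner_comm, ← (hEL y).2]
    have hnn : 0 ≤ᵐ[μ] fun x => ⟪x, y⟫ := by
      filter_upwards [hμC] with x hx using hy x hx
    refine lt_of_le_of_ne (integral_nonneg_of_ae hnn) fun h0 => ?_
    rw [eq_comm, integral_eq_zero_iff_of_nonneg_ae hnn (hEL y).1, hμ, EventuallyEq,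
      ae_withDensity_iff (by fun_prop)] at h0
    have h1 : ∀ᵐ x ∂(volume.restrict C), ⟪x, y⟫ = 0 := by
      filter_upwards [h0] with x hx using hx (by simp [exp_pos])
    rw [ae_restrict_iff' hCm] at h1
    have h2 : volume {x : Esp d | ⟪x, y⟫ = 0} = 0 := by
      have : {x : Esp d | ⟪x, y⟫ = 0} = ((ℝ ∙ y)ᗮ : Submodule ℝ (Esp d)) := by
        ext x
        simp [Submodule.mem_orthogonal_singleton_iff_inner_left]
      rw [this]
      refine Measure.addHaar_submodule _ _ fun htop => hy0 ?_
      have : y ∈ (ℝ ∙ y)ᗮ := htop ▸ Submodule.mem_top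
      rw [Submodule.mem_orthogonal_singleton_iff_inner_left] at this
      exact inner_self_eq_zero.1 this
    refine hvol (measure_mono_null (fun x hx => ?_) (measure_union_null h1 h2))
    by_cases hxy : ⟪x, y⟫ = 0
    · exact Or.inr hxy
    · exact Or.inl fun hc => hxy (hc hx)
  have hC'cl : IsClosed C' := by
    have : C' = ⋂ x ∈ C, {y : Esp d | 0 ≤ ⟪x, y⟫} := by
      ext x; simp [hC']
    rw [this]
    exact isClosed_biInter fun y _ => isClosed_le continuous_const (by fun_prop)
  have hC's : ∀ y ∈ C', ∀ t : ℝ, 0 ≤ t → t • y ∈ C' := fun y hy t ht x hx => by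
    rw [real_inner_smul_right]
    exact mul_nonneg ht (hy x hx)
  have hscale : ∀ D : Set (Esp d), (∀ y ∈ D, y ≠ 0 → 0 < ⟪y, v⟫) →
      ∀ y ∈ D, y ≠ 0 → 0 < ⟪y, ‖v‖⁻¹ • v⟫ := fun D hD y hy hy0 => by
    rw [real_inner_smul_right]
    exact mul_pos (inv_pos.2 hvn) (hD y hy hy0)
  have hve : v = ‖v‖ • ‖v‖⁻¹ • v := by rw [smul_smul, mul_inv_cancel₀ hvn.ne', one_smul]
  refine ⟨‖v‖⁻¹ • v, by simp [uSphere, norm_smul, hvn.ne'], C', ⟨fun x => ⟨fun hx y hy => hy x hx,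
    fun hx => ?_⟩, fun y => Iff.rfl, exists_mul_norm_le_inner h.isClosed h.smul_mem (hscale _ hpos),
    exists_mul_norm_le_inner hC'cl hC's (hscale _ hpos')⟩, ‖v‖, hvn, fun z hz => ?_⟩
  · by_contra hxC
    obtain ⟨y, hy, hxy⟩ := h.exists_separating hxC
    exact absurd (hx y hy) (not_le.2 hxy)
  · have hvz : ⟪v, z⟫ = 0 := by rw [hve, real_inner_smul_left, hz, mul_zero]
    obtain ⟨hi, hintg⟩ := hEL z
    rw [hvz, integral_eq_lintegral_pos_part_sub_lintegral_neg_part hi, sub_eq_zero] at hintg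
    have hlt : ∀ w : Esp d, Integrable (fun x => ⟪x, w⟫) μ →
        ∫⁻ x, ENNReal.ofReal ⟪x, w⟫ ∂μ ≠ ∞ := fun w hw => hw.lintegral_lt_top.ne
    simp_rw [← inner_neg_right] at hintg
    rw [ENNReal.toReal_eq_toReal_iff' (hlt z hi) (hlt (-z) (hEL (-z)).1)] at hintg
    have hconv : ∀ w : Esp d, ∫⁻ x, ENNReal.ofReal ⟪x, w⟫ ∂μ =
        ∫⁻ x in C, ENNReal.ofReal ⟪x, w⟫ *
          ENNReal.ofReal (rexp (-(‖v‖ * ⟪x, ‖v‖⁻¹ • v⟫))) := by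
      intro w
      rw [hμ, lintegral_withDensity_eq_lintegral_mul _ (by fun_prop) (by fun_prop)]
      refine lintegral_congr fun x => ?_
      rw [Pi.mul_apply, mul_comm, ← real_inner_smul_right, ← hve]
    rw [← hconv, ← hconv, hintg]

end IsClosedConvexCone

theorem lintegral_Ici_exp_neg_mul {l : ℝ} (hl : 0 < l) (a : ℝ) :
    ∫⁻ t in Set.Ici a, ENNReal.ofReal (rexp (-(l * t))) = ENNReal.ofReal (rexp (-(l * a)) / l) := by
  have h1 := integral_exp_mul_Ioi (a := -l) (by linarith) a
  have h2 := integrableOn_exp_mul_Ioi (a := -l) (by linarith) a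
  rw [← setLIntegral_congr Ioi_ae_eq_Ici, ← ofReal_integral_eq_lintegral_ofReal
    (by simpa [IntegrableOn, neg_mul] using h2) (Eventually.of_forall fun x => (exp_pos _).le)]
  simp only [neg_mul] at h1
  rw [h1, neg_div_neg_eq]

/-- The exponentially weighted centering condition, expressed on the section of the cone. -/
theorem IsDualConePair.lintegral_inner_mul_inv_coneHeight_eq {m : ℕ} {e : Esp (m + 1)}
    {C C' : Set (Esp (m + 1))} {ι : EuclideanSpace ℝ (Fin (m + 1)) →ₗᵢ[ℝ] Esp (m + 1)}
    (h : IsDualConePair e C C') (hι : IsOrthParam e ι) {l : ℝ} (hl : 0 < l)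
    (hcen : ∀ z, ⟪e, z⟫ = 0 →
      ∫⁻ x in C, ENNReal.ofReal ⟪x, z⟫ * ENNReal.ofReal (rexp (-(l * ⟪x, e⟫))) =
      ∫⁻ x in C, ENNReal.ofReal ⟪x, -z⟫ * ENNReal.ofReal (rexp (-(l * ⟪x, e⟫))))
    (w : EuclideanSpace ℝ (Fin (m + 1))) :
    ∫⁻ u, ENNReal.ofReal ⟪u, w⟫ *
        ENNReal.ofReal ((coneHeight e ι C u)⁻¹ ^ (m + 2)) ∂(sphereProb m) =
      ∫⁻ u, ENNReal.ofReal ⟪u, -w⟫ *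
        ENNReal.ofReal ((coneHeight e ι C u)⁻¹ ^ (m + 2)) ∂(sphereProb m) := by
  obtain ⟨c, hc0, hct, hc⟩ := hι.exists_lintegral_eq
  obtain ⟨k, hk0, hkt, hk⟩ := exists_lintegral_homogeneous m
  have hCm : MeasurableSet C := h.isClosed.measurableSet
  have hpm := h.measurable_coneHeight hι
  set M := ∫⁻ r in Set.Ioi (0 : ℝ), ENNReal.ofReal (r ^ (m + 1)) *
    ENNReal.ofReal (rexp (-(l * r)) / l) with hM
  have key : ∀ w, ∫⁻ x in C, ENNReal.ofReal ⟪x, ι w⟫ * ENNReal.ofReal (rexp (-(l * ⟪x, e⟫))) =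
      c * (k * M) * ∫⁻ u, ENNReal.ofReal ⟪u, w⟫ *
        ENNReal.ofReal ((coneHeight e ι C u)⁻¹ ^ (m + 2)) ∂(sphereProb m) := by
    intro w
    have h1 := hk (coneHeight e ι C) 1 (fun y => ENNReal.ofReal ⟪y, w⟫)
      (fun r => ENNReal.ofReal (rexp (-(l * r)) / l)) hpm
      (fun r hr y => h.coneHeight_smul hι hr y) (fun y hy => h.coneHeight_pos hι hy)
      (by fun_prop) (fun r hr y => by
        rw [real_inner_smul_left, ENNReal.ofReal_mul hr.le, pow_one]) (by fun_prop)
    rw [← hM] at h1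
    rw [mul_assoc, ← h1, ← lintegral_indicator hCm,
      hc _ ((by fun_prop : Measurable fun x : Esp (m + 1) =>
        ENNReal.ofReal ⟪x, ι w⟫ * ENNReal.ofReal (rexp (-(l * ⟪x, e⟫)))).indicator hCm)]
    congr 1
    refine lintegral_congr fun y => ?_
    rw [← lintegral_Ici_exp_neg_mul hl, ← lintegral_const_mul _ (by fun_prop),
      ← lintegral_indicator measurableSet_Ici]
    refine lintegral_congr fun t => ?_
    by_cases ht : t • e + ι y ∈ C
    · rw [Set.indicator_of_mem ht, Set.indicator_of_mem
        (show t ∈ Set.Ici (coneHeight e ι C y) from (h.coneHeight_le_iff hι).2 ht),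
        hι.inner_add_right]
      congr 2
      have := hι.inner_add t 0 y w
      simpa using this
    · rw [Set.indicator_of_notMem ht, Set.indicator_of_notMem
        (show t ∉ Set.Ici (coneHeight e ι C y) from fun hc => ht ((h.coneHeight_le_iff hι).1 hc))]
  have hM0 : M ≠ 0 := lintegral_Ioi_pow_mul_ne_zero _ (by fun_prop) fun r => by positivity
  have hMt : M ≠ ∞ := by
    have : M = (∫⁻ r in Set.Ioi (0 : ℝ), ENNReal.ofReal (r ^ (m + 1)) *
        ENNReal.ofReal (rexp (-(l * r)))) * ENNReal.ofReal l⁻¹ := by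
      rw [hM, ← lintegral_mul_const _ (by fun_prop)]
      refine lintegral_congr fun r => ?_
      rw [div_eq_mul_inv, ENNReal.ofReal_mul (exp_pos _).le, mul_assoc]
    rw [this]
    exact ENNReal.mul_ne_top (lintegral_Ioi_pow_mul_exp_neg_mul_ne_top _ hl) ENNReal.ofReal_ne_top
  have h1 := hcen (ι w) (hι.inner_eq_zero' w)
  rw [← map_neg, key, key] at h1
  exact (ENNReal.mul_right_inj (mul_ne_zero hc0 (mul_ne_zero hk0 hM0))
    (ENNReal.mul_ne_top hct (ENNReal.mul_ne_top hkt hMt))).1 h1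

theorem IsClosedConvexCone.volume_ne_zero {d : ℕ} {C : Set (Esp d)} (h : IsClosedConvexCone C)
    (hσ : sigmaMeas d (C ∩ uSphere d) ≠ 0) : volume C ≠ 0 := by
  intro h0
  obtain ⟨k, hk0, hkt, hk⟩ := exists_lintegral_polar d
  have hCm := h.isClosed.measurableSet
  have h1 := hk (C.indicator fun _ => 1) (measurable_const.indicator hCm)
  rw [lintegral_indicator hCm, setLIntegral_one, h0, eq_comm, mul_eq_zero, or_iff_right hk0] at h1
  have hmeas : Measurable fun u : Esp d => ∫⁻ r in Set.Ioi (0 : ℝ), ENNReal.ofReal (r ^ d) *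
      C.indicator (fun _ => (1 : ℝ≥0∞)) (r • u) := by
    have : Measurable fun q : Esp d × ℝ => ENNReal.ofReal (q.2 ^ d) *
        C.indicator (fun _ => (1 : ℝ≥0∞)) (q.2 • q.1) :=
      (by fun_prop : Measurable fun q : Esp d × ℝ => ENNReal.ofReal (q.2 ^ d)).mul
        ((measurable_const.indicator hCm).comp (measurable_snd.smul measurable_fst))
    exact this.lintegral_prod_right'
  rw [lintegral_eq_zero_iff hmeas, EventuallyEq] at h1
  refine hσ ?_
  rw [sigmaMeas, uSphere, Measure.restrict_apply (hCm.inter Metric.isClosed_sphere.measurableSet),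
    Set.inter_assoc, Set.inter_self, ← Measure.restrict_apply hCm]
  refine measure_mono_null (fun u hu => ?_) h1
  intro h2
  have h3 : ∫⁻ r in Set.Ioi (0 : ℝ), ENNReal.ofReal (r ^ d) * ENNReal.ofReal 1 = 0 := by
    refine Eq.trans (setLIntegral_congr_fun measurableSet_Ioi fun r hr => ?_) h2
    beta_reduce
    rw [Set.indicator_of_mem (h.smul_mem u hu r (le_of_lt hr)), ENNReal.ofReal_one]
  exact lintegral_Ioi_pow_mul_ne_zero d measurable_const (fun _ => one_pos) h3

theorem isProbabilityMeasure_sigma0 {m : ℕ} {e : Esp (m + 1)} (he : e ∈ uSphere (m + 1)) :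
    IsProbabilityMeasure (sigma0 (m + 1) e) := by
  obtain ⟨ι, hι⟩ := exists_isOrthParam he
  rw [← map_sphereProb hι]
  exact Measure.isProbabilityMeasure_map ι.continuous.aemeasurable

theorem integral_sigma0 {m : ℕ} {e : Esp (m + 1)}
    {ι : EuclideanSpace ℝ (Fin (m + 1)) →ₗᵢ[ℝ] Esp (m + 1)} (hι : IsOrthParam e ι)
    (F : Esp (m + 1) → ℝ) : ∫ u, F u ∂(sigma0 (m + 1) e) = ∫ u, F (ι u) ∂(sphereProb m) := by
  rw [← map_sphereProb hι]
  exact ι.isometry.isClosedEmbedding.measurableEmbedding.integral_map F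

theorem sphRadial_mem_Icc {d : ℕ} (K : Set (Esp d)) (e u : Esp d) :
    sphRadial K e u ∈ Set.Icc 0 (π / 2) :=
  ⟨Real.sSup_nonneg fun _ ht => ht.1, Real.sSup_le (fun _ ht => ht.2.1) (by positivity)⟩

theorem Delta2Star_nonneg {d : ℕ} (K : Set (Esp d)) : 0 ≤ Delta2Star d K :=
  Real.sInf_nonneg (by rintro _ ⟨e, -, rfl⟩; exact Real.sqrt_nonneg _)

theorem Delta2Star_le_L2dev {d : ℕ} {K : Set (Esp d)} {e : Esp d} (he : e ∈ hemiCenters d K) :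
    Delta2Star d K ≤ L2dev d K e :=
  csInf_le ⟨0, by rintro _ ⟨e, -, rfl⟩; exact Real.sqrt_nonneg _⟩ ⟨e, he, rfl⟩

theorem L2dev_le_one {m : ℕ} (hm : 1 ≤ m) (K : Set (Esp (m + 1))) {e : Esp (m + 1)}
    (he : e ∈ uSphere (m + 1)) : L2dev (m + 1) K e ≤ 1 := by
  have := isProbabilityMeasure_sigma0 he
  have hD : ∀ u, Dfun (m + 1) (sphRadial K e u) ∈ Set.Icc (0 : ℝ) 1 := fun u => by
    have h := sphRadial_mem_Icc K e u
    exact ⟨Dfun_nonneg h.1 (by linarith [h.2, pi_pos]),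
      (Dfun_mono h.1 h.2 (by linarith [pi_pos])).trans (Dfun_pi_div_two_le_one hm)⟩
  have ha0 : 0 ≤ avgD (m + 1) K e := integral_nonneg fun u => (hD u).1
  have ha1 : avgD (m + 1) K e ≤ 1 := by
    have h1 := norm_integral_le_of_norm_le_const (μ := sigma0 (m + 1) e) (C := 1)
      (f := fun u => Dfun (m + 1) (sphRadial K e u))
      (.of_forall fun u => by rw [Real.norm_of_nonneg (hD u).1]; exact (hD u).2)
    rw [probReal_univ, mul_one] at h1
    exact (le_abs_self _).trans h1
  have hb := norm_integral_le_of_norm_le_const (μ := sigma0 (m + 1) e) (C := 1)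
    (f := fun u => (Dfun (m + 1) (sphRadial K e u) - avgD (m + 1) K e) ^ 2)
    (.of_forall fun u => by
      rw [Real.norm_of_nonneg (sq_nonneg _), sq_le_one_iff_abs_le_one, abs_le]
      exact ⟨by linarith [(hD u).1], by linarith [(hD u).2]⟩)
  rw [probReal_univ, mul_one] at hb
  rw [L2dev, Real.sqrt_le_one]
  exact (le_abs_self _).trans hb

namespace IsDualConePair

variable {m : ℕ} {e : Esp (m + 1)} {C C' : Set (Esp (m + 1))}
  {ι : EuclideanSpace ℝ (Fin (m + 1)) →ₗᵢ[ℝ] Esp (m + 1)}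

theorem mem_hemiCenters (h : IsDualConePair e C C') (he : e ∈ uSphere (m + 1)) :
    e ∈ hemiCenters (m + 1) (C ∩ uSphere (m + 1)) := by
  obtain ⟨δ, hδ, hle⟩ := h.exists_pos
  exact ⟨he, fun x hx => le_trans (by positivity) (hle x hx.1)⟩

theorem L2dev_sq (h : IsDualConePair e C C') (hι : IsOrthParam e ι) :
    L2dev (m + 1) (C ∩ uSphere (m + 1)) e ^ 2 =
      ∫ u, (Dfun (m + 1) (arctan (coneHeight e ι C u)⁻¹) -
        ∫ u, Dfun (m + 1) (arctan (coneHeight e ι C u)⁻¹) ∂(sphereProb m)) ^ 2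
          ∂(sphereProb m) := by
  have havg : avgD (m + 1) (C ∩ uSphere (m + 1)) e =
      ∫ u, Dfun (m + 1) (arctan (coneHeight e ι C u)⁻¹) ∂(sphereProb m) := by
    rw [avgD, integral_sigma0 hι]
    refine integral_congr_ae ?_
    filter_upwards [ae_sphereProb_norm_eq_one m] with u hu
    rw [h.sphRadial_eq hι hu]
  rw [L2dev, Real.sq_sqrt (integral_nonneg fun u => sq_nonneg _), havg, integral_sigma0 hι]
  refine integral_congr_ae ?_
  filter_upwards [ae_sphereProb_norm_eq_one m] with u hu
  rw [h.sphRadial_eq hι hu]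

end IsDualConePair

/-- The stability inequality for line-free cones, in terms of the first constant only. -/
theorem U1_ge_of_lineFree {m : ℕ} (hm : 1 ≤ m) {C : Set (Esp (m + 1))} (hC : IsClosedConvexCone C)
    (hl : ∀ x ∈ C, x ≠ 0 → -x ∉ C) {e : Esp (m + 1)} (he : e ∈ uSphere (m + 1)) {α α₀ : ℝ}
    (hσ : sigmaMeas (m + 1) (C ∩ uSphere (m + 1)) = sigmaMeas (m + 1) (cap e α))
    (hpos : 0 < sigmaMeas (m + 1) (C ∩ uSphere (m + 1))) (hα₀ : 0 < α₀) (hle : α₀ ≤ α)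
    (hα : α < π / 2) {β : ℝ} (hβ : 0 ≤ β)
    (hβ' : β ≤ 2 * ((((m + 1 + 1).choose 2 : ℝ) * Real.sin α₀ ^ (m + 1 + 1) *
        (Real.tan α ^ (2 * (m + 1)))⁻¹) / (((m + 1 : ℕ) : ℝ) + ((m + 1 : ℕ) : ℝ) *
          ((m + 1 + 1).choose 2 : ℝ) * (π / 2) ^ 2 * (Real.tan α ^ (m + 1))⁻¹))) :
    (1 + β * Delta2Star (m + 1) (C ∩ uSphere (m + 1)) ^ 2) * U1 (m + 1) (cap e α) ≤
      U1 (m + 1) (C ∩ uSphere (m + 1)) := by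
  have hα0 : 0 < α := hα₀.trans_le hle
  obtain ⟨v, hv, C', h, l, hlpos, hcen⟩ :=
    hC.exists_isDualConePair_centered hl (hC.volume_ne_zero hpos.ne')
  obtain ⟨ι, hι⟩ := exists_isOrthParam hv
  have hS := h.integral_mul_integral_le_one hι
    (h.lintegral_inner_mul_inv_coneHeight_eq hι hlpos hcen)
  have hmem : ∀ D D' : Set (Esp (m + 1)), IsDualConePair v D D' → ∀ u,
      arctan (coneHeight v ι D u)⁻¹ ∈ Set.Ico 0 (π / 2) := fun D D' hD u =>
    ⟨arctan_nonneg.2 (inv_nonneg.2 (hD.coneHeight_nonneg hι u)), arctan_lt_pi_div_two _⟩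
  have hmeas : ∀ D D' : Set (Esp (m + 1)), IsDualConePair v D D' →
      Measurable fun u => arctan (coneHeight v ι D u)⁻¹ := fun D D' hD =>
    measurable_arctan.comp (hD.measurable_coneHeight hι).inv
  have hintg : ∫ u, Dfun (m + 1) (arctan (coneHeight v ι C u)⁻¹) ∂(sphereProb m) =
      Dfun (m + 1) α := by
    have h0 : 0 ≤ ∫ u, Dfun (m + 1) (arctan (coneHeight v ι C u)⁻¹) ∂(sphereProb m) :=
      integral_nonneg fun u => Dfun_nonneg (hmem C C' h u).1
        (by linarith [(hmem C C' h u).2, pi_pos])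
    rw [h.sigmaMeas_inter hι, sigmaMeas_cap he hα0.le (by linarith [pi_pos]),
      ENNReal.mul_right_inj sigmaConst_ne_zero sigmaConst_ne_top,
      ENNReal.ofReal_eq_ofReal_iff h0 (Dfun_nonneg hα0.le (by linarith [pi_pos]))] at hσ
    exact hσ
  have hpolar := integral_Dfun_le_of_polar hm (μ := sphereProb m) (hmeas C C' h)
    (hmeas C' C h.symm) (hmem C C' h) (hmem C' C h.symm)
    (by simpa only [tan_arctan] using h.integrable_inv_coneHeight_pow hι (m + 1))
    (by simpa only [tan_arctan] using h.symm.integrable_inv_coneHeight_pow hι (m + 1))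
    (by simpa only [tan_arctan] using hS) hα₀ hle hα hintg
  have hV := h.L2dev_sq hι
  rw [hintg] at hV
  rw [← hV] at hpolar
  have hΔ : Delta2Star (m + 1) (C ∩ uSphere (m + 1)) ^ 2 ≤
      L2dev (m + 1) (C ∩ uSphere (m + 1)) v ^ 2 :=
    pow_le_pow_left₀ (Delta2Star_nonneg _) (Delta2Star_le_L2dev (h.mem_hemiCenters hv)) 2
  have hH := Dfun_pi_div_two_pos (m := m)
  have hG : 0 < Dfun (m + 1) (π / 2) - Dfun (m + 1) (π / 2 - α) :=
    sub_pos.2 (Dfun_lt (by linarith) (by linarith) (by linarith [pi_pos]))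
  have hβΔ : β * Delta2Star (m + 1) (C ∩ uSphere (m + 1)) ^ 2 ≤
      2 * ((((m + 1 + 1).choose 2 : ℝ) * Real.sin α₀ ^ (m + 1 + 1) *
        (Real.tan α ^ (2 * (m + 1)))⁻¹) / (((m + 1 : ℕ) : ℝ) + ((m + 1 : ℕ) : ℝ) *
          ((m + 1 + 1).choose 2 : ℝ) * (π / 2) ^ 2 * (Real.tan α ^ (m + 1))⁻¹)) *
        L2dev (m + 1) (C ∩ uSphere (m + 1)) v ^ 2 :=
    mul_le_mul hβ' hΔ (sq_nonneg _) (hβ.trans hβ')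
  have hmul := mul_le_mul_of_nonneg_right hβΔ hG.le
  refine le_trans ?_ (h.U1_ge hι)
  refine le_trans (mul_le_mul_of_nonneg_left (U1_cap_le he hα0.le hα.le)
    (add_nonneg zero_le_one (mul_nonneg hβ (sq_nonneg _)))) ?_
  rw [← mul_div_assoc]
  gcongr
  linarith

theorem IsClosedConvexCone.half_le_U1_of_line {m : ℕ} {C : Set (Esp (m + 1))}
    (hC : IsClosedConvexCone C) (hvol : volume C ≠ 0) {p : Esp (m + 1)} (hp : p ∈ C) (hp0 : p ≠ 0)
    (hp' : -p ∈ C) : 1 / 2 ≤ U1 (m + 1) (C ∩ uSphere (m + 1)) := by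
  have hnorm : ∀ x ∈ C, x ≠ 0 → ∀ z, ⟪z, x⟫ = 0 →
      ∃ y ∈ C ∩ uSphere (m + 1), ⟪z, y⟫ = 0 := fun x hx hx0 z hz =>
    ⟨‖x‖⁻¹ • x, ⟨hC.smul_mem x hx _ (by positivity), by simp [uSphere, norm_smul, hx0]⟩,
      by rw [real_inner_smul_right, hz, mul_zero]⟩
  have hline : ∀ t : ℝ, t • p ∈ C := fun t => by
    rcases le_total 0 t with ht | ht
    · exact hC.smul_mem p hp t ht
    · simpa using hC.smul_mem _ hp' (-t) (by linarith)
  obtain ⟨q, hq, hqp⟩ : ∃ q ∈ C, q ∉ (ℝ ∙ p) := by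
    by_contra! hsub
    refine hvol (measure_mono_null (t := ((ℝ ∙ p : Submodule ℝ (Esp (m + 1))) : Set _)) (fun q hq => hsub q hq) ?_)
    refine Measure.addHaar_submodule _ _ fun htop => ?_
    have h1 := finrank_span_singleton (K := ℝ) hp0
    rw [htop, finrank_top] at h1
    simp at h1
  have hall : uSphere (m + 1) ⊆ {x | ∃ y ∈ C ∩ uSphere (m + 1), ⟪x, y⟫ = 0} := by
    intro x _
    by_cases hxp : ⟪x, p⟫ = 0
    · exact hnorm p hp hp0 x hxp
    · refine hnorm (q + (-(⟪x, q⟫ / ⟪x, p⟫)) • p) (hC.add_mem hq (hline _)) (fun h0 => hqp ?_) x ?_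
      · rw [add_eq_zero_iff_eq_neg] at h0
        rw [h0]
        exact neg_mem (Submodule.smul_mem _ _ (Submodule.mem_span_singleton_self p))
      · rw [inner_add_right, real_inner_smul_right]
        field_simp
        ring
  have hω : 0 < omegaTot (m + 1) :=
    ENNReal.toReal_pos sigmaMeas_uSphere_ne_zero sigmaMeas_uSphere_ne_top
  have h1 : omegaTot (m + 1) ≤
      (sigmaMeas (m + 1) {x | ∃ y ∈ C ∩ uSphere (m + 1), ⟪x, y⟫ = 0}).toReal :=
    ENNReal.toReal_mono (measure_ne_top _ _) (measure_mono hall)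
  calc (1 : ℝ) / 2 = 1 / (2 * omegaTot (m + 1)) * omegaTot (m + 1) := by field_simp
    _ ≤ U1 (m + 1) (C ∩ uSphere (m + 1)) := by
      rw [U1]; gcongr

theorem IsClosedConvexCone.hemiCenters_nonempty {d : ℕ} {C : Set (Esp d)}
    (hC : IsClosedConvexCone C) (hne : C ≠ Set.univ) :
    (hemiCenters d (C ∩ uSphere d)).Nonempty := by
  obtain ⟨z, hz⟩ := (Set.ne_univ_iff_exists_notMem C).1 hne
  obtain ⟨y, hy, hzy⟩ := hC.exists_separating hz
  have hy0 : y ≠ 0 := by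
    rintro rfl
    simp at hzy
  refine ⟨‖y‖⁻¹ • y, by simp [uSphere, norm_smul, hy0], fun x hx => ?_⟩
  rw [real_inner_smul_right]
  exact mul_nonneg (by positivity) (hy x hx.1)

/-- The stability inequality for cones containing a line, in terms of the second constant only. -/
theorem U1_ge_of_line {m : ℕ} (hm : 1 ≤ m) {C : Set (Esp (m + 1))} (hC : IsClosedConvexCone C)
    (hne : C ≠ Set.univ) (hvol : volume C ≠ 0) {p : Esp (m + 1)} (hp : p ∈ C) (hp0 : p ≠ 0)
    (hp' : -p ∈ C) {e : Esp (m + 1)} (he : e ∈ uSphere (m + 1)) {α : ℝ} (hα0 : 0 < α)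
    (hα : α < π / 2) {β : ℝ} (hβ : 0 ≤ β)
    (hβ' : β ≤ 2 * ((2 / π) ^ 2 * Dfun (m + 1) (π / 2 - α))) :
    (1 + β * Delta2Star (m + 1) (C ∩ uSphere (m + 1)) ^ 2) * U1 (m + 1) (cap e α) ≤
      U1 (m + 1) (C ∩ uSphere (m + 1)) := by
  refine le_trans ?_ (hC.half_le_U1_of_line hvol hp hp0 hp')
  obtain ⟨v, hv⟩ := hC.hemiCenters_nonempty hne
  have hΔ0 := Delta2Star_nonneg (C ∩ uSphere (m + 1))
  have hΔ : Delta2Star (m + 1) (C ∩ uSphere (m + 1)) ^ 2 ≤ 1 :=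
    pow_le_one₀ hΔ0 ((Delta2Star_le_L2dev hv).trans (L2dev_le_one hm _ hv.1))
  have hH := Dfun_pi_div_two_pos (m := m)
  have hH1 := Dfun_pi_div_two_le_one hm
  have hG0 : 0 ≤ Dfun (m + 1) (π / 2 - α) := Dfun_nonneg (by linarith) (by linarith [pi_pos])
  have hG1 : Dfun (m + 1) (π / 2 - α) ≤ Dfun (m + 1) (π / 2) :=
    Dfun_mono (by linarith) (by linarith) (by linarith [pi_pos])
  have hπ : 2 * (2 / π) ^ 2 ≤ 1 := by
    have := pi_gt_three
    rw [div_pow, mul_div_assoc', div_le_one (by positivity)]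
    nlinarith
  have hβG : β ≤ Dfun (m + 1) (π / 2 - α) := hβ'.trans (by nlinarith)
  have hβΔ : β * Delta2Star (m + 1) (C ∩ uSphere (m + 1)) ^ 2 ≤ Dfun (m + 1) (π / 2 - α) :=
    (mul_le_of_le_one_right hβ hΔ).trans hβG
  refine le_trans (mul_le_mul_of_nonneg_left (U1_cap_le he hα0.le hα.le)
    (add_nonneg zero_le_one (mul_nonneg hβ (sq_nonneg _)))) ?_
  rw [← mul_div_assoc, div_le_div_iff₀ (by positivity) two_pos]
  have hmul := mul_le_mul_of_nonneg_right hβΔ (sub_nonneg.2 hG1)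
  nlinarith

theorem negIntPolar_nonempty {d : ℕ} {K : Set (Esp d)} (hK : IsProperSphConvBody d K) :
    (negIntPolar d K).Nonempty := by
  obtain ⟨C, hcl, hconv, hs, -, hl, rfl⟩ := hK
  rcases (C \ {0}).eq_empty_or_nonempty with hE | ⟨p, hp, hp0⟩
  · obtain ⟨e, he⟩ := (NormedSpace.sphere_nonempty (x := (0 : Esp d)) (r := 1)).2 zero_le_one
    refine ⟨e, he, fun x hx => ?_⟩
    have hx0 : x ∈ C \ {0} := ⟨hx.1, by rintro rfl; simpa [uSphere] using hx.2⟩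
    rw [hE] at hx0
    exact absurd hx0 (Set.notMem_empty x)
  · obtain ⟨v, hv⟩ := (IsClosedConvexCone.mk hcl hconv hs ⟨p, hp⟩).exists_inner_pos hl
    have hv0 : v ≠ 0 := by
      rintro rfl
      simpa using hv p hp hp0
    refine ⟨‖v‖⁻¹ • v, by simp [uSphere, norm_smul, hv0], fun x hx => ?_⟩
    have hn : 0 < ‖v‖ := norm_pos_iff.2 hv0
    rw [real_inner_comm, real_inner_smul_right]
    exact mul_pos (inv_pos.2 hn) (hv x hx.1 (by rintro rfl; simpa [uSphere] using hx.2))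

theorem Delta2Star_le_Delta2 {d : ℕ} {K : Set (Esp d)}
    (hK : IsProperSphConvBody d K) : Delta2Star d K ≤ Delta2 d K := by
  refine csInf_le_csInf ⟨0, ?_⟩ ((negIntPolar_nonempty hK).image _) (Set.image_mono ?_)
  · rintro _ ⟨e, -, rfl⟩
    exact Real.sqrt_nonneg _
  · exact fun e he => ⟨he.1, fun x hx => by rw [real_inner_comm]; exact (he.2 x hx).le⟩

/-- Remark 4.2. The stability inequality of Theorem 4.1 holds with
`Δ₂*` on all of `𝒦̄_s^d`, and `Δ₂*(K) ≤ Δ₂(K)` for proper bodies `K ∈ 𝒦_s^d`. -/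
theorem statement1 (d : ℕ) (hd : 2 ≤ d) :
    (∀ K : Set (Esp d), IsSphConvBody d K → ∀ e : Esp d, e ∈ uSphere d → ∀ αC α0 : ℝ,
      sigmaMeas d K = sigmaMeas d (cap e αC) → 0 < sigmaMeas d K →
      0 < αC → αC < π / 2 → 0 < α0 → α0 < π / 2 → α0 ≤ αC →
      U1 d K ≥ (1 + (2 * min
          ((((d + 1).choose 2 : ℝ) * Real.sin α0 ^ (d + 1) * (Real.tan αC ^ (2 * d))⁻¹) /
            ((d : ℝ) + (d : ℝ) * ((d + 1).choose 2 : ℝ) * (π / 2) ^ 2 * (Real.tan αC ^ d)⁻¹))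
          ((2 / π) ^ 2 * Dfun d (π / 2 - αC))) * Delta2Star d K ^ 2) * U1 d (cap e αC)) ∧
    (∀ K : Set (Esp d), IsProperSphConvBody d K → Delta2Star d K ≤ Delta2 d K) := by
  obtain ⟨m, rfl⟩ : ∃ m, d = m + 1 := ⟨d - 1, by omega⟩
  have hm : 1 ≤ m := by omega
  refine ⟨?_, fun K hK => Delta2Star_le_Delta2 hK⟩
  rintro K ⟨C, hcl, hconv, hs, -, hsub, rfl⟩ e he αC α0 hσ hpos hα hα' h0 h0' hle
  have hCne : C.Nonempty := by
    rw [Set.nonempty_iff_ne_empty]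
    rintro rfl
    simp at hpos
  have hC : IsClosedConvexCone C := ⟨hcl, hconv, hs, hCne⟩
  have hG0 : 0 ≤ Dfun (m + 1) (π / 2 - αC) := Dfun_nonneg (by linarith) (by linarith [pi_pos])
  have hsin : 0 < Real.sin α0 := Real.sin_pos_of_pos_of_lt_pi h0 (by linarith [pi_pos])
  have htan : 0 < Real.tan αC := Real.tan_pos_of_pos_of_lt_pi_div_two hα hα'
  have hβ : 0 ≤ 2 * min
      ((((m + 1 + 1).choose 2 : ℝ) * Real.sin α0 ^ (m + 1 + 1) *
        (Real.tan αC ^ (2 * (m + 1)))⁻¹) / (((m + 1 : ℕ) : ℝ) + ((m + 1 : ℕ) : ℝ) *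
          ((m + 1 + 1).choose 2 : ℝ) * (π / 2) ^ 2 * (Real.tan αC ^ (m + 1))⁻¹))
      ((2 / π) ^ 2 * Dfun (m + 1) (π / 2 - αC)) :=
    mul_nonneg two_pos.le (le_min (by positivity) (by positivity))
  by_cases hl : ∀ x ∈ C, x ≠ 0 → -x ∉ C
  · exact U1_ge_of_lineFree hm hC hl he hσ hpos h0 hle hα' hβ
      (mul_le_mul_of_nonneg_left (min_le_left _ _) two_pos.le)
  · push Not at hl
    obtain ⟨p, hp, hp0, hp'⟩ := hl
    exact U1_ge_of_line hm hC (fun hu => hsub ⊤ (by simpa using hu)) (hC.volume_ne_zero hpos.ne')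
      hp hp0 hp' he hα hα' hβ (mul_le_mul_of_nonneg_left (min_le_right _ _) two_pos.le)

end
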